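/- For every λ > 0 there exists a triple (f, g, h) of smooth functions on (0,∞)² with 0 ≤ f, g, h ≤ 1 satisfying the system f₁₁ + f₂₂ + f₁/r₁ + f₂/r₂ − f(1−g)²/r₁² − f(1−h)²/r₂² − (λ/2)(f² − 1)f = 0, g₁₁ + g₂₂ − g₁/r₁ + g₂/r₂ + f² − f²g = 0, h₁₁ + h₂₂ + h₁/r₁ − h₂/r₂ + f² − f²h = 0, such that: f extends continuously to [0,∞)² with boundary values f(r₁, 0) = f(0, r₂) = 0 (equivalently ψ = 0 on Π₁ ∪ Π₂ for the associated ansatz), f > 0 on the open quadrant (0,∞)², g(r₁, r₂) = h(r₂, r₁) for all r₁, r₂ > 0, and g extends continuously with g(0, r₂) = 0 (g vanishes on the r₂-axis). -/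

import Mathlib

/- STATEMENT 4: existence of a solution (f, g, h) of the reduced saddle system
on the quadrant, with 0 ≤ f, g, h ≤ 1, zero boundary values for f on the axes,
f > 0 inside, the symmetry g(r₁,r₂) = h(r₂,r₁), and g vanishing on the r₂-axis. -/

noncomputable section

/-- Partial derivative in the first variable. -/
def d1 (f : ℝ → ℝ → ℝ) (a b : ℝ) : ℝ := deriv (fun t => f t b) a
/-- Partial derivative in the second variable. -/
def d2 (f : ℝ → ℝ → ℝ) (a b : ℝ) : ℝ := deriv (fun t => f a t) b

namespace SaddleProfile

open MeasureTheory Set Filter Topology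
open scoped ContDiff

/-- Directional derivative of a function on the plane. -/
def pd (v : ℝ × ℝ) (f : ℝ × ℝ → ℝ) : ℝ × ℝ → ℝ := fun x => fderiv ℝ f x v

/-- The Laplacian on the plane. -/
def lap (f : ℝ × ℝ → ℝ) : ℝ × ℝ → ℝ := fun x =>
  pd (1, 0) (pd (1, 0) f) x + pd (0, 1) (pd (0, 1) f) x

/-- The squared Euclidean length on the plane. -/
def sqLen (y : ℝ × ℝ) : ℝ := y.1 ^ 2 + y.2 ^ 2

/-- The regularised logarithmic potential on the plane. -/
def logPot (δ : ℝ) (y : ℝ × ℝ) : ℝ := Real.log (δ ^ 2 + sqLen y)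

/-- The coordinate derivatives of the regularised logarithmic potential, contracted with `v`. -/
def logPotDeriv (δ : ℝ) (v y : ℝ × ℝ) : ℝ :=
  2 * (y.1 * v.1 + y.2 * v.2) / (δ ^ 2 + sqLen y)

theorem sqLen_nonneg (y : ℝ × ℝ) : 0 ≤ sqLen y := by unfold sqLen; positivity

theorem norm_sq_le_sqLen (y : ℝ × ℝ) : ‖y‖ ^ 2 ≤ sqLen y := by
  unfold sqLen
  rw [Prod.norm_def]
  rcases max_cases ‖y.1‖ ‖y.2‖ with ⟨h, _⟩ | ⟨h, _⟩ <;> rw [h] <;>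
    simp [sq_abs] <;> positivity

theorem sqLen_le (y : ℝ × ℝ) : sqLen y ≤ 2 * ‖y‖ ^ 2 := by
  unfold sqLen
  have h1 : y.1 ^ 2 ≤ ‖y‖ ^ 2 := by
    rw [← sq_abs]; exact pow_le_pow_left₀ (abs_nonneg _) (norm_fst_le y) 2
  have h2 : y.2 ^ 2 ≤ ‖y‖ ^ 2 := by
    rw [← sq_abs]; exact pow_le_pow_left₀ (abs_nonneg _) (norm_snd_le y) 2
  linarith

theorem contDiff_sqLen : ContDiff ℝ ∞ sqLen := by unfold sqLen; fun_prop

theorem pd_contDiff {f : ℝ × ℝ → ℝ} (hf : ContDiff ℝ ∞ f) (v : ℝ × ℝ) : ContDiff ℝ ∞ (pd v f) := by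
  have := hf.fderiv_right (m := ∞) (by simp)
  exact this.clm_apply contDiff_const

theorem pd_mul {f g : ℝ × ℝ → ℝ} {x : ℝ × ℝ} (hf : DifferentiableAt ℝ f x)
    (hg : DifferentiableAt ℝ g x) (v : ℝ × ℝ) :
    pd v (fun y => f y * g y) x = f x * pd v g x + pd v f x * g x := by
  unfold pd
  rw [fderiv_fun_mul hf hg]
  simp [mul_comm]

theorem pd_add {f g : ℝ × ℝ → ℝ} {x : ℝ × ℝ} (hf : DifferentiableAt ℝ f x)
    (hg : DifferentiableAt ℝ g x) (v : ℝ × ℝ) :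
    pd v (fun y => f y + g y) x = pd v f x + pd v g x := by
  unfold pd
  rw [fderiv_fun_add hf hg]
  simp

theorem pd_pd_mul {f g : ℝ × ℝ → ℝ} (hf : ContDiff ℝ ∞ f) (hg : ContDiff ℝ ∞ g) (v x : ℝ × ℝ) :
    pd v (pd v (fun y => f y * g y)) x
      = f x * pd v (pd v g) x + 2 * (pd v f x * pd v g x) + pd v (pd v f) x * g x := by
  have df := hf.differentiable (by simp)
  have dg := hg.differentiable (by simp)
  have df' := (pd_contDiff hf v).differentiable (by simp)
  have dg' := (pd_contDiff hg v).differentiable (by simp)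
  have : pd v (fun y => f y * g y) = fun y => f y * pd v g y + pd v f y * g y := by
    funext y; exact pd_mul (df y) (dg y) v
  rw [this, pd_add ((df x).fun_mul (dg' x)) ((df' x).fun_mul (dg x)), pd_mul (df x) (dg' x),
    pd_mul (df' x) (dg x)]
  ring

theorem pd_comp_const_sub {f : ℝ × ℝ → ℝ} (hf : ContDiff ℝ ∞ f) (v a : ℝ × ℝ) :
    pd v (fun y => f (a - y)) = fun y => -pd v f (a - y) := by
  funext y
  unfold pd
  have h1 : HasFDerivAt (fun y : ℝ × ℝ => a - y) (-ContinuousLinearMap.id ℝ (ℝ × ℝ)) y := by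
    simpa using (hasFDerivAt_id y).const_sub a
  have h2 := ((hf.differentiable (by simp)) (a - y)).hasFDerivAt.comp y h1
  have h3 := h2.fderiv
  simp only [Function.comp_def] at h3
  rw [h3]; simp

theorem lap_comp_const_sub {f : ℝ × ℝ → ℝ} (hf : ContDiff ℝ ∞ f) (a y : ℝ × ℝ) :
    lap (fun y => f (a - y)) y = lap f (a - y) := by
  unfold lap
  have key : ∀ v : ℝ × ℝ, pd v (pd v (fun y => f (a - y))) y = pd v (pd v f) (a - y) := by
    intro v
    rw [pd_comp_const_sub hf]
    have h : pd v (fun y => -pd v f (a - y)) y = - pd v (fun y => pd v f (a - y)) y := by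
      unfold pd; rw [fderiv_fun_neg]; simp
    rw [h, pd_comp_const_sub (pd_contDiff hf v)]; simp
  rw [key, key]

theorem contDiff_logPot {δ : ℝ} (hδ : 0 < δ) : ContDiff ℝ ∞ (logPot δ) := by
  unfold logPot
  refine (contDiff_const.add contDiff_sqLen).log fun y => ?_
  have := sqLen_nonneg y
  positivity

theorem contDiffAt_logPot_zero {y : ℝ × ℝ} (hy : y ≠ 0) : ContDiffAt ℝ ∞ (logPot 0) y := by
  unfold logPot
  refine (contDiff_const.add contDiff_sqLen).contDiffAt.log ?_
  have := norm_sq_le_sqLen y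
  have h : 0 < ‖y‖ ^ 2 := by positivity
  intro h0
  linarith

theorem pd_logPot {δ : ℝ} {y : ℝ × ℝ} (h : δ ^ 2 + sqLen y ≠ 0) (v : ℝ × ℝ) :
    pd v (logPot δ) y = logPotDeriv δ v y := by
  have h1 : HasFDerivAt (fun y : ℝ × ℝ => y.1) (ContinuousLinearMap.fst ℝ ℝ ℝ) y := hasFDerivAt_fst
  have h2 : HasFDerivAt (fun y : ℝ × ℝ => y.2) (ContinuousLinearMap.snd ℝ ℝ ℝ) y := hasFDerivAt_snd
  have h3 := (((h1.pow 2).fun_add (h2.pow 2)).const_add (δ ^ 2)).log h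
  unfold pd
  have : logPot δ = fun y : ℝ × ℝ => Real.log (δ ^ 2 + (y.1 ^ 2 + y.2 ^ 2)) := rfl
  rw [this, h3.fderiv]
  simp [logPotDeriv, sqLen]
  field_simp

theorem lap_logPot {δ : ℝ} (hδ : 0 < δ) (y : ℝ × ℝ) :
    lap (logPot δ) y = 4 * δ ^ 2 / (δ ^ 2 + sqLen y) ^ 2 := by
  have pos : ∀ y, 0 < δ ^ 2 + sqLen y := fun y => by
    have := sqLen_nonneg y; positivity
  have e1 : ∀ v : ℝ × ℝ, pd v (logPot δ) = logPotDeriv δ v := fun v => by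
    funext y; exact pd_logPot (pos y).ne' v
  have key : ∀ v : ℝ × ℝ, pd v (logPotDeriv δ v) y =
      (2 * (v.1 ^ 2 + v.2 ^ 2) * (δ ^ 2 + sqLen y) - 4 * (y.1 * v.1 + y.2 * v.2) ^ 2)
        / (δ ^ 2 + sqLen y) ^ 2 := by
    intro v
    have h1 : HasFDerivAt (fun y : ℝ × ℝ => y.1) (ContinuousLinearMap.fst ℝ ℝ ℝ) y := hasFDerivAt_fst
    have h2 : HasFDerivAt (fun y : ℝ × ℝ => y.2) (ContinuousLinearMap.snd ℝ ℝ ℝ) y := hasFDerivAt_snd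
    have h3 := (((h1.pow 2).fun_add (h2.pow 2)).const_add (δ ^ 2))
    have h4 := ((h1.mul_const v.1).fun_add (h2.mul_const v.2)).const_mul 2
    have h5 := h4.fun_mul ((hasDerivAt_inv (pos y).ne').comp_hasFDerivAt y h3)
    unfold pd
    have : logPotDeriv δ v = fun y : ℝ × ℝ =>
        2 * (y.1 * v.1 + y.2 * v.2) * (δ ^ 2 + (y.1 ^ 2 + y.2 ^ 2))⁻¹ := by
      funext y; simp [logPotDeriv, sqLen, div_eq_mul_inv]
    rw [this]; erw [h5.fderiv]
    have p := (pos y).ne'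
    simp [sqLen] at p ⊢
    field_simp
    ring
  unfold lap
  rw [e1, e1, key, key]
  have p := (pos y).ne'
  rw [← add_div]
  congr 1
  simp [sqLen]; ring

theorem abs_logPotDeriv_le (δ : ℝ) (v : ℝ × ℝ) {y : ℝ × ℝ} (hy : y ≠ 0) :
    |logPotDeriv δ v y| ≤ 4 * ‖v‖ * ‖y‖⁻¹ := by
  have hn : 0 < ‖y‖ := norm_pos_iff.2 hy
  have h1 : |y.1 * v.1 + y.2 * v.2| ≤ 2 * (‖y‖ * ‖v‖) := by
    have a := mul_le_mul (norm_fst_le y) (norm_fst_le v) (norm_nonneg _) (norm_nonneg _)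
    have b := mul_le_mul (norm_snd_le y) (norm_snd_le v) (norm_nonneg _) (norm_nonneg _)
    rw [← norm_mul] at a b
    rw [Real.norm_eq_abs] at a b
    have := abs_add_le (y.1 * v.1) (y.2 * v.2)
    linarith
  have h2 : ‖y‖ ^ 2 ≤ δ ^ 2 + sqLen y := by
    have := norm_sq_le_sqLen y; nlinarith [sq_nonneg δ]
  have h3 : 0 < δ ^ 2 + sqLen y := lt_of_lt_of_le (by positivity) h2
  unfold logPotDeriv
  rw [abs_div, abs_mul, abs_of_pos h3, abs_two, div_le_iff₀ h3]
  have : 4 * ‖v‖ * ‖y‖⁻¹ * ‖y‖ ^ 2 ≤ 4 * ‖v‖ * ‖y‖⁻¹ * (δ ^ 2 + sqLen y) := by gcongr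
  have e : 4 * ‖v‖ * ‖y‖⁻¹ * ‖y‖ ^ 2 = 2 * (2 * (‖y‖ * ‖v‖)) := by field_simp; ring
  linarith

theorem abs_logPot_le {δ : ℝ} (h0 : 0 ≤ δ) (h1 : δ ≤ 1) {y : ℝ × ℝ} (hy : y ≠ 0) :
    |logPot δ y| ≤ 2 * ‖y‖ ^ 2 + 2 * ‖y‖⁻¹ := by
  have hn : 0 < ‖y‖ := norm_pos_iff.2 hy
  have h2 : ‖y‖ ^ 2 ≤ δ ^ 2 + sqLen y := by
    have := norm_sq_le_sqLen y; nlinarith [sq_nonneg δ]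
  have h3 : 0 < δ ^ 2 + sqLen y := lt_of_lt_of_le (by positivity) h2
  unfold logPot
  have hup : Real.log (δ ^ 2 + sqLen y) ≤ 2 * ‖y‖ ^ 2 := by
    have := Real.log_le_sub_one_of_pos h3
    have := sqLen_le y
    nlinarith
  have hlo : -(2 * ‖y‖⁻¹) ≤ Real.log (δ ^ 2 + sqLen y) := by
    have a := Real.log_le_log (by positivity) h2
    rw [Real.log_pow] at a
    have b := Real.one_sub_inv_le_log_of_pos hn
    push_cast at a
    linarith
  have := inv_pos.2 hn
  rw [abs_le]
  constructor <;> nlinarith [sq_nonneg ‖y‖]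

theorem integrable_mul_norm_inv {c : ℝ × ℝ → ℝ} (hc : Continuous c) (hs : HasCompactSupport c) :
    Integrable fun y => c y * (1 + 2 * ‖y‖ ^ 2 + ‖y‖⁻¹) := by
  obtain ⟨R, hR⟩ := hs.isBounded.subset_ball 0
  obtain ⟨C, hC⟩ := hc.bounded_above_of_compact_support hs
  have i1 : Integrable fun y : ℝ × ℝ => (indicator (Iio R) (fun r : ℝ => r⁻¹)) ‖y‖ := by
    rw [integrable_fun_norm_addHaar]
    have : IntegrableOn (indicator (Iio R) (fun _ : ℝ => (1 : ℝ))) (Ioi 0) := by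
      rw [IntegrableOn, integrable_indicator_iff measurableSet_Iio, IntegrableOn,
        Measure.restrict_restrict measurableSet_Iio]
      have : Iio R ∩ Ioi 0 = Ioo 0 R := by ext; simp [and_comm]
      rw [this]
      simp
    refine this.congr_fun (fun r hr => ?_) measurableSet_Ioi
    have hr' : r ≠ 0 := ne_of_gt hr
    by_cases h : r < R
    · simp [indicator, h, hr']
    · simp [indicator, h]
  have i2 : Integrable fun y : ℝ × ℝ => c y * ‖y‖⁻¹ := by
    refine (i1.const_mul C).mono' (hc.measurable.mul (by fun_prop)).aestronglyMeasurable
      (ae_of_all _ fun y => ?_)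
    by_cases hy : y ∈ tsupport c
    · have : ‖y‖ < R := by simpa using hR hy
      simp only [indicator, mem_Iio, this, if_true]
      rw [norm_mul, norm_inv, norm_norm]
      gcongr
      exact hC y
    · rw [image_eq_zero_of_notMem_tsupport hy]
      have hC0 : 0 ≤ C := (norm_nonneg _).trans (hC 0)
      simp only [zero_mul, norm_zero]
      exact mul_nonneg hC0 (Set.indicator_apply_nonneg fun _ => by positivity)
  have i3 : Integrable fun y : ℝ × ℝ => c y * (1 + 2 * ‖y‖ ^ 2) :=
    (hc.mul (by fun_prop)).integrable_of_hasCompactSupport hs.mul_right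
  refine (i3.add i2).congr (ae_of_all _ fun y => ?_)
  simp only [Pi.add_apply]; ring

/-- A kernel built from the logarithmic potential and its derivative. -/
def logKernel (c₁ c₂ : ℝ × ℝ → ℝ) (v : ℝ × ℝ) (δ : ℝ) (y : ℝ × ℝ) : ℝ :=
  c₁ y * logPotDeriv δ v y + c₂ y * logPot δ y

theorem measurable_logKernel {c₁ c₂ : ℝ × ℝ → ℝ} (h₁ : Continuous c₁) (h₂ : Continuous c₂)
    (v : ℝ × ℝ) (δ : ℝ) : Measurable (logKernel c₁ c₂ v δ) := by
  unfold logKernel logPotDeriv logPot sqLen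
  have := h₁.measurable
  have := h₂.measurable
  fun_prop

theorem abs_logKernel_le (c₁ c₂ : ℝ × ℝ → ℝ) (v : ℝ × ℝ) {δ : ℝ} (h0 : 0 ≤ δ) (h1 : δ ≤ 1)
    {y : ℝ × ℝ} (hy : y ≠ 0) :
    ‖logKernel c₁ c₂ v δ y‖ ≤
      (4 * ‖v‖ * |c₁ y| + 2 * |c₂ y|) * (1 + 2 * ‖y‖ ^ 2 + ‖y‖⁻¹) := by
  have a := abs_logPotDeriv_le δ v hy
  have b := abs_logPot_le h0 h1 hy
  have hn : 0 < ‖y‖⁻¹ := inv_pos.2 (norm_pos_iff.2 hy)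
  unfold logKernel
  calc _ ≤ |c₁ y| * |logPotDeriv δ v y| + |c₂ y| * |logPot δ y| := by
        rw [← abs_mul, ← abs_mul]; exact abs_add_le _ _
    _ ≤ |c₁ y| * (4 * ‖v‖ * ‖y‖⁻¹) + |c₂ y| * (2 * ‖y‖ ^ 2 + 2 * ‖y‖⁻¹) := by gcongr
    _ ≤ _ := by
        have p : 0 ≤ ‖v‖ * |c₁ y| := by positivity
        have q : 0 ≤ |c₂ y| := abs_nonneg _
        have : 0 ≤ ‖y‖ ^ 2 := by positivity
        nlinarith [mul_nonneg p this, mul_nonneg q this]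

theorem integrable_logKernel_bound {c₁ c₂ : ℝ × ℝ → ℝ} (h₁ : Continuous c₁) (h₂ : Continuous c₂)
    (s₁ : HasCompactSupport c₁) (s₂ : HasCompactSupport c₂) (v : ℝ × ℝ) :
    Integrable fun y => (4 * ‖v‖ * |c₁ y| + 2 * |c₂ y|) * (1 + 2 * ‖y‖ ^ 2 + ‖y‖⁻¹) := by
  refine integrable_mul_norm_inv (by fun_prop) ?_
  exact HasCompactSupport.add (s₁.abs.mul_left) (s₂.abs.mul_left)

theorem ae_ne_zero_plane : ∀ᵐ y : ℝ × ℝ, y ≠ 0 := by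
  simp [ae_iff]

theorem integrable_logKernel {c₁ c₂ : ℝ × ℝ → ℝ} (h₁ : Continuous c₁) (h₂ : Continuous c₂)
    (s₁ : HasCompactSupport c₁) (s₂ : HasCompactSupport c₂) (v : ℝ × ℝ) {δ : ℝ}
    (h0 : 0 ≤ δ) (h1 : δ ≤ 1) : Integrable (logKernel c₁ c₂ v δ) :=
  (integrable_logKernel_bound h₁ h₂ s₁ s₂ v).mono'
    (measurable_logKernel h₁ h₂ v δ).aestronglyMeasurable
    (ae_ne_zero_plane.mono fun _ hy => abs_logKernel_le c₁ c₂ v h0 h1 hy)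

theorem tendsto_integral_logKernel_sub {c₁ c₂ : ℝ × ℝ → ℝ} (h₁ : Continuous c₁)
    (h₂ : Continuous c₂) (s₁ : HasCompactSupport c₁) (s₂ : HasCompactSupport c₂) (v : ℝ × ℝ) :
    Tendsto (fun δ => ∫ y, ‖logKernel c₁ c₂ v δ y - logKernel c₁ c₂ v 0 y‖) (𝓝[>] 0) (𝓝 0) := by
  have hb := integrable_logKernel_bound h₁ h₂ s₁ s₂ v
  have ev : ∀ᶠ δ : ℝ in 𝓝[>] 0, 0 ≤ δ ∧ δ ≤ 1 := by
    filter_upwards [Ioo_mem_nhdsGT (show (0 : ℝ) < 1 by norm_num)] with δ hδ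
    exact ⟨hδ.1.le, hδ.2.le⟩
  have := tendsto_integral_filter_of_dominated_convergence (μ := (volume : Measure (ℝ × ℝ)))
    (F := fun δ y => ‖logKernel c₁ c₂ v δ y - logKernel c₁ c₂ v 0 y‖) (f := fun _ => (0 : ℝ))
    (l := 𝓝[>] (0 : ℝ)) _
    (Eventually.of_forall fun δ => ((measurable_logKernel h₁ h₂ v δ).sub
      (measurable_logKernel h₁ h₂ v 0)).norm.aestronglyMeasurable) ?_ (hb.add hb) ?_
  · simpa using this
  · filter_upwards [ev] with δ hδ
    filter_upwards [ae_ne_zero_plane] with y hy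
    rw [norm_norm]
    exact (norm_sub_le _ _).trans (add_le_add (abs_logKernel_le c₁ c₂ v hδ.1 hδ.2 hy)
      (abs_logKernel_le c₁ c₂ v le_rfl zero_le_one hy))
  · filter_upwards [ae_ne_zero_plane] with y hy
    have hpos : (0 : ℝ) ^ 2 + sqLen y ≠ 0 := by
      have := norm_sq_le_sqLen y
      have h : 0 < ‖y‖ ^ 2 := by positivity
      intro h0; linarith
    have hc : ContinuousAt (fun δ => ‖logKernel c₁ c₂ v δ y - logKernel c₁ c₂ v 0 y‖) 0 := by
      unfold logKernel logPotDeriv logPot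
      fun_prop (disch := exact hpos)
    have := hc.tendsto
    simp only [sub_self, norm_zero] at this
    exact this.mono_left nhdsWithin_le_nhds

theorem tendsto_convolution_logKernel {c₁ c₂ : ℝ × ℝ → ℝ} (h₁ : Continuous c₁)
    (h₂ : Continuous c₂) (s₁ : HasCompactSupport c₁) (s₂ : HasCompactSupport c₂) (v : ℝ × ℝ)
    {f : ℝ × ℝ → ℝ} (hf : Continuous f) (sf : HasCompactSupport f) :
    TendstoUniformly (fun δ x => ∫ y, logKernel c₁ c₂ v δ y * f (x - y))
      (fun x => ∫ y, logKernel c₁ c₂ v 0 y * f (x - y)) (𝓝[>] 0) := by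
  obtain ⟨C, hC⟩ := hf.bounded_above_of_compact_support sf
  have ht := (tendsto_integral_logKernel_sub h₁ h₂ s₁ s₂ v).mul_const C
  rw [zero_mul] at ht
  have ev : ∀ᶠ δ : ℝ in 𝓝[>] 0, 0 ≤ δ ∧ δ ≤ 1 := by
    filter_upwards [Ioo_mem_nhdsGT (show (0 : ℝ) < 1 by norm_num)] with δ hδ
    exact ⟨hδ.1.le, hδ.2.le⟩
  have ib : ∀ {δ : ℝ}, 0 ≤ δ → δ ≤ 1 → ∀ x,
      Integrable fun y => logKernel c₁ c₂ v δ y * f (x - y) := by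
    intro δ h0 h1 x
    exact (integrable_logKernel h₁ h₂ s₁ s₂ v h0 h1).mul_bdd (c := C)
      (by fun_prop) (ae_of_all _ fun y => hC _)
  rw [Metric.tendstoUniformly_iff]
  intro ε hε
  filter_upwards [ev, ht.eventually_lt_const hε] with δ hδ hlt x
  refine lt_of_le_of_lt ?_ hlt
  rw [dist_comm, dist_eq_norm, ← integral_sub (ib hδ.1 hδ.2 x) (ib le_rfl zero_le_one x),
    ← integral_mul_const]
  refine norm_integral_le_of_norm_le (Integrable.mul_const ?_ _) (ae_of_all _ fun y => ?_)
  · exact ((integrable_logKernel h₁ h₂ s₁ s₂ v hδ.1 hδ.2).sub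
      (integrable_logKernel h₁ h₂ s₁ s₂ v le_rfl zero_le_one)).norm
  · rw [← sub_mul, norm_mul]
    gcongr
    exact hC _

theorem contDiff_convolution_logKernel {c₁ c₂ : ℝ × ℝ → ℝ} (h₁ : Continuous c₁)
    (h₂ : Continuous c₂) (s₁ : HasCompactSupport c₁) (s₂ : HasCompactSupport c₂) (v : ℝ × ℝ)
    {f : ℝ × ℝ → ℝ} {n : ℕ} (hf : ContDiff ℝ n f) (sf : HasCompactSupport f) :
    ContDiff ℝ n (fun x => ∫ y, logKernel c₁ c₂ v 0 y * f (x - y)) := by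
  have := HasCompactSupport.contDiff_convolution_right (μ := volume) (n := n)
    (ContinuousLinearMap.mul ℝ ℝ) sf
    (integrable_logKernel h₁ h₂ s₁ s₂ v le_rfl zero_le_one).locallyIntegrable (by exact_mod_cast hf)
  exact_mod_cast this

theorem HasCompactSupport.pd {f : ℝ × ℝ → ℝ} (hf : HasCompactSupport f) (v : ℝ × ℝ) :
    HasCompactSupport (pd v f) :=
  hf.fderiv_apply (𝕜 := ℝ) v

/-- Convolution with the truncated logarithmic kernel gains one derivative. -/
theorem contDiff_succ_convolution_log {χ f : ℝ × ℝ → ℝ} (hχ : ContDiff ℝ ∞ χ)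
    (sχ : HasCompactSupport χ) {n : ℕ} (hf : ContDiff ℝ n f) (sf : HasCompactSupport f) :
    ContDiff ℝ (n + 1 : ℕ) (fun x => ∫ y, (χ y * logPot 0 y) * f (x - y)) := by
  have hcf : Continuous f := hf.continuous
  have k0 : ∀ δ, (fun y => χ y * logPot δ y) = logKernel 0 χ 0 δ := by
    intro δ; funext y; simp [logKernel]
  set D : (ℝ × ℝ) → ℝ → (ℝ × ℝ) → ℝ := fun v δ x =>
    ∫ y, logKernel χ (pd v χ) v δ y * f (x - y) with hD
  set A : ℝ → (ℝ × ℝ) → ((ℝ × ℝ) →L[ℝ] ℝ) := fun δ x =>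
    D (1, 0) δ x • ContinuousLinearMap.fst ℝ ℝ ℝ + D (0, 1) δ x • ContinuousLinearMap.snd ℝ ℝ ℝ
    with hA
  have cχ := hχ.continuous
  have cpd : ∀ v, Continuous (pd v χ) := fun v => (pd_contDiff hχ v).continuous
  have unif : ∀ v, TendstoUniformly (D v) (D v 0) (𝓝[>] 0) := fun v =>
    tendsto_convolution_logKernel cχ (cpd v) sχ (HasCompactSupport.pd sχ v) v hcf sf
  have hA' : TendstoUniformly A (A 0) (𝓝[>] 0) := by
    have t1 := ((ContinuousLinearMap.toSpanSingleton ℝ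
      (ContinuousLinearMap.fst ℝ ℝ ℝ)).uniformContinuous).comp_tendstoUniformly (unif (1, 0))
    have t2 := ((ContinuousLinearMap.toSpanSingleton ℝ
      (ContinuousLinearMap.snd ℝ ℝ ℝ)).uniformContinuous).comp_tendstoUniformly (unif (0, 1))
    exact t1.add t2
  have hder : ∀ x, HasFDerivAt (fun x => ∫ y, (χ y * logPot 0 y) * f (x - y)) (A 0 x) x := by
    have hseq : Tendsto (fun n : ℕ => (1 : ℝ) / (n + 1)) atTop (𝓝[>] 0) :=
      tendsto_nhdsWithin_iff.2 ⟨tendsto_one_div_add_atTop_nhds_zero_nat,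
        Eventually.of_forall fun n => by simp only [mem_Ioi]; positivity⟩
    refine hasFDerivAt_of_tendstoUniformly (l := atTop)
      (f := fun (n : ℕ) x => ∫ y, (χ y * logPot (1 / (n + 1)) y) * f (x - y))
      (f' := fun (n : ℕ) x => A (1 / (n + 1)) x) ?_ ?_ ?_
    · intro u hu
      exact hseq.eventually (hA' u hu)
    · intro n x
      have hδ : (0 : ℝ) < 1 / (n + 1) := by positivity
      generalize (1 : ℝ) / (n + 1) = δ at hδ
      have hG : ContDiff ℝ ∞ (fun y => χ y * logPot δ y) := hχ.mul (contDiff_logPot hδ)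
      have sG : HasCompactSupport (fun y => χ y * logPot δ y) := sχ.mul_right
      have h := sG.hasFDerivAt_convolution_left (μ := volume) (ContinuousLinearMap.mul ℝ ℝ)
        (hG.of_le (by exact_mod_cast le_top)) hcf.locallyIntegrable x
      have e : ∀ v : ℝ × ℝ, (convolution (fderiv ℝ fun y => χ y * logPot δ y) f
          (ContinuousLinearMap.precompL (ℝ × ℝ) (ContinuousLinearMap.mul ℝ ℝ)) volume x) v
          = D v δ x := by
        intro v
        rw [ContinuousLinearMap.precompL, convolution_flip,
          convolution_precompR_apply (μ := volume) (ContinuousLinearMap.mul ℝ ℝ).flip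
          hcf.locallyIntegrable (sG.fderiv ℝ) (hG.continuous_fderiv (by simp)) x v,
          convolution_flip]
        · simp only [convolution_def, hD, ContinuousLinearMap.mul_apply']
          refine integral_congr_ae (ae_of_all _ fun y => ?_)
          simp only
          congr 1
          have := pd_mul (x := y) (hχ.differentiable (by simp) y)
            ((contDiff_logPot hδ).differentiable (by simp) y) v
          have hp : δ ^ 2 + sqLen y ≠ 0 := by have := sqLen_nonneg y; positivity
          rw [pd_logPot hp] at this
          exact this
      convert! h using 1
      refine ContinuousLinearMap.ext fun w => ?_
      have hw : w = w.1 • ((1, 0) : ℝ × ℝ) + w.2 • ((0, 1) : ℝ × ℝ) := by ext <;> simp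
      conv_rhs => rw [hw]
      rw [map_add, map_smul, map_smul, e, e]
      simp [hA, mul_comm]
    · intro x
      have := (tendsto_convolution_logKernel (c₁ := 0) continuous_zero cχ
        HasCompactSupport.zero sχ 0 hcf sf).tendsto_at x
      have h2 := this.comp hseq
      rw [← k0 0] at h2
      refine h2.congr fun n => ?_
      simp [logKernel]
  have hsm : ∀ v, ContDiff ℝ n (D v 0) := fun v =>
    contDiff_convolution_logKernel cχ (cpd v) sχ (HasCompactSupport.pd sχ v) v hf sf
  rw [show ((n + 1 : ℕ) : WithTop ℕ∞) = (n : WithTop ℕ∞) + 1 by push_cast; rfl,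
    contDiff_succ_iff_fderiv]
  refine ⟨fun x => (hder x).differentiableAt, by simp, ?_⟩
  have : fderiv ℝ (fun x => ∫ y, (χ y * logPot 0 y) * f (x - y)) = A 0 := by
    funext x; exact (hder x).fderiv
  rw [this, hA]
  exact ((hsm (1, 0)).smul contDiff_const).add ((hsm (0, 1)).smul contDiff_const)

theorem lap_mul_logPot {χ : ℝ × ℝ → ℝ} (hχ : ContDiff ℝ ∞ χ) {δ : ℝ} (hδ : 0 < δ) (y : ℝ × ℝ) :
    lap (fun y => χ y * logPot δ y) y = χ y * (4 * δ ^ 2 / (δ ^ 2 + sqLen y) ^ 2)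
      + (logKernel (fun y => 2 * pd (1, 0) χ y) 0 (1, 0) δ y
        + logKernel (fun y => 2 * pd (0, 1) χ y) (lap χ) (0, 1) δ y) := by
  have hp : δ ^ 2 + sqLen y ≠ 0 := by have := sqLen_nonneg y; positivity
  have hl := lap_logPot hδ y
  have hG := contDiff_logPot hδ
  rw [← hl]
  unfold lap at *
  rw [pd_pd_mul hχ hG, pd_pd_mul hχ hG, pd_logPot hp, pd_logPot hp]
  simp only [logKernel, Pi.zero_apply, zero_mul, add_zero]
  ring

theorem pd_eq_zero_of_eventuallyEq {f : ℝ × ℝ → ℝ} {c : ℝ} {x : ℝ × ℝ}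
    (h : f =ᶠ[𝓝 x] fun _ => c) (v : ℝ × ℝ) : pd v f =ᶠ[𝓝 x] fun _ => 0 := by
  filter_upwards [h.fderiv (𝕜 := ℝ)] with y hy
  simp [pd, hy]

theorem lap_contDiff {f : ℝ × ℝ → ℝ} (hf : ContDiff ℝ ∞ f) : ContDiff ℝ ∞ (lap f) :=
  (pd_contDiff (pd_contDiff hf _) _).add (pd_contDiff (pd_contDiff hf _) _)

theorem HasCompactSupport.lap {f : ℝ × ℝ → ℝ} (hf : HasCompactSupport f) :
    HasCompactSupport (lap f) :=
  HasCompactSupport.add (HasCompactSupport.pd (HasCompactSupport.pd hf _) _)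
    (HasCompactSupport.pd (HasCompactSupport.pd hf _) _)

theorem lap_eq_zero_of_eventuallyEq {f : ℝ × ℝ → ℝ} {c : ℝ} {x : ℝ × ℝ}
    (h : f =ᶠ[𝓝 x] fun _ => c) : lap f =ᶠ[𝓝 x] fun _ => 0 := by
  filter_upwards [pd_eq_zero_of_eventuallyEq (pd_eq_zero_of_eventuallyEq h (1, 0)) (1, 0),
    pd_eq_zero_of_eventuallyEq (pd_eq_zero_of_eventuallyEq h (0, 1)) (0, 1)] with y h1 h2
  simp [lap, h1, h2]

theorem contDiff_of_tsupport_subset {n : WithTop ℕ∞} {f : ℝ × ℝ → ℝ} {O : Set (ℝ × ℝ)}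
    (hf : ContDiffOn ℝ n f O) (hO : IsOpen O) (hs : tsupport f ⊆ O) : ContDiff ℝ n f := by
  rw [contDiff_iff_contDiffAt]
  intro x
  by_cases hx : x ∈ tsupport f
  · exact hf.contDiffAt (hO.mem_nhds (hs hx))
  · exact contDiffAt_const (c := (0 : ℝ)) |>.congr_of_eventuallyEq
      (notMem_tsupport_iff_eventuallyEq.1 hx)

/-- A logarithmic kernel with coefficients vanishing near the origin is smooth. -/
theorem contDiff_logKernel_zero {c₁ c₂ : ℝ × ℝ → ℝ} (h₁ : ContDiff ℝ ∞ c₁) (h₂ : ContDiff ℝ ∞ c₂)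
    (z₁ : c₁ =ᶠ[𝓝 0] fun _ => 0) (z₂ : c₂ =ᶠ[𝓝 0] fun _ => 0) (v : ℝ × ℝ) :
    ContDiff ℝ ∞ (logKernel c₁ c₂ v 0) := by
  rw [contDiff_iff_contDiffAt]
  intro y
  by_cases hy : y = 0
  · subst hy
    refine contDiffAt_const (c := (0 : ℝ)) |>.congr_of_eventuallyEq ?_
    filter_upwards [z₁, z₂] with w a b
    simp [logKernel, a, b]
  · have hp : (0 : ℝ) ^ 2 + sqLen y ≠ 0 := by
      have := norm_sq_le_sqLen y
      have h : 0 < ‖y‖ ^ 2 := by positivity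
      intro h0; linarith
    refine (h₁.contDiffAt.mul ?_).add (h₂.contDiffAt.mul (contDiffAt_logPot_zero hy))
    unfold logPotDeriv
    refine ContDiffAt.div (by fun_prop) ?_ hp
    exact (contDiff_const.add contDiff_sqLen).contDiffAt

/-- The bubble whose rescalings approximate the Dirac mass. -/
def bubble (w : ℝ × ℝ) : ℝ := 4 / (1 + sqLen w) ^ 2

theorem integrable_bubble : Integrable bubble := by
  have h := integrable_rpow_neg_one_add_norm_sq (E := ℝ × ℝ) (μ := volume) (r := 4)
    (by simp; norm_num)
  refine (h.const_mul 4).mono' ?_ (ae_of_all _ fun w => ?_)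
  · unfold bubble sqLen
    exact (by fun_prop : Measurable _).aestronglyMeasurable
  · have h1 := norm_sq_le_sqLen w
    have h0 := sqLen_nonneg w
    unfold bubble
    rw [Real.norm_of_nonneg (by positivity), div_eq_mul_inv,
      show (-4 / 2 : ℝ) = -((2 : ℕ) : ℝ) by norm_num, Real.rpow_neg (by positivity),
      Real.rpow_natCast]
    gcongr

theorem integral_bubble_pos : 0 < ∫ w, bubble w := by
  have hpos : ∀ w, 0 < bubble w := fun w => by
    have h0 := sqLen_nonneg w
    unfold bubble; positivity
  refine (integral_pos_iff_support_of_nonneg (fun w => (hpos w).le) integrable_bubble).2 ?_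
  have : Function.support bubble = univ := by
    ext w; simp [(hpos w).ne']
  simp [this]

theorem tendsto_integral_bubble {g : ℝ × ℝ → ℝ} (hg : Continuous g) (sg : HasCompactSupport g) :
    Tendsto (fun δ => ∫ y, (4 * δ ^ 2 / (δ ^ 2 + sqLen y) ^ 2) * g y) (𝓝[>] 0)
      (𝓝 ((∫ w, bubble w) * g 0)) := by
  obtain ⟨C, hC⟩ := hg.bounded_above_of_compact_support sg
  have hm : Measurable bubble := by unfold bubble sqLen; fun_prop
  have key : Tendsto (fun δ : ℝ => ∫ w, bubble w * g (δ • w)) (𝓝[>] 0)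
      (𝓝 (∫ w, bubble w * g ((0 : ℝ) • w))) := by
    refine tendsto_integral_filter_of_dominated_convergence (fun w => ‖bubble w‖ * C)
      (Eventually.of_forall fun δ => ?_) (Eventually.of_forall fun δ => ae_of_all _ fun w => ?_)
      (integrable_bubble.norm.mul_const C) (ae_of_all _ fun w => ?_)
    · exact (hm.mul (by fun_prop)).aestronglyMeasurable
    · rw [norm_mul]; gcongr; exact hC _
    · have : Continuous fun δ : ℝ => bubble w * g (δ • w) := by fun_prop
      exact (this.tendsto 0).mono_left nhdsWithin_le_nhds
  simp only [zero_smul, integral_mul_const] at key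
  refine key.congr' ?_
  filter_upwards [self_mem_nhdsWithin] with δ hδ
  have hδ' : (0 : ℝ) < δ := hδ
  have h := Measure.integral_comp_smul (volume : Measure (ℝ × ℝ))
    (fun y => (4 * δ ^ 2 / (δ ^ 2 + sqLen y) ^ 2) * g y) δ
  have fr : Module.finrank ℝ (ℝ × ℝ) = 2 := by simp
  rw [fr, abs_of_pos (by positivity), smul_eq_mul] at h
  have h2 : ∫ y, (4 * δ ^ 2 / (δ ^ 2 + sqLen y) ^ 2) * g y
      = δ ^ 2 * ∫ w, (4 * δ ^ 2 / (δ ^ 2 + sqLen (δ • w)) ^ 2) * g (δ • w) := by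
    rw [h]; field_simp
  rw [h2, ← integral_const_mul]
  congr 1
  funext w
  have h0 := sqLen_nonneg w
  have : sqLen (δ • w) = δ ^ 2 * sqLen w := by simp [sqLen]; ring
  rw [this]
  unfold bubble
  field_simp

/-- Interior regularity for the Poisson equation in the plane, one derivative at a time. -/
theorem contDiffOn_succ_of_weak_poisson {O : Set (ℝ × ℝ)} (hO : IsOpen O) {u F : ℝ × ℝ → ℝ}
    (hu : ContinuousOn u O) {n : ℕ} (hF : ContDiffOn ℝ n F O)
    (hw : ∀ ξ : ℝ × ℝ → ℝ, ContDiff ℝ ∞ ξ → HasCompactSupport ξ → tsupport ξ ⊆ O →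
      ∫ x, u x * lap ξ x = ∫ x, F x * ξ x) :
    ContDiffOn ℝ (n + 1 : ℕ) u O := by
  intro x₀ hx₀
  obtain ⟨ε, hε, hball⟩ := Metric.isOpen_iff.1 hO x₀ hx₀
  obtain ⟨R, hR, hRε⟩ : ∃ R : ℝ, 0 < R ∧ 4 * R < ε := ⟨ε / 5, by positivity, by linarith⟩
  let χ : ContDiffBump (0 : ℝ × ℝ) := ⟨R, 2 * R, hR, by linarith⟩
  let χ₁ : ContDiffBump x₀ := ⟨3 * R, 4 * R, by positivity, by linarith⟩
  have hχ : ContDiff ℝ ∞ χ := χ.contDiff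
  have sχ : HasCompactSupport χ := χ.hasCompactSupport
  have tχ : tsupport χ = Metric.closedBall 0 (2 * R) := χ.tsupport_eq
  have tχ₁ : tsupport χ₁ ⊆ O := by
    rw [χ₁.tsupport_eq]
    exact (Metric.closedBall_subset_ball hRε).trans hball
  have onχ : (χ : ℝ × ℝ → ℝ) =ᶠ[𝓝 0] fun _ => 1 := χ.eventuallyEq_one
  set v : ℝ × ℝ → ℝ := fun y => χ₁ y * u y with hv
  set f : ℝ × ℝ → ℝ := fun y => χ₁ y * F y with hf
  have tv : tsupport v ⊆ O := (tsupport_mul_subset_left).trans tχ₁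
  have tf : tsupport f ⊆ O := (tsupport_mul_subset_left).trans tχ₁
  have cv : Continuous v :=
    (χ₁.continuous.continuousOn.mul hu).continuous_of_tsupport_subset hO tv
  have sv : HasCompactSupport v := χ₁.hasCompactSupport.mul_right
  have sf : HasCompactSupport f := χ₁.hasCompactSupport.mul_right
  have cf : ContDiff ℝ n f := by
    exact contDiff_of_tsupport_subset ((χ₁.contDiff (n := n)).contDiffOn.mul hF) hO tf
  set κ₁ := logKernel (fun y => 2 * pd (1, 0) χ y) 0 (1, 0) with hκ₁
  set κ₂ := logKernel (fun y => 2 * pd (0, 1) χ y) (lap χ) (0, 1) with hκ₂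
  have cp : ∀ v, ContDiff ℝ ∞ (fun y => 2 * pd v χ y) := fun v =>
    contDiff_const.mul (pd_contDiff hχ v)
  have sp : ∀ v, HasCompactSupport (fun y => 2 * pd v χ y) := fun v =>
    (HasCompactSupport.pd sχ v).mul_left
  have zp : ∀ v, (fun y => 2 * pd v χ y) =ᶠ[𝓝 0] fun _ => 0 := fun v => by
    filter_upwards [pd_eq_zero_of_eventuallyEq onχ v] with y hy
    simp [hy]
  have cl := lap_contDiff hχ
  have sl := HasCompactSupport.lap sχ
  have rep : ∀ x ∈ Metric.ball x₀ R, (∫ w, bubble w) * u x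
      + ((∫ y, κ₁ 0 y * v (x - y)) + ∫ y, κ₂ 0 y * v (x - y))
        = ∫ y, (χ y * logPot 0 y) * f (x - y) := by
    intro x hx
    have near : ∀ y, y ∈ tsupport χ → χ₁ (x - y) = 1 := by
      intro y hy
      rw [tχ, mem_closedBall_zero_iff] at hy
      refine χ₁.one_of_mem_closedBall ?_
      rw [mem_ball_iff_norm] at hx
      rw [mem_closedBall_iff_norm]
      have : x - y - x₀ = (x - x₀) - y := by abel
      rw [this]
      refine (norm_sub_le _ _).trans ?_
      change _ ≤ 3 * R
      linarith
    have onx : χ₁ x = 1 := by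
      have := near 0 (by rw [tχ]; simp; positivity)
      simpa using this
    have idδ : ∀ δ : ℝ, 0 < δ → δ ≤ 1 →
        (∫ y, (4 * δ ^ 2 / (δ ^ 2 + sqLen y) ^ 2) * (χ y * v (x - y)))
          + ((∫ y, κ₁ δ y * v (x - y)) + ∫ y, κ₂ δ y * v (x - y))
          = ∫ y, logKernel 0 χ 0 δ y * f (x - y) := by
      intro δ hδ hδ1
      set G : ℝ × ℝ → ℝ := fun y => χ y * logPot δ y with hG
      have cG : ContDiff ℝ ∞ G := hχ.mul (contDiff_logPot hδ)
      have sG : HasCompactSupport G := sχ.mul_right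
      have hG0 : ∀ y, y ∉ tsupport χ → G =ᶠ[𝓝 y] fun _ => 0 := by
        intro y hy
        filter_upwards [(isClosed_tsupport (χ : ℝ × ℝ → ℝ)).isOpen_compl.mem_nhds hy] with z hz
        simp [hG, image_eq_zero_of_notMem_tsupport hz]
      have e1 : ∫ y, u y * lap (fun y => G (x - y)) y = ∫ y, lap G y * v (x - y) := by
        rw [← integral_sub_left_eq_self (fun y => lap G y * v (x - y)) volume x]
        congr 1
        funext y
        rw [lap_comp_const_sub cG]
        by_cases hy : x - y ∈ tsupport χ
        · have := near _ hy
          simp only [sub_sub_cancel] at this ⊢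
          simp [hv, this, mul_comm]
        · simp [(lap_eq_zero_of_eventuallyEq (hG0 _ hy)).eq_of_nhds]
      have e2 : ∫ y, F y * G (x - y) = ∫ y, logKernel 0 χ 0 δ y * f (x - y) := by
        rw [← integral_sub_left_eq_self (fun y => logKernel 0 χ 0 δ y * f (x - y)) volume x]
        congr 1
        funext y
        by_cases hy : x - y ∈ tsupport χ
        · have := near _ hy
          simp only [sub_sub_cancel] at this ⊢
          simp [hf, this, mul_comm, logKernel, hG]
        · simp [image_eq_zero_of_notMem_tsupport hy, hG, logKernel]
      have e3 := hw (fun y => G (x - y)) (cG.comp (contDiff_const.sub contDiff_id))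
        (sG.comp_homeomorph (Homeomorph.subLeft x)) (by
          intro y hy
          have h1 : x - y ∈ tsupport G :=
            tsupport_comp_subset_preimage G (continuous_const.sub continuous_id) hy
          have h2 : x - y ∈ tsupport χ := tsupport_mul_subset_left h1
          have h3 := near _ h2
          rw [sub_sub_cancel] at h3
          exact tχ₁ (subset_tsupport _ (by simp [h3])))
      rw [e1, e2] at e3
      rw [← e3]
      have b1 : ∀ {k : ℝ × ℝ → ℝ}, Integrable k → Integrable fun y => k y * v (x - y) := by
        intro k hk
        obtain ⟨C, hC⟩ := cv.bounded_above_of_compact_support sv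
        exact hk.mul_bdd (c := C) (by fun_prop) (ae_of_all _ fun y => hC _)
      have i1 := b1 (integrable_logKernel (cp (1, 0)).continuous continuous_zero (sp _)
        HasCompactSupport.zero (1, 0) hδ.le hδ1)
      have i2 := b1 (integrable_logKernel (cp (0, 1)).continuous cl.continuous (sp _)
        sl (0, 1) hδ.le hδ1)
      have i0 : Integrable fun y => (4 * δ ^ 2 / (δ ^ 2 + sqLen y) ^ 2) * (χ y * v (x - y)) := by
        refine Continuous.integrable_of_hasCompactSupport ?_ (sχ.mul_right.mul_left)
        have := contDiff_sqLen.continuous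
        have hne : ∀ y, (δ ^ 2 + sqLen y) ^ 2 ≠ 0 := fun y => by
          have := sqLen_nonneg y; positivity
        have := χ.continuous
        fun_prop (disch := exact hne _)
      rw [← integral_add i1 i2, ← integral_add i0 (i1.fun_add i2)]
      congr 1
      funext y
      rw [lap_mul_logPot hχ hδ]
      ring
    have t0 := tendsto_integral_bubble (g := fun y => χ y * v (x - y))
      (χ.continuous.mul (cv.comp (continuous_const.sub continuous_id))) sχ.mul_right
    have t1 := (tendsto_convolution_logKernel (cp (1, 0)).continuous continuous_zero (sp _)
        HasCompactSupport.zero (1, 0) cv sv).tendsto_at x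
    have t2 := (tendsto_convolution_logKernel (cp (0, 1)).continuous cl.continuous (sp _)
        sl (0, 1) cv sv).tendsto_at x
    have t3 := (tendsto_convolution_logKernel continuous_zero χ.continuous
        HasCompactSupport.zero sχ 0 cf.continuous sf).tendsto_at x
    have t4 := t0.add (t1.add t2)
    have ev : ∀ᶠ δ : ℝ in 𝓝[>] 0, 0 < δ ∧ δ ≤ 1 := by
      filter_upwards [Ioo_mem_nhdsGT (show (0 : ℝ) < 1 by norm_num)] with δ hδ
      exact ⟨hδ.1, hδ.2.le⟩
    have t5 := tendsto_nhds_unique (t4.congr' (ev.mono fun δ h => idδ δ h.1 h.2)) t3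
    have χ0 : χ 0 = 1 := onχ.eq_of_nhds
    simp only [sub_zero, χ0, one_mul, hv, onx] at t5
    rw [hv]
    simp only [hκ₁, hκ₂, logKernel, Pi.zero_apply, zero_mul, zero_add] at t5 ⊢
    exact t5
  have c1 : ContDiff ℝ (n + 1 : ℕ) (fun x => ∫ y, κ₁ 0 y * v (x - y)) := by
    have k := contDiff_logKernel_zero (cp (1, 0)) (contDiff_const (c := (0 : ℝ))) (zp _)
      EventuallyEq.rfl (1, 0)
    have s : HasCompactSupport (κ₁ 0) :=
      HasCompactSupport.add ((sp (1, 0)).mul_right) (HasCompactSupport.zero.mul_right)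
    exact s.contDiff_convolution_left (μ := volume) (n := (n + 1 : ℕ)) (ContinuousLinearMap.mul ℝ ℝ)
      (k.of_le (by exact_mod_cast le_top)) cv.locallyIntegrable
  have c2 : ContDiff ℝ (n + 1 : ℕ) (fun x => ∫ y, κ₂ 0 y * v (x - y)) := by
    have k := contDiff_logKernel_zero (cp (0, 1)) cl (zp _)
      (lap_eq_zero_of_eventuallyEq onχ) (0, 1)
    have s : HasCompactSupport (κ₂ 0) :=
      HasCompactSupport.add ((sp (0, 1)).mul_right) (sl.mul_right)
    exact s.contDiff_convolution_left (μ := volume) (n := (n + 1 : ℕ)) (ContinuousLinearMap.mul ℝ ℝ)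
      (k.of_le (by exact_mod_cast le_top)) cv.locallyIntegrable
  have c3 := contDiff_succ_convolution_log hχ sχ cf sf
  have c4 := (contDiff_const (c := (∫ w, bubble w)⁻¹)).mul (c3.sub (c1.add c2))
  refine (c4.contDiffAt.congr_of_eventuallyEq ?_).contDiffWithinAt
  filter_upwards [Metric.ball_mem_nhds x₀ hR] with x hx
  have := rep x hx
  have p := integral_bubble_pos.ne'
  rw [← this]
  field_simp
  ring

theorem integrable_mul_of_tsupport_subset {O : Set (ℝ × ℝ)} (hO : IsOpen O) {c η : ℝ × ℝ → ℝ}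
    (hc : ContinuousOn c O) (hη : Continuous η) (sη : HasCompactSupport η) (tη : tsupport η ⊆ O) :
    Integrable fun x => c x * η x :=
  ((hc.mul hη.continuousOn).continuous_of_tsupport_subset hO
    (tsupport_mul_subset_right.trans tη)).integrable_of_hasCompactSupport sη.mul_left

theorem contDiffOn_pd {O : Set (ℝ × ℝ)} (hO : IsOpen O) {u : ℝ × ℝ → ℝ} (hu : ContDiffOn ℝ ∞ u O)
    (v : ℝ × ℝ) : ContDiffOn ℝ ∞ (pd v u) O :=
  (hu.fderiv_of_isOpen (m := ∞) hO (by simp)).clm_apply contDiffOn_const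

theorem tsupport_pd_subset (η : ℝ × ℝ → ℝ) (v : ℝ × ℝ) : tsupport (pd v η) ⊆ tsupport η :=
  tsupport_fderiv_apply_subset ℝ v

theorem integral_mul_pd {O : Set (ℝ × ℝ)} (hO : IsOpen O) {u η : ℝ × ℝ → ℝ}
    (hu : ContDiffOn ℝ ∞ u O) (hη : ContDiff ℝ ∞ η) (sη : HasCompactSupport η)
    (tη : tsupport η ⊆ O) (v : ℝ × ℝ) :
    ∫ x, u x * pd v η x = -∫ x, pd v u x * η x := by
  refine integral_mul_fderiv_eq_neg_fderiv_mul_of_integrable ?_ ?_ ?_ ?_ ?_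
  · exact integrable_mul_of_tsupport_subset hO (contDiffOn_pd hO hu v).continuousOn
      hη.continuous sη tη
  · exact integrable_mul_of_tsupport_subset hO hu.continuousOn (pd_contDiff hη v).continuous
      (HasCompactSupport.pd sη v) ((tsupport_pd_subset η v).trans tη)
  · exact integrable_mul_of_tsupport_subset hO hu.continuousOn hη.continuous sη tη
  · intro x hx
    exact (hu.contDiffAt (hO.mem_nhds (tη hx))).differentiableAt (by simp)
  · intro x _
    exact hη.differentiable (by simp) x

/-- A smooth weak solution of the Poisson equation is a classical one. -/
theorem lap_eq_of_weak_poisson {O : Set (ℝ × ℝ)} (hO : IsOpen O) {u F : ℝ × ℝ → ℝ}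
    (hu : ContDiffOn ℝ ∞ u O) (hF : ContinuousOn F O)
    (hw : ∀ ξ : ℝ × ℝ → ℝ, ContDiff ℝ ∞ ξ → HasCompactSupport ξ → tsupport ξ ⊆ O →
      ∫ x, u x * lap ξ x = ∫ x, F x * ξ x) {x : ℝ × ℝ} (hx : x ∈ O) : lap u x = F x := by
  have cl : ContinuousOn (lap u) O :=
    ((contDiffOn_pd hO (contDiffOn_pd hO hu (1, 0)) (1, 0)).add
      (contDiffOn_pd hO (contDiffOn_pd hO hu (0, 1)) (0, 1))).continuousOn
  have h := IsOpen.ae_eq_zero_of_integral_contDiff_smul_eq_zero (μ := volume) hO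
    (f := fun x => lap u x - F x)
    ((cl.sub hF).locallyIntegrableOn hO.measurableSet) ?_
  · refine Measure.eqOn_open_of_ae_eq (μ := volume) ?_ hO cl hF hx
    rw [EventuallyEq, ae_restrict_iff' hO.measurableSet]
    filter_upwards [h] with y hy hyO
    exact sub_eq_zero.1 (hy hyO)
  · intro ξ cξ sξ tξ
    have two : ∀ v, ∫ x, u x * pd v (pd v ξ) x = ∫ x, pd v (pd v u) x * ξ x := by
      intro v
      rw [integral_mul_pd hO hu (pd_contDiff cξ v) (HasCompactSupport.pd sξ v)
        ((tsupport_pd_subset ξ v).trans tξ), integral_mul_pd hO (contDiffOn_pd hO hu v) cξ sξ tξ,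
        neg_neg]
    have i1 : ∀ v, Integrable fun x => u x * pd v (pd v ξ) x := fun v =>
      integrable_mul_of_tsupport_subset hO hu.continuousOn
        (pd_contDiff (pd_contDiff cξ v) v).continuous
        (HasCompactSupport.pd (HasCompactSupport.pd sξ v) v)
        ((tsupport_pd_subset _ v).trans ((tsupport_pd_subset ξ v).trans tξ))
    have i2 : ∀ v, Integrable fun x => pd v (pd v u) x * ξ x := fun v =>
      integrable_mul_of_tsupport_subset hO (contDiffOn_pd hO (contDiffOn_pd hO hu v) v).continuousOn
        cξ.continuous sξ tξ
    have e1 : ∫ x, lap u x * ξ x = ∫ x, u x * lap ξ x := by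
      simp only [lap, add_mul, mul_add]
      rw [integral_add (i2 _) (i2 _), integral_add (i1 _) (i1 _), two, two]
    have e2 := e1.trans (hw ξ cξ sξ tξ)
    have e3 : ∀ x, ξ x • (lap u x - F x) = lap u x * ξ x - F x * ξ x := fun x => by
      rw [smul_eq_mul]; ring
    simp only [e3]
    rw [integral_sub (integrable_mul_of_tsupport_subset hO cl cξ.continuous sξ tξ)
      (integrable_mul_of_tsupport_subset hO hF cξ.continuous sξ tξ), e2, sub_self]

section gaussian

/-- Euclidean space of dimension `d`. -/
abbrev Eu (d : ℕ) := EuclideanSpace ℝ (Fin d)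

instance isAddHaarMeasure_volume_prod (p q : ℕ) :
    (volume : Measure (Eu p × Eu q)).IsAddHaarMeasure :=
  Measure.prod.instIsAddHaarMeasure _ _

/-- The unnormalised Gaussian weight on a product of two Euclidean spaces. -/
def gaussWeight (p q : ℕ) (z : Eu p × Eu q) : ℝ := Real.exp (-(‖z.1‖ ^ 2 + ‖z.2‖ ^ 2) / 2)

/-- The pair of squared radii of a point of a product of two Euclidean spaces. -/
def sqRad {p q : ℕ} (x : Eu p × Eu q) : ℝ × ℝ := (‖x.1‖ ^ 2, ‖x.2‖ ^ 2)

/-- The closed quadrant. -/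
def quad : Set (ℝ × ℝ) := Ici 0 ×ˢ Ici 0

theorem sqRad_mem_quad {p q : ℕ} (x : Eu p × Eu q) : sqRad x ∈ quad :=
  ⟨mem_Ici.2 (sq_nonneg _), mem_Ici.2 (sq_nonneg _)⟩

theorem continuous_sqRad {p q : ℕ} : Continuous (sqRad (p := p) (q := q)) := by
  unfold sqRad; fun_prop

theorem continuous_comp_sqRad {p q : ℕ} {w : ℝ × ℝ → ℝ} (hw : ContinuousOn w quad) :
    Continuous fun x : Eu p × Eu q => w (sqRad x) :=
  hw.comp_continuous continuous_sqRad sqRad_mem_quad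

variable {p q : ℕ}

theorem gaussWeight_pos (z : Eu p × Eu q) : 0 < gaussWeight p q z := Real.exp_pos _

theorem continuous_gaussWeight : Continuous (gaussWeight p q) := by
  unfold gaussWeight; fun_prop

theorem integrable_exp_neg_mul_norm_sq {b : ℝ} (hb : 0 < b) (d : ℕ) :
    Integrable fun z : Eu d => Real.exp (-b * ‖z‖ ^ 2) := by
  have h := (GaussianFourier.integrable_cexp_neg_mul_sq_norm_add (V := Eu d) (b := (b : ℂ))
    (by simpa using hb) 0 0).norm
  refine h.congr (ae_of_all _ fun z => ?_)
  simp only [Complex.norm_exp]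
  congr 1
  simp [← Complex.ofReal_pow]

theorem integrable_exp_neg_mul_sqRad {b : ℝ} (hb : 0 < b) :
    Integrable fun z : Eu p × Eu q => Real.exp (-b * (‖z.1‖ ^ 2 + ‖z.2‖ ^ 2)) := by
  have := (integrable_exp_neg_mul_norm_sq hb p).mul_prod (integrable_exp_neg_mul_norm_sq hb q)
  refine this.congr (ae_of_all _ fun z => ?_)
  simp only [← Real.exp_add]
  congr 1
  ring

theorem integrable_gaussWeight : Integrable (gaussWeight p q) := by
  refine (integrable_exp_neg_mul_sqRad (p := p) (q := q) (b := 1 / 2) (by norm_num)).congr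
    (ae_of_all _ fun z => ?_)
  simp only [gaussWeight]
  congr 1
  ring

theorem integrable_norm_mul_gaussWeight :
    Integrable fun z : Eu p × Eu q => (‖z.1‖ + ‖z.2‖) * gaussWeight p q z := by
  refine ((integrable_exp_neg_mul_sqRad (p := p) (q := q) (b := 1 / 4)
    (by norm_num)).const_mul 4).mono' ?_ (ae_of_all _ fun z => ?_)
  · exact (Continuous.mul (by fun_prop) continuous_gaussWeight).aestronglyMeasurable
  · have hw := gaussWeight_pos z
    rw [Real.norm_of_nonneg (by positivity)]
    have e : gaussWeight p q z = Real.exp (-(1 / 4) * (‖z.1‖ ^ 2 + ‖z.2‖ ^ 2))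
        * Real.exp (-(1 / 4) * (‖z.1‖ ^ 2 + ‖z.2‖ ^ 2)) := by
      rw [← Real.exp_add, gaussWeight]; congr 1; ring
    rw [e]
    set r := ‖z.1‖ ^ 2 + ‖z.2‖ ^ 2
    have h1 : (‖z.1‖ + ‖z.2‖) * Real.exp (-(1 / 4) * r) ≤ 4 := by
      have h2 : ‖z.1‖ + ‖z.2‖ ≤ 4 * Real.exp ((1 / 4) * r) := by
        have := Real.add_one_le_exp ((1 / 4) * r)
        have : ‖z.1‖ + ‖z.2‖ ≤ 4 * ((1 / 4) * r + 1) := by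
          simp only [r]
          nlinarith [sq_nonneg (‖z.1‖ - 1), sq_nonneg (‖z.2‖ - 1)]
        linarith
      calc _ ≤ 4 * Real.exp ((1 / 4) * r) * Real.exp (-(1 / 4) * r) := by gcongr
        _ = 4 := by rw [mul_assoc, ← Real.exp_add]; simp
    calc _ = ((‖z.1‖ + ‖z.2‖) * Real.exp (-(1 / 4) * r)) * Real.exp (-(1 / 4) * r) := by ring
      _ ≤ _ := by gcongr

theorem hasLineDerivAt_gaussWeight (z : Eu p × Eu q) (i : Fin p) :
    HasLineDerivAt ℝ (gaussWeight p q) (-(z.1 i * gaussWeight p q z)) z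
      (EuclideanSpace.single i 1, 0) := by
  have hd : HasFDerivAt (fun y : Eu p × Eu q => -(‖y.1‖ ^ 2 + ‖y.2‖ ^ 2) / 2) _ z :=
    (((hasFDerivAt_fst.norm_sq).fun_add (hasFDerivAt_snd.norm_sq)).fun_neg).mul_const (2 : ℝ)⁻¹
  have h := hd.exp.hasLineDerivAt (EuclideanSpace.single i 1, 0)
  refine h.congr_deriv ?_
  have : inner ℝ z.1 (EuclideanSpace.single i (1 : ℝ)) = z.1 i := by
    simp [EuclideanSpace.inner_single_right]
  simp [gaussWeight, this]
  ring

/-- Gaussian integration by parts in the first factor for a radial vector field. -/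
theorem integral_gauss_fst {b b' : ℝ × ℝ → ℝ} {C : ℝ} (hb : ContinuousOn b quad)
    (hb' : ContinuousOn b' quad)
    (hd : ∀ y ∈ quad, HasDerivAt (fun t => b (t, y.2)) (b' y) y.1)
    (B : ∀ y ∈ quad, |b y| * (1 + y.1) ≤ C) (B' : ∀ y ∈ quad, |b' y| * (1 + y.1) ≤ C)
    (x : Eu p × Eu q) (s : ℝ) :
    ∫ z, b (sqRad (x + s • z)) * inner ℝ (x.1 + s • z.1) z.1 * gaussWeight p q z
      = s * ∫ z, (p * b (sqRad (x + s • z)) + 2 * (sqRad (x + s • z)).1 * b' (sqRad (x + s • z)))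
          * gaussWeight p q z := by
  have cb : Continuous fun z : Eu p × Eu q => b (sqRad (x + s • z)) :=
    (continuous_comp_sqRad hb).comp (by fun_prop)
  have cb' : Continuous fun z : Eu p × Eu q => b' (sqRad (x + s • z)) :=
    (continuous_comp_sqRad hb').comp (by fun_prop)
  have hC : 0 ≤ C := (mul_nonneg (abs_nonneg _) (by simp)).trans (B 0 ⟨mem_Ici.2 le_rfl, mem_Ici.2 le_rfl⟩)
  have coord : ∀ (y : Eu p) i, |y i| ≤ ‖y‖ := fun y i => by
    simpa using PiLp.norm_apply_le y i
  have b1 : ∀ y : Eu p × Eu q, |b (sqRad y)| * ‖y.1‖ ≤ C := fun y => by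
    refine le_trans ?_ (B _ (sqRad_mem_quad y))
    gcongr
    simp only [sqRad]
    nlinarith [sq_nonneg (‖y.1‖ - 1), norm_nonneg y.1]
  have b0 : ∀ y : Eu p × Eu q, |b (sqRad y)| ≤ C := fun y => by
    refine le_trans ?_ (B _ (sqRad_mem_quad y))
    refine le_mul_of_one_le_right (abs_nonneg _) ?_
    simp [sqRad]
  have b2 : ∀ y : Eu p × Eu q, |b' (sqRad y)| * ‖y.1‖ ^ 2 ≤ C := fun y => by
    refine le_trans ?_ (B' _ (sqRad_mem_quad y))
    gcongr
    simp [sqRad]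
  set F : Fin p → Eu p × Eu q → ℝ := fun i z => b (sqRad (x + s • z)) * (x.1 + s • z.1) i with hF
  set F' : Fin p → Eu p × Eu q → ℝ := fun i z =>
    s * (b (sqRad (x + s • z)) + 2 * ((x.1 + s • z.1) i) ^ 2 * b' (sqRad (x + s • z))) with hF'
  have cF : ∀ i, Continuous (F i) := fun i => cb.mul (by fun_prop)
  have cF' : ∀ i, Continuous (F' i) := fun i => by
    exact continuous_const.mul (cb.add (Continuous.mul (by fun_prop) cb'))
  have bF : ∀ i z, |F i z| ≤ C := fun i z => by
    simp only [hF, abs_mul]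
    exact (mul_le_mul_of_nonneg_left (coord _ i) (abs_nonneg _)).trans (b1 (x + s • z))
  have bF' : ∀ i z, |F' i z| ≤ |s| * (3 * C) := fun i z => by
    simp only [hF', abs_mul]
    gcongr
    refine (abs_add_le _ _).trans ?_
    have h1 := b0 (x + s • z)
    have h2 := b2 (x + s • z)
    have h3 : ((x.1 + s • z.1) i) ^ 2 ≤ ‖x.1 + s • z.1‖ ^ 2 := by
      rw [← sq_abs]; exact pow_le_pow_left₀ (abs_nonneg _) (coord _ i) 2
    have h4 : |b' (sqRad (x + s • z))| * ((x.1 + s • z.1) i) ^ 2 ≤ C :=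
      (mul_le_mul_of_nonneg_left h3 (abs_nonneg _)).trans h2
    rw [abs_mul, abs_mul, abs_two, abs_of_nonneg (sq_nonneg ((x.1 + s • z.1).ofLp i))]
    linarith
  have iF : ∀ i, Integrable fun z => F i z * gaussWeight p q z := fun i =>
    integrable_gaussWeight.bdd_mul (c := C) (cF i).aestronglyMeasurable
      (ae_of_all _ fun z => bF i z)
  have iF' : ∀ i, Integrable fun z => F' i z * gaussWeight p q z := fun i =>
    integrable_gaussWeight.bdd_mul (c := |s| * (3 * C)) (cF' i).aestronglyMeasurable
      (ae_of_all _ fun z => bF' i z)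
  have iFz : ∀ i, Integrable fun z => F i z * (-(z.1 i * gaussWeight p q z)) := fun i => by
    refine Integrable.bdd_mul (c := C) ?_ (cF i).aestronglyMeasurable
      (ae_of_all _ fun z => bF i z)
    refine (integrable_norm_mul_gaussWeight.mono' ?_ (ae_of_all _ fun z => ?_)).neg
    · exact (Continuous.mul (by fun_prop) continuous_gaussWeight).aestronglyMeasurable
    · rw [norm_mul, Real.norm_of_nonneg (gaussWeight_pos z).le]
      have := (gaussWeight_pos z).le
      gcongr
      exact (coord _ i).trans (le_add_of_nonneg_right (norm_nonneg _))
  have dF : ∀ i z, HasLineDerivAt ℝ (F i) (F' i z) z (EuclideanSpace.single i 1, 0) := by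
    intro i z
    unfold HasLineDerivAt
    have e1 : ∀ t : ℝ, (x + s • (z + t • ((EuclideanSpace.single i 1, 0) : Eu p × Eu q))).1
        = (x.1 + s • z.1) + t • (s • EuclideanSpace.single i (1 : ℝ)) := fun t => by
      simp only [Prod.fst_add, Prod.smul_fst, smul_add, smul_comm s t]
      abel
    have e2 : ∀ t : ℝ, (x + s • (z + t • ((EuclideanSpace.single i 1, 0) : Eu p × Eu q))).2
        = x.2 + s • z.2 := fun t => by simp
    have hlin : HasDerivAt (fun t : ℝ => (x.1 + s • z.1) + t • (s • EuclideanSpace.single i (1 : ℝ)))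
        (s • EuclideanSpace.single i (1 : ℝ)) 0 := by
      simpa using ((hasDerivAt_id (0 : ℝ)).smul_const
        (s • EuclideanSpace.single i (1 : ℝ) : Eu p)).const_add (x.1 + s • z.1)
    have hn := hlin.norm_sq
    simp only [zero_smul, add_zero] at hn
    have hb1 : HasDerivAt (fun t => b (t, ‖x.2 + s • z.2‖ ^ 2)) (b' (sqRad (x + s • z)))
        (‖x.1 + s • z.1 + (0 : ℝ) • (s • EuclideanSpace.single i (1 : ℝ))‖ ^ 2) := by
      rw [zero_smul, add_zero]
      exact hd _ (sqRad_mem_quad (x + s • z))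
    have hc := hb1.comp (0 : ℝ) hn
    have hi : HasDerivAt (fun t : ℝ =>
        (x.1 + s • z.1 + t • (s • EuclideanSpace.single i (1 : ℝ))) i) s 0 := by
      have : (fun t : ℝ => (x.1 + s • z.1 + t • (s • EuclideanSpace.single i (1 : ℝ)) : Eu p) i)
          = fun t => (x.1 + s • z.1) i + t * s := by
        funext t; simp
      rw [this]
      simpa using ((hasDerivAt_id (0 : ℝ)).mul_const s).const_add ((x.1 + s • z.1) i)
    have hm := hc.fun_mul hi
    refine (hm.congr_deriv ?_).congr_of_eventuallyEq (Eventually.of_forall fun t => ?_)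
    · simp only [hF', Function.comp, zero_smul, add_zero, inner_smul_right,
        EuclideanSpace.inner_single_right, sqRad, Prod.fst_add, Prod.snd_add, Prod.smul_fst,
        Prod.smul_snd]
      simp
      ring
    · simp only [hF, sqRad, Function.comp]
      rw [e1, e2]
      congr 1
      simp
      ring
  have ibp : ∀ i, ∫ z, F i z * (z.1 i * gaussWeight p q z) = ∫ z, F' i z * gaussWeight p q z := by
    intro i
    have h := integral_bilinear_hasLineDerivAt_right_eq_neg_left_of_integrable
      (μ := (volume : Measure (Eu p × Eu q))) (B := ContinuousLinearMap.mul ℝ ℝ)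
      (f := F i) (f' := F' i) (g := gaussWeight p q)
      (g' := fun z => -(z.1 i * gaussWeight p q z)) (v := (EuclideanSpace.single i 1, 0))
      (iF' i) (iFz i) (iF i) (fun z _ => dF i z) (fun z _ => hasLineDerivAt_gaussWeight z i)
    simp only [ContinuousLinearMap.mul_apply', mul_neg, integral_neg] at h
    linarith
  have iFz' : ∀ i, Integrable fun z => F i z * (z.1 i * gaussWeight p q z) := fun i => by
    simpa using (iFz i).neg
  have hs := Finset.sum_congr (rfl : (Finset.univ : Finset (Fin p)) = _) fun i _ => ibp i
  rw [← integral_finsetSum _ fun i _ => iFz' i, ← integral_finsetSum _ fun i _ => iF' i] at hs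
  rw [← integral_const_mul]
  refine Eq.trans ?_ (hs.trans ?_)
  · congr 1
    funext z
    simp only [hF, PiLp.inner_apply, Finset.mul_sum, Finset.sum_mul]
    refine Finset.sum_congr rfl fun i _ => ?_
    simp
    ring
  · congr 1
    funext z
    simp only [hF', sqRad]
    rw [← Finset.sum_mul, ← Finset.mul_sum, Finset.sum_add_distrib, ← Finset.sum_mul,
      ← Finset.mul_sum]
    have : ∑ i, ((x.1 + s • z.1) i) ^ 2 = ‖(x + s • z).1‖ ^ 2 := by
      rw [EuclideanSpace.norm_sq_eq]; simp
    rw [this]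
    simp
    ring

end gaussian

section radial_fields

variable {p q : ℕ}

/-- Gaussian integration by parts in the second factor for a radial vector field. -/
theorem integral_gauss_snd {b b' : ℝ × ℝ → ℝ} {C : ℝ} (hb : ContinuousOn b quad)
    (hb' : ContinuousOn b' quad)
    (hd : ∀ y ∈ quad, HasDerivAt (fun t => b (y.1, t)) (b' y) y.2)
    (B : ∀ y ∈ quad, |b y| * (1 + y.2) ≤ C) (B' : ∀ y ∈ quad, |b' y| * (1 + y.2) ≤ C)
    (x : Eu p × Eu q) (s : ℝ) :
    ∫ z, b (sqRad (x + s • z)) * inner ℝ (x.2 + s • z.2) z.2 * gaussWeight p q z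
      = s * ∫ z, (q * b (sqRad (x + s • z)) + 2 * (sqRad (x + s • z)).2 * b' (sqRad (x + s • z)))
          * gaussWeight p q z := by
  have hsw : MapsTo (Prod.swap : ℝ × ℝ → ℝ × ℝ) quad quad := fun y hy => ⟨hy.2, hy.1⟩
  have h := integral_gauss_fst (p := q) (q := p) (b := b ∘ Prod.swap) (b' := b' ∘ Prod.swap)
    (C := C) (hb.comp continuous_swap.continuousOn hsw)
    (hb'.comp continuous_swap.continuousOn hsw) (fun y hy => hd y.swap (hsw hy))
    (fun y hy => B y.swap (hsw hy)) (fun y hy => B' y.swap (hsw hy)) x.swap s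
  have sw : ∀ f : Eu p × Eu q → ℝ, ∫ z, f z = ∫ z : Eu q × Eu p, f z.swap := fun f =>
    (integral_prod_swap (μ := (volume : Measure (Eu p))) (ν := (volume : Measure (Eu q))) f).symm
  rw [sw, sw]
  have g : ∀ z : Eu q × Eu p, gaussWeight p q z.swap = gaussWeight q p z := fun z => by
    simp [gaussWeight, add_comm]
  simp only [g]
  exact h

/-- A function on the quadrant that is regular up to the boundary, together with its first and
pure second derivatives, all suitably bounded. -/
structure RadRegular (θ θ₁ θ₂ θ₁₁ θ₂₂ : ℝ × ℝ → ℝ) (C : ℝ) : Prop where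
  hasFDerivAt : ∀ y ∈ quad, HasFDerivAt θ
    (θ₁ y • ContinuousLinearMap.fst ℝ ℝ ℝ + θ₂ y • ContinuousLinearMap.snd ℝ ℝ ℝ) y
  hasDerivAt_fst : ∀ y ∈ quad, HasDerivAt (fun t => θ₁ (t, y.2)) (θ₁₁ y) y.1
  hasDerivAt_snd : ∀ y ∈ quad, HasDerivAt (fun t => θ₂ (y.1, t)) (θ₂₂ y) y.2
  cont₁ : ContinuousOn θ₁ quad
  cont₂ : ContinuousOn θ₂ quad
  cont₁₁ : ContinuousOn θ₁₁ quad
  cont₂₂ : ContinuousOn θ₂₂ quad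
  bound : ∀ y ∈ quad, |θ y| ≤ C
  bound₁ : ∀ y ∈ quad, |θ₁ y| * (1 + y.1) ≤ C
  bound₂ : ∀ y ∈ quad, |θ₂ y| * (1 + y.2) ≤ C
  bound₁₁ : ∀ y ∈ quad, |θ₁₁ y| * (1 + y.1) ≤ C
  bound₂₂ : ∀ y ∈ quad, |θ₂₂ y| * (1 + y.2) ≤ C

/-- The Laplacian on a product of Euclidean spaces of dimensions `p` and `q`, in terms of
derivatives with respect to the squared radii. -/
def radLap (p q : ℕ) (θ₁ θ₂ θ₁₁ θ₂₂ : ℝ × ℝ → ℝ) (y : ℝ × ℝ) : ℝ :=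
  4 * y.1 * θ₁₁ y + 2 * p * θ₁ y + 4 * y.2 * θ₂₂ y + 2 * q * θ₂ y

section
variable {θ θ₁ θ₂ θ₁₁ θ₂₂ : ℝ × ℝ → ℝ} {C : ℝ}

theorem RadRegular.cont (h : RadRegular θ θ₁ θ₂ θ₁₁ θ₂₂ C) : ContinuousOn θ quad := fun y hy =>
  (h.hasFDerivAt y hy).continuousAt.continuousWithinAt

theorem RadRegular.nonneg (h : RadRegular θ θ₁ θ₂ θ₁₁ θ₂₂ C) : 0 ≤ C :=
  (abs_nonneg _).trans (h.bound 0 ⟨mem_Ici.2 le_rfl, mem_Ici.2 le_rfl⟩)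

theorem RadRegular.continuousOn_radLap (h : RadRegular θ θ₁ θ₂ θ₁₁ θ₂₂ C) :
    ContinuousOn (radLap p q θ₁ θ₂ θ₁₁ θ₂₂) quad := by
  have := h.cont₁
  have := h.cont₂
  have := h.cont₁₁
  have := h.cont₂₂
  unfold radLap
  fun_prop

theorem RadRegular.abs_radLap_le (h : RadRegular θ θ₁ θ₂ θ₁₁ θ₂₂ C) {y : ℝ × ℝ} (hy : y ∈ quad) :
    |radLap p q θ₁ θ₂ θ₁₁ θ₂₂ y| ≤ (8 + 2 * p + 2 * q) * C := by
  have hy1 : 0 ≤ y.1 := hy.1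
  have hy2 : 0 ≤ y.2 := hy.2
  have h1 := h.bound₁ y hy
  have h2 := h.bound₂ y hy
  have h3 := h.bound₁₁ y hy
  have h4 := h.bound₂₂ y hy
  have a1 := abs_nonneg (θ₁ y)
  have a2 := abs_nonneg (θ₂ y)
  have a3 := abs_nonneg (θ₁₁ y)
  have a4 := abs_nonneg (θ₂₂ y)
  have c1 : |θ₁ y| ≤ C := by nlinarith
  have c2 : |θ₂ y| ≤ C := by nlinarith
  have c3 : y.1 * |θ₁₁ y| ≤ C := by nlinarith
  have c4 : y.2 * |θ₂₂ y| ≤ C := by nlinarith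
  unfold radLap
  refine (abs_add_le _ _).trans ?_
  have t1 := abs_add_three (4 * y.1 * θ₁₁ y) (2 * p * θ₁ y) (4 * y.2 * θ₂₂ y)
  simp only [abs_mul, abs_of_nonneg hy1, abs_of_nonneg hy2, Nat.abs_ofNat, Nat.abs_cast] at t1 ⊢
  have hp : (p : ℝ) * |θ₁ y| ≤ p * C := by gcongr
  have hq : (q : ℝ) * |θ₂ y| ≤ q * C := by gcongr
  linarith

/-- The Gaussian average of a radial function solves the heat equation. -/
theorem RadRegular.hasDerivAt_integral (h : RadRegular θ θ₁ θ₂ θ₁₁ θ₂₂ C) (x : Eu p × Eu q)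
    (s : ℝ) :
    HasDerivAt (fun s : ℝ => ∫ z, θ (sqRad (x + s • z)) * gaussWeight p q z)
      (s * ∫ z, radLap p q θ₁ θ₂ θ₁₁ θ₂₂ (sqRad (x + s • z)) * gaussWeight p q z) s := by
  have cth : ∀ {w : ℝ × ℝ → ℝ}, ContinuousOn w quad → ∀ s : ℝ,
      Continuous fun z : Eu p × Eu q => w (sqRad (x + s • z)) := fun hw s =>
    (continuous_comp_sqRad hw).comp (by fun_prop)
  have inte : ∀ {w : ℝ × ℝ → ℝ} {C' : ℝ}, ContinuousOn w quad → (∀ y ∈ quad, |w y| ≤ C') → ∀ s : ℝ,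
      Integrable fun z : Eu p × Eu q => w (sqRad (x + s • z)) * gaussWeight p q z :=
    fun hw hb s => integrable_gaussWeight.bdd_mul (cth hw s).aestronglyMeasurable
      (ae_of_all _ fun z => hb _ (sqRad_mem_quad _))
  set D : ℝ → Eu p × Eu q → ℝ := fun s z =>
    2 * (θ₁ (sqRad (x + s • z)) * inner ℝ (x.1 + s • z.1) z.1 * gaussWeight p q z)
    + 2 * (θ₂ (sqRad (x + s • z)) * inner ℝ (x.2 + s • z.2) z.2 * gaussWeight p q z) with hD
  have t1 : ∀ (s : ℝ) (z : Eu p × Eu q),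
      |θ₁ (sqRad (x + s • z)) * inner ℝ (x.1 + s • z.1) z.1| ≤ C * ‖z.1‖ := by
    intro s z
    have hb := h.bound₁ _ (sqRad_mem_quad (x + s • z))
    have hi := abs_real_inner_le_norm (x.1 + s • z.1) z.1
    rw [abs_mul]
    have e : ‖x.1 + s • z.1‖ ≤ 1 + (sqRad (x + s • z)).1 := by
      simp only [sqRad, Prod.fst_add, Prod.smul_fst]
      nlinarith [sq_nonneg (‖x.1 + s • z.1‖ - 1), norm_nonneg (x.1 + s • z.1)]
    calc _ ≤ |θ₁ (sqRad (x + s • z))| * (‖x.1 + s • z.1‖ * ‖z.1‖) := by gcongr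
      _ ≤ |θ₁ (sqRad (x + s • z))| * ((1 + (sqRad (x + s • z)).1) * ‖z.1‖) := by gcongr
      _ = |θ₁ (sqRad (x + s • z))| * (1 + (sqRad (x + s • z)).1) * ‖z.1‖ := by ring
      _ ≤ _ := by gcongr
  have t2 : ∀ (s : ℝ) (z : Eu p × Eu q),
      |θ₂ (sqRad (x + s • z)) * inner ℝ (x.2 + s • z.2) z.2| ≤ C * ‖z.2‖ := by
    intro s z
    have hb := h.bound₂ _ (sqRad_mem_quad (x + s • z))
    have hi := abs_real_inner_le_norm (x.2 + s • z.2) z.2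
    rw [abs_mul]
    have e : ‖x.2 + s • z.2‖ ≤ 1 + (sqRad (x + s • z)).2 := by
      simp only [sqRad, Prod.snd_add, Prod.smul_snd]
      nlinarith [sq_nonneg (‖x.2 + s • z.2‖ - 1), norm_nonneg (x.2 + s • z.2)]
    calc _ ≤ |θ₂ (sqRad (x + s • z))| * (‖x.2 + s • z.2‖ * ‖z.2‖) := by gcongr
      _ ≤ |θ₂ (sqRad (x + s • z))| * ((1 + (sqRad (x + s • z)).2) * ‖z.2‖) := by gcongr
      _ = |θ₂ (sqRad (x + s • z))| * (1 + (sqRad (x + s • z)).2) * ‖z.2‖ := by ring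
      _ ≤ _ := by gcongr
  have m1 : ∀ s, Continuous fun z : Eu p × Eu q =>
      θ₁ (sqRad (x + s • z)) * inner ℝ (x.1 + s • z.1) z.1 * gaussWeight p q z := fun s =>
    ((cth h.cont₁ s).mul (by fun_prop)).mul continuous_gaussWeight
  have m2 : ∀ s, Continuous fun z : Eu p × Eu q =>
      θ₂ (sqRad (x + s • z)) * inner ℝ (x.2 + s • z.2) z.2 * gaussWeight p q z := fun s =>
    ((cth h.cont₂ s).mul (by fun_prop)).mul continuous_gaussWeight
  have hC := h.nonneg
  have n1 : ∀ (s : ℝ) (z : Eu p × Eu q),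
      ‖θ₁ (sqRad (x + s • z)) * inner ℝ (x.1 + s • z.1) z.1 * gaussWeight p q z‖
        ≤ C * ((‖z.1‖ + ‖z.2‖) * gaussWeight p q z) := by
    intro s z
    have hg := (gaussWeight_pos z).le
    rw [norm_mul, Real.norm_of_nonneg hg, ← mul_assoc]
    gcongr
    refine (t1 s z).trans ?_
    gcongr
    exact le_add_of_nonneg_right (norm_nonneg _)
  have n2 : ∀ (s : ℝ) (z : Eu p × Eu q),
      ‖θ₂ (sqRad (x + s • z)) * inner ℝ (x.2 + s • z.2) z.2 * gaussWeight p q z‖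
        ≤ C * ((‖z.1‖ + ‖z.2‖) * gaussWeight p q z) := by
    intro s z
    have hg := (gaussWeight_pos z).le
    rw [norm_mul, Real.norm_of_nonneg hg, ← mul_assoc]
    gcongr
    refine (t2 s z).trans ?_
    gcongr
    exact le_add_of_nonneg_left (norm_nonneg _)
  have ib := (integrable_norm_mul_gaussWeight (p := p) (q := q)).const_mul C
  have i1 := fun s => ib.mono' (m1 s).aestronglyMeasurable (ae_of_all _ (n1 s))
  have i2 := fun s => ib.mono' (m2 s).aestronglyMeasurable (ae_of_all _ (n2 s))
  have key := hasDerivAt_integral_of_dominated_loc_of_deriv_le (x₀ := s) (s := univ)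
    (μ := (volume : Measure (Eu p × Eu q)))
    (F := fun s z => θ (sqRad (x + s • z)) * gaussWeight p q z) (F' := D)
    (bound := fun z => 4 * (C * ((‖z.1‖ + ‖z.2‖) * gaussWeight p q z)))
    univ_mem (Eventually.of_forall fun s =>
      ((cth h.cont s).mul continuous_gaussWeight).aestronglyMeasurable)
    (inte h.cont h.bound s)
    (((m1 s).const_mul 2).add ((m2 s).const_mul 2)).aestronglyMeasurable
    (ae_of_all _ fun z s _ => by
      refine (norm_add_le _ _).trans ?_
      rw [norm_mul, norm_mul 2, Real.norm_ofNat]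
      linarith [n1 s z, n2 s z])
    (ib.const_mul 4)
    (ae_of_all _ fun z s _ => by
      have hl : HasDerivAt (fun s : ℝ => x + s • z) z s := by
        simpa using ((hasDerivAt_id s).smul_const z).const_add x
      have h1 : HasDerivAt (fun s : ℝ => x.1 + s • z.1) z.1 s := by
        simpa using ((hasDerivAt_id s).smul_const z.1).const_add x.1
      have h2 : HasDerivAt (fun s : ℝ => x.2 + s • z.2) z.2 s := by
        simpa using ((hasDerivAt_id s).smul_const z.2).const_add x.2
      have h3 : HasDerivAt (fun s : ℝ => sqRad (x + s • z))
          (2 * inner ℝ (x.1 + s • z.1) z.1, 2 * inner ℝ (x.2 + s • z.2) z.2) s :=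
        h1.norm_sq.prodMk h2.norm_sq
      have h4 := ((h.hasFDerivAt _ (sqRad_mem_quad (x + s • z))).comp_hasDerivAt s h3).mul_const
        (gaussWeight p q z)
      refine h4.congr_deriv ?_
      simp [hD]
      ring)
  refine key.2.congr_deriv ?_
  simp only [hD]
  rw [integral_add ((i1 s).const_mul 2) ((i2 s).const_mul 2), integral_const_mul,
    integral_const_mul,
    integral_gauss_fst h.cont₁ h.cont₁₁ h.hasDerivAt_fst h.bound₁ h.bound₁₁,
    integral_gauss_snd h.cont₂ h.cont₂₂ h.hasDerivAt_snd h.bound₂ h.bound₂₂]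
  have b1 : ∀ y ∈ quad, |p * θ₁ y + 2 * y.1 * θ₁₁ y| ≤ (p + 2) * C := by
    intro y hy
    have hy1 : 0 ≤ y.1 := hy.1
    have h1 := h.bound₁ y hy
    have h3 := h.bound₁₁ y hy
    have a1 := abs_nonneg (θ₁ y)
    have a3 := abs_nonneg (θ₁₁ y)
    have c1 : |θ₁ y| ≤ C := by nlinarith
    have c3 : y.1 * |θ₁₁ y| ≤ C := by nlinarith
    refine (abs_add_le _ _).trans ?_
    simp only [abs_mul, abs_of_nonneg hy1, Nat.abs_ofNat, Nat.abs_cast]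
    have hp : (p : ℝ) * |θ₁ y| ≤ p * C := by gcongr
    linarith
  have b2 : ∀ y ∈ quad, |q * θ₂ y + 2 * y.2 * θ₂₂ y| ≤ (q + 2) * C := by
    intro y hy
    have hy1 : 0 ≤ y.2 := hy.2
    have h1 := h.bound₂ y hy
    have h3 := h.bound₂₂ y hy
    have a1 := abs_nonneg (θ₂ y)
    have a3 := abs_nonneg (θ₂₂ y)
    have c1 : |θ₂ y| ≤ C := by nlinarith
    have c3 : y.2 * |θ₂₂ y| ≤ C := by nlinarith
    refine (abs_add_le _ _).trans ?_
    simp only [abs_mul, abs_of_nonneg hy1, Nat.abs_ofNat, Nat.abs_cast]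
    have hp : (q : ℝ) * |θ₂ y| ≤ q * C := by gcongr
    linarith
  have k1 := inte (w := fun y => p * θ₁ y + 2 * y.1 * θ₁₁ y) (by
    have := h.cont₁; have := h.cont₁₁; fun_prop) b1 s
  have k2 := inte (w := fun y => q * θ₂ y + 2 * y.2 * θ₂₂ y) (by
    have := h.cont₂; have := h.cont₂₂; fun_prop) b2 s
  rw [mul_left_comm, mul_left_comm 2 s, ← mul_add, ← mul_add, ← integral_add k1 k2,
    ← integral_const_mul]
  congr 1
  congr 1
  funext z
  simp only [radLap]
  ring

end

end radial_fields

section resolvent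

variable {p q : ℕ} {M : ℝ}

/-- The total mass of the Gaussian weight. -/
def gaussMass (p q : ℕ) : ℝ := ∫ z, gaussWeight p q z

theorem gaussMass_pos : 0 < gaussMass p q := by
  refine (integral_pos_iff_support_of_nonneg (fun z => (gaussWeight_pos z).le)
    integrable_gaussWeight).2 ?_
  have : Function.support (gaussWeight p q) = univ := by
    ext z; simp [(gaussWeight_pos z).ne']
  rw [this]
  exact Measure.measure_univ_pos.2 (NeZero.ne _)

/-- The weight in the time variable. -/
def timeWeight (M s : ℝ) : ℝ := s * Real.exp (-(M / 2) * s ^ 2)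

theorem integrable_timeWeight (hM : 0 < M) : Integrable (timeWeight M) :=
  integrable_mul_exp_neg_mul_sq (half_pos hM)

/-- The reference measure for times and Gaussian directions. -/
def baseMeas (p q : ℕ) : Measure (ℝ × (Eu p × Eu q)) := (volume.restrict (Ioi 0)).prod volume

instance : SFinite (baseMeas p q) := by unfold baseMeas; infer_instance

/-- The density, with respect to `baseMeas`, of the measure whose images are the resolvents. -/
def resolvDens (p q : ℕ) (M : ℝ) (y : ℝ × (Eu p × Eu q)) : ℝ :=
  timeWeight M y.1 * (gaussWeight p q y.2 / gaussMass p q)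

theorem continuous_resolvDens : Continuous (resolvDens p q M) := by
  have := continuous_gaussWeight (p := p) (q := q)
  unfold resolvDens timeWeight
  fun_prop

theorem ae_baseMeas_pos : ∀ᵐ y ∂baseMeas p q, 0 < y.1 :=
  Measure.quasiMeasurePreserving_fst.ae (ae_restrict_mem measurableSet_Ioi)

theorem ae_resolvDens_nonneg : ∀ᵐ y ∂baseMeas p q, 0 ≤ resolvDens p q M y := by
  filter_upwards [ae_baseMeas_pos] with y hy
  have := gaussWeight_pos y.2
  have := gaussMass_pos (p := p) (q := q)
  unfold resolvDens timeWeight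
  positivity

theorem integrable_resolvDens (hM : 0 < M) : Integrable (resolvDens p q M) (baseMeas p q) :=
  (integrable_timeWeight hM).restrict.mul_prod (integrable_gaussWeight.div_const _)

/-- The resolvent `(M - Δ)⁻¹` at `x`, as a measure on the squared radii. -/
def resolv (p q : ℕ) (M : ℝ) (x : Eu p × Eu q) : Measure (ℝ × ℝ) :=
  ((baseMeas p q).withDensity fun y => ENNReal.ofReal (resolvDens p q M y)).map
    fun y => sqRad (x + y.1 • y.2)

theorem continuous_path (x : Eu p × Eu q) :
    Continuous fun y : ℝ × (Eu p × Eu q) => sqRad (x + y.1 • y.2) :=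
  continuous_sqRad.comp (by fun_prop)

theorem isFiniteMeasure_resolv (hM : 0 < M) (x : Eu p × Eu q) : IsFiniteMeasure (resolv p q M x) := by
  have : IsFiniteMeasure ((baseMeas p q).withDensity fun y => ENNReal.ofReal (resolvDens p q M y)) :=
    isFiniteMeasure_withDensity_ofReal (integrable_resolvDens hM).2
  unfold resolv
  infer_instance

theorem ae_resolv_mem_quad (x : Eu p × Eu q) : ∀ᵐ y ∂resolv p q M x, y ∈ quad := by
  unfold resolv
  refine (ae_map_iff (continuous_path x).aemeasurable
    (measurableSet_Ici.prod measurableSet_Ici)).2 ?_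
  exact ae_of_all _ fun y => sqRad_mem_quad _

theorem integral_resolv {w : ℝ × ℝ → ℝ} (hw : Measurable w) (x : Eu p × Eu q) :
    ∫ y, w y ∂resolv p q M x
      = ∫ y, resolvDens p q M y * w (sqRad (x + y.1 • y.2)) ∂baseMeas p q := by
  unfold resolv
  rw [integral_map (continuous_path x).aemeasurable hw.aestronglyMeasurable,
    integral_withDensity_eq_integral_toReal_smul
      continuous_resolvDens.measurable.ennreal_ofReal (ae_of_all _ fun _ => ENNReal.ofReal_lt_top)]
  refine integral_congr_ae ?_
  filter_upwards [ae_resolvDens_nonneg] with y hy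
  rw [ENNReal.toReal_ofReal hy, smul_eq_mul]

section
variable {w : ℝ × ℝ → ℝ} {C : ℝ}

theorem integrable_resolvDens_mul (hM : 0 < M) (hw : Measurable w) (hb : ∀ y ∈ quad, |w y| ≤ C)
    (x : Eu p × Eu q) :
    Integrable (fun y => resolvDens p q M y * w (sqRad (x + y.1 • y.2))) (baseMeas p q) :=
  (integrable_resolvDens hM).mul_bdd (c := C) (hw.comp (continuous_path x).measurable).aestronglyMeasurable
    (ae_of_all _ fun _ => hb _ (sqRad_mem_quad _))

theorem integral_resolv_iterated (hM : 0 < M) (hw : Measurable w) (hb : ∀ y ∈ quad, |w y| ≤ C)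
    (x : Eu p × Eu q) :
    ∫ y, w y ∂resolv p q M x
      = (∫ s in Ioi (0 : ℝ), timeWeight M s * ∫ z, w (sqRad (x + s • z)) * gaussWeight p q z)
        / gaussMass p q := by
  rw [integral_resolv hw, baseMeas, integral_prod _ (integrable_resolvDens_mul hM hw hb x),
    ← integral_div]
  refine integral_congr_ae (ae_of_all _ fun s => ?_)
  simp only [resolvDens]
  rw [← integral_const_mul, ← integral_div]
  refine integral_congr_ae (ae_of_all _ fun z => ?_)
  simp only
  ring

theorem integrable_resolv (hM : 0 < M) (hw : Measurable w) (hb : ∀ y ∈ quad, |w y| ≤ C)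
    (x : Eu p × Eu q) : Integrable w (resolv p q M x) := by
  have := isFiniteMeasure_resolv (p := p) (q := q) hM x
  refine Integrable.of_bound hw.aestronglyMeasurable C ?_
  filter_upwards [ae_resolv_mem_quad x] with y hy using hb y hy

theorem abs_integral_gauss_le (hb : ∀ y ∈ quad, |w y| ≤ C) (x : Eu p × Eu q) (s : ℝ) :
    |∫ z, w (sqRad (x + s • z)) * gaussWeight p q z| ≤ C * gaussMass p q := by
  rw [gaussMass, ← integral_const_mul]
  rw [← Real.norm_eq_abs]
  refine norm_integral_le_of_norm_le (integrable_gaussWeight.const_mul C) (ae_of_all _ fun z => ?_)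
  rw [norm_mul, Real.norm_of_nonneg (gaussWeight_pos z).le]
  exact mul_le_mul_of_nonneg_right (hb _ (sqRad_mem_quad _)) (gaussWeight_pos z).le

end

/-- The resolvent inverts `M - Δ`. -/
theorem RadRegular.integral_resolv {θ θ₁ θ₂ θ₁₁ θ₂₂ w : ℝ × ℝ → ℝ} {C : ℝ}
    (h : RadRegular θ θ₁ θ₂ θ₁₁ θ₂₂ C) (hM : 0 < M) (hw : Measurable w)
    (he : ∀ y ∈ quad, w y = M * θ y - radLap p q θ₁ θ₂ θ₁₁ θ₂₂ y) (x : Eu p × Eu q) :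
    ∫ y, w y ∂resolv p q M x = θ (sqRad x) := by
  have hb : ∀ y ∈ quad, |w y| ≤ M * C + (8 + 2 * p + 2 * q) * C := fun y hy => by
    rw [he y hy]
    refine (abs_sub _ _).trans (add_le_add ?_ (h.abs_radLap_le hy))
    rw [abs_mul, abs_of_pos hM]
    gcongr
    exact h.bound y hy
  have cth : ∀ {w : ℝ × ℝ → ℝ}, ContinuousOn w quad → ∀ s : ℝ,
      Continuous fun z : Eu p × Eu q => w (sqRad (x + s • z)) := fun hw s =>
    (continuous_comp_sqRad hw).comp (by fun_prop)
  have inte : ∀ {w : ℝ × ℝ → ℝ} {C' : ℝ}, ContinuousOn w quad → (∀ y ∈ quad, |w y| ≤ C') → ∀ s : ℝ,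
      Integrable fun z : Eu p × Eu q => w (sqRad (x + s • z)) * gaussWeight p q z :=
    fun hw hb s => integrable_gaussWeight.bdd_mul (cth hw s).aestronglyMeasurable
      (ae_of_all _ fun z => hb _ (sqRad_mem_quad _))
  have hval : ∀ s : ℝ, ∫ z, w (sqRad (x + s • z)) * gaussWeight p q z
      = M * (∫ z, θ (sqRad (x + s • z)) * gaussWeight p q z)
        - ∫ z, radLap p q θ₁ θ₂ θ₁₁ θ₂₂ (sqRad (x + s • z)) * gaussWeight p q z := fun s => by
    rw [← integral_const_mul, ← integral_sub ((inte h.cont h.bound s).const_mul M)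
      (inte h.continuousOn_radLap (fun y hy => h.abs_radLap_le hy) s)]
    refine integral_congr_ae (ae_of_all _ fun z => ?_)
    simp only
    rw [he _ (sqRad_mem_quad _)]
    ring
  have hd : ∀ s : ℝ, HasDerivAt (fun s : ℝ => -(Real.exp (-(M / 2) * s ^ 2)
      * ∫ z, θ (sqRad (x + s • z)) * gaussWeight p q z))
      (timeWeight M s * ∫ z, w (sqRad (x + s • z)) * gaussWeight p q z) s := fun s => by
    have he : HasDerivAt (fun s : ℝ => Real.exp (-(M / 2) * s ^ 2))
        (Real.exp (-(M / 2) * s ^ 2) * (-(M / 2) * (2 * s))) s := by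
      simpa using ((hasDerivAt_pow 2 s).const_mul (-(M / 2))).exp
    refine (he.fun_mul (h.hasDerivAt_integral x s)).fun_neg.congr_deriv ?_
    rw [hval]
    unfold timeWeight
    ring
  have hi : IntegrableOn (fun s => timeWeight M s * ∫ z, w (sqRad (x + s • z)) * gaussWeight p q z)
      (Ioi 0) := by
    refine (integrable_timeWeight hM).restrict.mul_bdd ?_
      (ae_of_all _ fun s => abs_integral_gauss_le hb x s)
    refine StronglyMeasurable.aestronglyMeasurable ?_
    refine StronglyMeasurable.integral_prod_right (f := fun s (z : Eu p × Eu q) =>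
      w (sqRad (x + s • z)) * gaussWeight p q z) ?_
    exact ((hw.comp (continuous_path x).measurable).mul
      (continuous_gaussWeight.measurable.comp measurable_snd)).stronglyMeasurable
  have ht : Tendsto (fun s : ℝ => -(Real.exp (-(M / 2) * s ^ 2)
      * ∫ z, θ (sqRad (x + s • z)) * gaussWeight p q z)) atTop (𝓝 0) := by
    have h0 : Tendsto (fun s : ℝ => Real.exp (-(M / 2) * s ^ 2)) atTop (𝓝 0) := by
      refine Real.tendsto_exp_atBot.comp ?_
      simpa using (tendsto_pow_atTop (α := ℝ) two_ne_zero).const_mul_atTop (half_pos hM)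
    have : Tendsto (fun s : ℝ => Real.exp (-(M / 2) * s ^ 2)
      * ∫ z, θ (sqRad (x + s • z)) * gaussWeight p q z) atTop (𝓝 0) :=
      h0.zero_mul_isBoundedUnder_le (isBoundedUnder_of
        ⟨C * gaussMass p q, fun s => abs_integral_gauss_le h.bound x s⟩)
    simpa using this.neg
  rw [integral_resolv_iterated hM hw hb, integral_Ioi_of_hasDerivAt_of_tendsto' (fun s _ => hd s) hi ht]
  have := (gaussMass_pos (p := p) (q := q)).ne'
  simp only [ne_eq, OfNat.ofNat_ne_zero, not_false_eq_true, zero_pow, mul_zero, Real.exp_zero,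
    zero_smul, add_zero, one_mul, integral_const_mul]
  rw [← gaussMass]
  field_simp
  ring

end resolvent

section slices

variable {p q : ℕ} {M : ℝ}

theorem integral_comp_measurePreserving {α β : Type*} [MeasurableSpace α] [MeasurableSpace β]
    {μ : Measure α} {ν : Measure β} {T : α → β} (hT : MeasurePreserving T μ ν) {f : β → ℝ}
    (hf : AEStronglyMeasurable f ν) : ∫ x, f (T x) ∂μ = ∫ y, f y ∂ν := by
  rw [← integral_map hT.measurable.aemeasurable (by rwa [hT.map_eq]), hT.map_eq]

theorem gaussWeight_sub_le {R : ℝ} {a : Eu p × Eu q} (h1 : ‖a.1‖ ≤ R) (h2 : ‖a.2‖ ≤ R)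
    (z : Eu p × Eu q) : gaussWeight p q (z - a)
      ≤ Real.exp (R ^ 2) * Real.exp (-(1 / 4) * (‖z.1‖ ^ 2 + ‖z.2‖ ^ 2)) := by
  rw [← Real.exp_add, gaussWeight]
  refine Real.exp_le_exp.2 ?_
  have key : ∀ {d : ℕ} (u v : Eu d), ‖v‖ ≤ R → ‖u‖ ^ 2 ≤ 2 * ‖u - v‖ ^ 2 + 2 * R ^ 2 := by
    intro d u v hv
    have h := norm_add_le (u - v) v
    rw [sub_add_cancel] at h
    have : ‖v‖ ^ 2 ≤ R ^ 2 := pow_le_pow_left₀ (norm_nonneg _) hv 2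
    nlinarith [sq_nonneg (‖u - v‖ - ‖v‖), norm_nonneg u, norm_nonneg (u - v), norm_nonneg v]
  have k1 := key z.1 a.1 h1
  have k2 := key z.2 a.2 h2
  simp only [Prod.fst_sub, Prod.snd_sub]
  linarith

theorem continuous_integral_gauss {w : ℝ × ℝ → ℝ} {C : ℝ} (hw : Measurable w)
    (hb : ∀ y ∈ quad, |w y| ≤ C) {s : ℝ} (hs : s ≠ 0) :
    Continuous fun x : Eu p × Eu q => ∫ z, w (sqRad (x + s • z)) * gaussWeight p q z := by
  have e : ∀ x : Eu p × Eu q, ∫ z, w (sqRad (x + s • z)) * gaussWeight p q z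
      = ∫ z, w (sqRad (s • z)) * gaussWeight p q (z - s⁻¹ • x) := fun x => by
    rw [← integral_sub_right_eq_self _ (s⁻¹ • x)]
    refine integral_congr_ae (ae_of_all _ fun z => ?_)
    simp only
    congr 3
    rw [smul_sub, smul_inv_smul₀ hs]
    abel
  simp only [e]
  have hm : Measurable fun z : Eu p × Eu q => w (sqRad (s • z)) :=
    hw.comp (continuous_sqRad.comp (by fun_prop)).measurable
  have hC : 0 ≤ C := (abs_nonneg _).trans (hb _ (sqRad_mem_quad (0 : Eu p × Eu q)))
  refine continuous_iff_continuousAt.2 fun x₀ => ?_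
  refine continuousAt_of_dominated (bound := fun z => C * (Real.exp ((‖s⁻¹‖ * (‖x₀‖ + 1)) ^ 2)
      * Real.exp (-(1 / 4) * (‖z.1‖ ^ 2 + ‖z.2‖ ^ 2)))) (Eventually.of_forall fun x => ?_) ?_
      (((integrable_exp_neg_mul_sqRad (by norm_num)).const_mul _).const_mul _)
      (ae_of_all _ fun z => ?_)
  · exact (hm.mul (continuous_gaussWeight.comp (by fun_prop)).measurable).aestronglyMeasurable
  · filter_upwards [Metric.ball_mem_nhds x₀ one_pos] with x hx
    have hx' : ‖x‖ ≤ ‖x₀‖ + 1 := by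
      have := norm_add_le x₀ (x - x₀)
      rw [add_sub_cancel, ← dist_eq_norm] at this
      linarith [Metric.mem_ball.1 hx]
    refine ae_of_all _ fun z => ?_
    rw [norm_mul, Real.norm_of_nonneg (gaussWeight_pos _).le]
    refine mul_le_mul (hb _ (sqRad_mem_quad _)) (gaussWeight_sub_le ?_ ?_ z)
      (gaussWeight_pos _).le hC
    · rw [Prod.smul_fst, norm_smul]
      gcongr
      exact (norm_fst_le x).trans hx'
    · rw [Prod.smul_snd, norm_smul]
      gcongr
      exact (norm_snd_le x).trans hx'
  · exact (continuous_const.mul (continuous_gaussWeight.comp (by fun_prop))).continuousAt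

theorem continuous_integral_resolv {w : ℝ × ℝ → ℝ} {C : ℝ} (hM : 0 < M) (hw : Measurable w)
    (hb : ∀ y ∈ quad, |w y| ≤ C) :
    Continuous fun x : Eu p × Eu q => ∫ y, w y ∂resolv p q M x := by
  simp only [integral_resolv_iterated hM hw hb]
  refine Continuous.div_const ?_ _
  refine continuous_of_dominated (bound := fun s => ‖timeWeight M s‖ * (C * gaussMass p q))
    (fun x => ?_) (fun x => ae_of_all _ fun s => ?_)
    ((integrable_timeWeight hM).restrict.norm.mul_const _) ?_
  · refine (integrable_timeWeight hM).restrict.aestronglyMeasurable.mul ?_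
    refine StronglyMeasurable.aestronglyMeasurable ?_
    refine StronglyMeasurable.integral_prod_right (f := fun s (z : Eu p × Eu q) =>
      w (sqRad (x + s • z)) * gaussWeight p q z) ?_
    exact ((hw.comp (continuous_path x).measurable).mul
      (continuous_gaussWeight.measurable.comp measurable_snd)).stronglyMeasurable
  · rw [norm_mul]
    exact mul_le_mul_of_nonneg_left (abs_integral_gauss_le hb x s) (norm_nonneg _)
  · filter_upwards [ae_restrict_mem measurableSet_Ioi] with s hs
    exact continuous_const.mul (continuous_integral_gauss hw hb (ne_of_gt hs))

theorem integral_resolv_of_isometry {p' q' : ℕ} {A : Eu p × Eu q → Eu p' × Eu q'}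
    (hA : MeasurePreserving A volume volume) (hl : ∀ x (s : ℝ) z, A (x + s • z) = A x + s • A z)
    (hg : ∀ z, gaussWeight p' q' (A z) = gaussWeight p q z) {w : ℝ × ℝ → ℝ} (hw : Measurable w)
    {σ : ℝ × ℝ → ℝ × ℝ} (hσ : Measurable σ) (hr : ∀ x, sqRad (A x) = σ (sqRad x))
    (x : Eu p × Eu q) :
    ∫ y, w y ∂resolv p' q' M (A x) = ∫ y, w (σ y) ∂resolv p q M x := by
  have hmass : gaussMass p' q' = gaussMass p q := by
    unfold gaussMass
    rw [← integral_comp_measurePreserving hA continuous_gaussWeight.aestronglyMeasurable]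
    simp only [hg]
  have hT : MeasurePreserving (Prod.map id A) (baseMeas p q) (baseMeas p' q') :=
    (MeasurePreserving.id _).prod hA
  rw [integral_resolv hw, integral_resolv (w := fun y => w (σ y)) (hw.comp hσ), ← integral_comp_measurePreserving hT]
  · simp only [Prod.map_fst, Prod.map_snd, id, ← hl, hr, resolvDens, hg, hmass]
  · exact (continuous_resolvDens.measurable.mul
      (hw.comp (continuous_path _).measurable)).aestronglyMeasurable

theorem integral_resolv_congr {x x' : Eu p × Eu q} (h : sqRad x = sqRad x') {w : ℝ × ℝ → ℝ}
    (hw : Measurable w) : ∫ y, w y ∂resolv p q M x' = ∫ y, w y ∂resolv p q M x := by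
  have h1 : ‖x.1‖ = ‖x'.1‖ := by
    have := congrArg Prod.fst h
    exact (pow_left_inj₀ (norm_nonneg _) (norm_nonneg _) two_ne_zero).1 this
  have h2 : ‖x.2‖ = ‖x'.2‖ := by
    have := congrArg Prod.snd h
    exact (pow_left_inj₀ (norm_nonneg _) (norm_nonneg _) two_ne_zero).1 this
  set R₁ := Submodule.reflection (Submodule.span ℝ {x.1 - x'.1})ᗮ
  set R₂ := Submodule.reflection (Submodule.span ℝ {x.2 - x'.2})ᗮ
  have hx : Prod.map R₁ R₂ x = x' :=
    Prod.ext (Submodule.reflection_sub h1) (Submodule.reflection_sub h2)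
  rw [← hx]
  refine integral_resolv_of_isometry (R₁.measurePreserving.prod R₂.measurePreserving)
    (fun x s z => ?_) (fun z => ?_) hw measurable_id (fun x => ?_) x
  · ext1 <;> simp
  · simp [gaussWeight]
  · simp [sqRad]

theorem integral_resolv_swap {w : ℝ × ℝ → ℝ} (hw : Measurable w) (x : Eu p × Eu q) :
    ∫ y, w y ∂resolv q p M x.swap = ∫ y, w y.swap ∂resolv p q M x :=
  integral_resolv_of_isometry Measure.measurePreserving_swap (fun _ _ _ => rfl)
    (fun z => by simp [gaussWeight, add_comm]) hw measurable_swap (fun _ => rfl) x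

/-- The resolvent is symmetric. -/
theorem RadRegular.integral_integral_resolv_mul {θ θ₁ θ₂ θ₁₁ θ₂₂ w v : ℝ × ℝ → ℝ} {C Cw : ℝ}
    (h : RadRegular θ θ₁ θ₂ θ₁₁ θ₂₂ C) (hM : 0 < M) (hw : Measurable w)
    (hb : ∀ y ∈ quad, |w y| ≤ Cw) (hv : Measurable v)
    (he : ∀ y ∈ quad, v y = M * θ y - radLap p q θ₁ θ₂ θ₁₁ θ₂₂ y)
    (hi : Integrable fun x : Eu p × Eu q => v (sqRad x)) :
    ∫ x : Eu p × Eu q, (∫ y, w y ∂resolv p q M x) * v (sqRad x)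
      = ∫ x : Eu p × Eu q, w (sqRad x) * θ (sqRad x) := by
  set I : (ℝ × (Eu p × Eu q)) × (Eu p × Eu q) → ℝ := fun t =>
    resolvDens p q M t.1 * v (sqRad t.2) * w (sqRad (t.2 + t.1.1 • t.1.2)) with hI
  have iI : Integrable I ((baseMeas p q).prod volume) := by
    refine ((integrable_resolvDens hM).mul_prod hi).mul_bdd (c := Cw) ?_
      (ae_of_all _ fun _ => hb _ (sqRad_mem_quad _))
    exact (hw.comp (continuous_sqRad.comp (by fun_prop)).measurable).aestronglyMeasurable
  have hT : MeasurePreserving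
      (fun t : (ℝ × (Eu p × Eu q)) × (Eu p × Eu q) => (id t.1, t.2 + -(t.1.1 • t.1.2)))
      ((baseMeas p q).prod volume) ((baseMeas p q).prod volume) :=
    (MeasurePreserving.id _).skew_product (g := fun (a : ℝ × (Eu p × Eu q)) z => z + -(a.1 • a.2))
      (by unfold Function.uncurry; exact Continuous.measurable (by fun_prop))
      (ae_of_all _ fun a => map_add_right_eq_self _ _)
  have iT := hT.integrable_comp_of_integrable iI
  have e1 : ∫ x : Eu p × Eu q, (∫ y, w y ∂resolv p q M x) * v (sqRad x)
      = ∫ t, I t ∂((baseMeas p q).prod volume) := by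
    rw [integral_prod_symm _ iI]
    refine integral_congr_ae (ae_of_all _ fun x => ?_)
    simp only [SaddleProfile.integral_resolv hw, hI]
    rw [← integral_mul_const]
    refine integral_congr_ae (ae_of_all _ fun x => ?_)
    simp only
    ring
  rw [e1, ← integral_comp_measurePreserving hT iI.aestronglyMeasurable]
  refine (integral_prod_symm _ iT).trans ?_
  refine integral_congr_ae (ae_of_all _ fun x => ?_)
  simp only [Function.comp, hI, id, neg_add_cancel_right]
  have : (volume : Measure (Eu p × Eu q)).IsNegInvariant :=
    Measure.IsAddHaarMeasure.isNegInvariant_of_regular _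
  have hneg : MeasurePreserving (Prod.map id Neg.neg) (baseMeas p q) (baseMeas p q) :=
    (MeasurePreserving.id _).prod (Measure.measurePreserving_neg _)
  rw [← h.integral_resolv hM hv he x, SaddleProfile.integral_resolv hv, ← integral_const_mul,
    ← integral_comp_measurePreserving hneg]
  · refine integral_congr_ae (ae_of_all _ fun y => ?_)
    simp only [Prod.map_fst, Prod.map_snd, id, smul_neg, resolvDens, gaussWeight, Prod.fst_neg,
      Prod.snd_neg, norm_neg, neg_neg]
    ring
  · exact ((continuous_resolvDens.measurable.mul
      (hv.comp (continuous_sqRad.comp (by fun_prop)).measurable)).mul_const _).aestronglyMeasurable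

section
variable [NeZero p] [NeZero q]

/-- A point with prescribed squared radii. -/
def radPt (p q : ℕ) [NeZero p] [NeZero q] (y : ℝ × ℝ) : Eu p × Eu q :=
  (EuclideanSpace.single 0 √y.1, EuclideanSpace.single 0 √y.2)

theorem sqRad_radPt {y : ℝ × ℝ} (hy : y ∈ quad) : sqRad (radPt p q y) = y := by
  ext1 <;> simp [sqRad, radPt, Real.sq_sqrt hy.1, Real.sq_sqrt hy.2]

theorem continuous_radPt : Continuous (radPt p q) := by
  have : ∀ {d : ℕ} [NeZero d], Continuous fun r : ℝ => (EuclideanSpace.single 0 r : Eu d) := by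
    intro d _
    have h : (fun r : ℝ => (EuclideanSpace.single 0 r : Eu d))
        = fun r : ℝ => r • EuclideanSpace.single 0 1 := by
      funext r
      ext i
      by_cases hi : i = 0 <;> simp [hi]
    rw [h]
    fun_prop
  exact (this.comp (by fun_prop)).prodMk (this.comp (by fun_prop))

/-- The resolvent acting on functions of the squared radii. -/
def resolvOp (p q : ℕ) [NeZero p] [NeZero q] (M : ℝ) (w : ℝ × ℝ → ℝ) (y : ℝ × ℝ) : ℝ :=
  ∫ v, w v ∂resolv p q M (radPt p q y)

end

end slices

section resolvent_order

variable {p q : ℕ} [NeZero p] [NeZero q] {M : ℝ}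

section
variable {w w' : ℝ × ℝ → ℝ} {C C' : ℝ}

theorem continuous_resolvOp (hM : 0 < M) (hw : Measurable w) (hb : ∀ y ∈ quad, |w y| ≤ C) :
    Continuous (resolvOp p q M w) :=
  (continuous_integral_resolv hM hw hb).comp continuous_radPt

theorem resolvOp_mono (hM : 0 < M) (hw : Measurable w) (hb : ∀ y ∈ quad, |w y| ≤ C)
    (hw' : Measurable w') (hb' : ∀ y ∈ quad, |w' y| ≤ C') (h : ∀ y ∈ quad, w y ≤ w' y) (y : ℝ × ℝ) :
    resolvOp p q M w y ≤ resolvOp p q M w' y := by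
  refine integral_mono_ae (integrable_resolv hM hw hb _) (integrable_resolv hM hw' hb' _) ?_
  filter_upwards [ae_resolv_mem_quad _] with v hv using h v hv

theorem resolvOp_nonneg (h : ∀ y ∈ quad, 0 ≤ w y) (y : ℝ × ℝ) : 0 ≤ resolvOp p q M w y := by
  refine integral_nonneg_of_ae ?_
  filter_upwards [ae_resolv_mem_quad _] with v hv using h v hv

theorem resolvOp_congr (h : ∀ y ∈ quad, w y = w' y) : resolvOp p q M w = resolvOp p q M w' := by
  funext y
  refine integral_congr_ae ?_
  filter_upwards [ae_resolv_mem_quad _] with v hv using h v hv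

theorem resolvOp_swap (hw : Measurable w) (h : ∀ y ∈ quad, w y.swap = w y) (y : ℝ × ℝ) :
    resolvOp p p M w y.swap = resolvOp p p M w y := by
  have e : resolvOp p p M w y.swap = resolvOp p p M (fun y => w y.swap) y :=
    integral_resolv_swap hw (radPt p p y)
  rw [e, resolvOp_congr h]

theorem resolvOp_sqRad (hw : Measurable w) (x : Eu p × Eu q) :
    resolvOp p q M w (sqRad x) = ∫ y, w y ∂resolv p q M x :=
  integral_resolv_congr (sqRad_radPt (sqRad_mem_quad x)).symm hw

theorem tendsto_resolvOp (hM : 0 < M) {W : ℕ → ℝ × ℝ → ℝ} (hW : ∀ n, Measurable (W n))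
    (hb : ∀ n, ∀ y ∈ quad, |W n y| ≤ C) (h : ∀ y ∈ quad, Tendsto (fun n => W n y) atTop (𝓝 (w y)))
    (y : ℝ × ℝ) : Tendsto (fun n => resolvOp p q M (W n) y) atTop (𝓝 (resolvOp p q M w y)) := by
  have := isFiniteMeasure_resolv hM (radPt p q y)
  refine tendsto_integral_of_dominated_convergence (fun _ => C)
    (fun n => (hW n).aestronglyMeasurable) (integrable_const C) (fun n => ?_) ?_
  · filter_upwards [ae_resolv_mem_quad _] with v hv using hb n v hv
  · filter_upwards [ae_resolv_mem_quad _] with v hv using h v hv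

end

/-- The model barrier in one variable. -/
def bar (A β s : ℝ) : ℝ := (A + s) ^ (-β)

/-- The coefficient produced by applying minus the Laplacian to the model barrier. -/
def barCoef (p : ℕ) (A β s : ℝ) : ℝ := (2 * p * β * (A + s) - 4 * β * (β + 1) * s) / (A + s) ^ 2

theorem measurable_bar (A β : ℝ) : Measurable (bar A β) := by unfold bar; fun_prop

theorem measurable_barCoef (p : ℕ) (A β : ℝ) : Measurable (barCoef p A β) := by
  unfold barCoef; fun_prop

theorem bar_pos {A s : ℝ} (β : ℝ) (hA : 0 < A) (hs : 0 ≤ s) : 0 < bar A β s :=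
  Real.rpow_pos_of_pos (by positivity) _

theorem hasDerivAt_bar {A s : ℝ} (β : ℝ) (hA : 0 < A) (hs : 0 ≤ s) :
    HasDerivAt (bar A β) (-β * bar A β s / (A + s)) s := by
  have hp : 0 < A + s := by positivity
  have h := ((hasDerivAt_id s).const_add A).rpow_const (p := -β) (Or.inl hp.ne')
  refine h.congr_deriv ?_
  simp only [bar, id]
  rw [Real.rpow_sub_one hp.ne']
  ring

theorem hasDerivAt_bar_deriv {A s : ℝ} (β : ℝ) (hA : 0 < A) (hs : 0 ≤ s) :
    HasDerivAt (fun t => -β * bar A β t / (A + t)) (β * (β + 1) * bar A β s / (A + s) ^ 2) s := by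
  have hp : 0 < A + s := by positivity
  have h := ((hasDerivAt_bar β hA hs).const_mul (-β)).fun_div ((hasDerivAt_id s).const_add A) hp.ne'
  refine h.congr_deriv ?_
  simp only [id]
  field_simp
  ring

theorem continuousOn_bar {A : ℝ} (β : ℝ) (hA : 0 < A) : ContinuousOn (bar A β) (Ici 0) := fun _ hs =>
  (hasDerivAt_bar β hA hs).continuousAt.continuousWithinAt

theorem bar_le {A β s : ℝ} (hA : 0 < A) (hβ : 0 ≤ β) (hs : 0 ≤ s) : bar A β s ≤ A ^ (-β) :=
  Real.rpow_le_rpow_of_nonpos hA (by linarith) (by linarith)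

/-- Products of model barriers are regular up to the boundary. -/
theorem radRegular_bar {A β A' β' : ℝ} (hA : 0 < A) (hβ : 0 ≤ β) (hA' : 0 < A') (hβ' : 0 ≤ β')
    (c : ℝ) : ∃ C, RadRegular (fun y => c * (bar A β y.1 * bar A' β' y.2))
      (fun y => c * (-β * bar A β y.1 / (A + y.1) * bar A' β' y.2))
      (fun y => c * (bar A β y.1 * (-β' * bar A' β' y.2 / (A' + y.2))))
      (fun y => c * (β * (β + 1) * bar A β y.1 / (A + y.1) ^ 2 * bar A' β' y.2))
      (fun y => c * (bar A β y.1 * (β' * (β' + 1) * bar A' β' y.2 / (A' + y.2) ^ 2))) C := by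
  have cb : ContinuousOn (fun y : ℝ × ℝ => bar A β y.1) quad :=
    (continuousOn_bar β hA).comp continuous_fst.continuousOn fun y hy => hy.1
  have cb' : ContinuousOn (fun y : ℝ × ℝ => bar A' β' y.2) quad :=
    (continuousOn_bar β' hA').comp continuous_snd.continuousOn fun y hy => hy.2
  have n1 : ∀ y ∈ quad, A + y.1 ≠ 0 := fun y hy => (add_pos_of_pos_of_nonneg hA hy.1).ne'
  have n2 : ∀ y ∈ quad, A' + y.2 ≠ 0 := fun y hy => (add_pos_of_pos_of_nonneg hA' hy.2).ne'
  have n1' : ∀ y ∈ quad, (A + y.1) ^ 2 ≠ 0 := fun y hy => pow_ne_zero _ (n1 y hy)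
  have n2' : ∀ y ∈ quad, (A' + y.2) ^ 2 ≠ 0 := fun y hy => pow_ne_zero _ (n2 y hy)
  have ratio : ∀ {a s : ℝ}, 0 < a → 0 ≤ s → (1 + s) / (a + s) ≤ 1 + 1 / a := by
    intro a s ha hs
    rw [div_le_iff₀ (by positivity)]
    have : (1 + 1 / a) * (a + s) = 1 + s + (a + s / a) := by field_simp; ring
    rw [this]
    have : 0 ≤ a + s / a := by positivity
    linarith
  have ratio2 : ∀ {a s : ℝ}, 0 < a → 0 ≤ s → (1 + s) / (a + s) ^ 2 ≤ (1 + 1 / a) * (1 / a) := by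
    intro a s ha hs
    have h1 := ratio ha hs
    have h2 : 1 / (a + s) ≤ 1 / a := one_div_le_one_div_of_le ha (by linarith)
    have h3 : 0 ≤ 1 / (a + s) := by positivity
    calc (1 + s) / (a + s) ^ 2 = (1 + s) / (a + s) * (1 / (a + s)) := by field_simp
      _ ≤ _ := by gcongr
  set K := A ^ (-β) * A' ^ (-β')
  have hK : ∀ y ∈ quad, |bar A β y.1 * bar A' β' y.2| ≤ K := by
    intro y hy
    have h1 := bar_pos β hA hy.1
    have h2 := bar_pos β' hA' hy.2
    rw [abs_of_pos (mul_pos h1 h2)]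
    exact mul_le_mul (bar_le hA hβ hy.1) (bar_le hA' hβ' hy.2) h2.le (by positivity)
  have hK0 : 0 ≤ K := by positivity
  set C := |c| * K * (1 + β * (1 + 1 / A) + β' * (1 + 1 / A') + β * (β + 1) * ((1 + 1 / A) * (1 / A))
    + β' * (β' + 1) * ((1 + 1 / A') * (1 / A')))
  have t1 : 0 ≤ β * (1 + 1 / A) := by positivity
  have t2 : 0 ≤ β' * (1 + 1 / A') := by positivity
  have t3 : 0 ≤ β * (β + 1) * ((1 + 1 / A) * (1 / A)) := by positivity
  have t4 : 0 ≤ β' * (β' + 1) * ((1 + 1 / A') * (1 / A')) := by positivity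
  have hcK : 0 ≤ |c| * K := by positivity
  have gen : ∀ {y : ℝ × ℝ} {e k : ℝ}, y ∈ quad → 0 ≤ e → e ≤ k → k ≤ 1 + β * (1 + 1 / A)
      + β' * (1 + 1 / A') + β * (β + 1) * ((1 + 1 / A) * (1 / A))
      + β' * (β' + 1) * ((1 + 1 / A') * (1 / A')) →
      |c| * |bar A β y.1 * bar A' β' y.2| * e ≤ C := by
    intro y e k hy h0 h1 h2
    have := hK y hy
    calc |c| * |bar A β y.1 * bar A' β' y.2| * e ≤ |c| * K * e := by gcongr
      _ ≤ _ := mul_le_mul_of_nonneg_left (h1.trans h2) hcK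
  refine ⟨C, fun y hy => ?_, fun y hy => ?_, fun y hy => ?_, ?_, ?_, ?_, ?_, fun y hy => ?_,
    fun y hy => ?_, fun y hy => ?_, fun y hy => ?_, fun y hy => ?_⟩
  · have h1 := (hasDerivAt_bar β hA hy.1).hasFDerivAt.comp y
      (hasFDerivAt_fst (𝕜 := ℝ) (E := ℝ) (F := ℝ) (p := y))
    have h2 := (hasDerivAt_bar β' hA' hy.2).hasFDerivAt.comp y
      (hasFDerivAt_snd (𝕜 := ℝ) (E := ℝ) (F := ℝ) (p := y))
    refine ((h1.mul h2).const_mul c).congr_fderiv ?_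
    (ext <;> simp [-mul_eq_mul_left_iff]); ring
  · exact ((hasDerivAt_bar_deriv β hA hy.1).mul_const (bar A' β' y.2)).const_mul c
  · exact ((hasDerivAt_bar_deriv β' hA' hy.2).const_mul (bar A β y.1)).const_mul c
  · fun_prop (disch := assumption)
  · fun_prop (disch := assumption)
  · fun_prop (disch := assumption)
  · fun_prop (disch := assumption)
  · have := gen hy zero_le_one le_rfl (by linarith)
    rwa [mul_one, ← abs_mul] at this
  · have hs : 0 ≤ y.1 := hy.1
    have h0 : 0 < A + y.1 := by positivity
    have := gen hy (e := β * ((1 + y.1) / (A + y.1))) (by positivity)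
      (mul_le_mul_of_nonneg_left (ratio hA hs) hβ) (by linarith)
    refine le_trans (le_of_eq ?_) this
    have : c * (-β * bar A β y.1 / (A + y.1) * bar A' β' y.2)
      = -(c * (bar A β y.1 * bar A' β' y.2) * (β / (A + y.1))) := by ring
    rw [this, abs_neg, abs_mul, abs_mul, abs_of_nonneg (a := β / (A + y.1)) (by positivity)]
    ring
  · have hs : 0 ≤ y.2 := hy.2
    have h0 : 0 < A' + y.2 := by positivity
    have := gen hy (e := β' * ((1 + y.2) / (A' + y.2))) (by positivity)
      (mul_le_mul_of_nonneg_left (ratio hA' hs) hβ') (by linarith)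
    refine le_trans (le_of_eq ?_) this
    have : c * (bar A β y.1 * (-β' * bar A' β' y.2 / (A' + y.2)))
      = -(c * (bar A β y.1 * bar A' β' y.2) * (β' / (A' + y.2))) := by ring
    rw [this, abs_neg, abs_mul, abs_mul, abs_of_nonneg (a := β' / (A' + y.2)) (by positivity)]
    ring
  · have hs : 0 ≤ y.1 := hy.1
    have h0 : 0 < A + y.1 := by positivity
    have := gen hy (e := β * (β + 1) * ((1 + y.1) / (A + y.1) ^ 2)) (by positivity)
      (mul_le_mul_of_nonneg_left (ratio2 hA hs) (by positivity)) (by linarith)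
    refine le_trans (le_of_eq ?_) this
    have : c * (β * (β + 1) * bar A β y.1 / (A + y.1) ^ 2 * bar A' β' y.2)
      = c * (bar A β y.1 * bar A' β' y.2) * (β * (β + 1) / (A + y.1) ^ 2) := by ring
    rw [this, abs_mul, abs_mul, abs_of_nonneg (a := β * (β + 1) / (A + y.1) ^ 2) (by positivity)]
    ring
  · have hs : 0 ≤ y.2 := hy.2
    have h0 : 0 < A' + y.2 := by positivity
    have := gen hy (e := β' * (β' + 1) * ((1 + y.2) / (A' + y.2) ^ 2)) (by positivity)
      (mul_le_mul_of_nonneg_left (ratio2 hA' hs) (by positivity)) (by linarith)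
    refine le_trans (le_of_eq ?_) this
    have : c * (bar A β y.1 * (β' * (β' + 1) * bar A' β' y.2 / (A' + y.2) ^ 2))
      = c * (bar A β y.1 * bar A' β' y.2) * (β' * (β' + 1) / (A' + y.2) ^ 2) := by ring
    rw [this, abs_mul, abs_mul, abs_of_nonneg (a := β' * (β' + 1) / (A' + y.2) ^ 2) (by positivity)]
    ring

theorem radLap_bar {m k : ℕ} (A β A' β' c : ℝ) (hA : 0 < A) (hA' : 0 < A') {y : ℝ × ℝ}
    (hy : y ∈ quad) :
    radLap m k (fun y => c * (-β * bar A β y.1 / (A + y.1) * bar A' β' y.2))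
      (fun y => c * (bar A β y.1 * (-β' * bar A' β' y.2 / (A' + y.2))))
      (fun y => c * (β * (β + 1) * bar A β y.1 / (A + y.1) ^ 2 * bar A' β' y.2))
      (fun y => c * (bar A β y.1 * (β' * (β' + 1) * bar A' β' y.2 / (A' + y.2) ^ 2))) y
      = -(c * (bar A β y.1 * bar A' β' y.2) * (barCoef m A β y.1 + barCoef k A' β' y.2)) := by
  have n1 : A + y.1 ≠ 0 := (add_pos_of_pos_of_nonneg hA hy.1).ne'
  have n2 : A' + y.2 ≠ 0 := (add_pos_of_pos_of_nonneg hA' hy.2).ne'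
  simp only [radLap, barCoef]
  field_simp
  ring

theorem resolvOp_bar {A β A' β' : ℝ} (hM : 0 < M) (hA : 0 < A) (hβ : 0 ≤ β) (hA' : 0 < A')
    (hβ' : 0 ≤ β') (c : ℝ) :
    let V : ℝ × ℝ → ℝ := fun y => c * (bar A β y.1 * bar A' β' y.2)
      * (M + (barCoef p A β y.1 + barCoef q A' β' y.2))
    Measurable V ∧ (∃ C, ∀ y ∈ quad, |V y| ≤ C) ∧
      ∀ y ∈ quad, resolvOp p q M V y = c * (bar A β y.1 * bar A' β' y.2) := by
  intro V
  obtain ⟨C, h⟩ := radRegular_bar hA hβ hA' hβ' c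
  have hV : Measurable V := by
    have := measurable_bar A β
    have := measurable_bar A' β'
    have := measurable_barCoef p A β
    have := measurable_barCoef q A' β'
    fun_prop
  have he : ∀ y ∈ quad, V y = M * (c * (bar A β y.1 * bar A' β' y.2)) - radLap p q _ _ _ _ y :=
    fun y hy => by
      rw [radLap_bar (m := p) (k := q) A β A' β' c hA hA' hy]
      simp only [V]
      ring
  refine ⟨hV, ⟨M * C + (8 + 2 * p + 2 * q) * C, fun y hy => ?_⟩, fun y hy => ?_⟩
  · rw [he y hy]
    refine (abs_sub _ _).trans (add_le_add ?_ (h.abs_radLap_le hy))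
    rw [abs_mul, abs_of_pos hM]
    gcongr
    exact h.bound y hy
  · have := h.integral_resolv hM hV he (radPt p q y)
    rwa [sqRad_radPt hy] at this

theorem resolvOp_le_bar {A β A' β' c C : ℝ} {w : ℝ × ℝ → ℝ} (hM : 0 < M) (hA : 0 < A) (hβ : 0 ≤ β)
    (hA' : 0 < A') (hβ' : 0 ≤ β') (hw : Measurable w) (hb : ∀ y ∈ quad, |w y| ≤ C)
    (h : ∀ y ∈ quad, w y ≤ c * (bar A β y.1 * bar A' β' y.2)
      * (M + (barCoef p A β y.1 + barCoef q A' β' y.2))) {y : ℝ × ℝ} (hy : y ∈ quad) :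
    resolvOp p q M w y ≤ c * (bar A β y.1 * bar A' β' y.2) := by
  obtain ⟨hV, ⟨C', hC'⟩, he⟩ := resolvOp_bar (p := p) (q := q) hM hA hβ hA' hβ' c
  rw [← he y hy]
  exact resolvOp_mono hM hw hb hV hC' h y

theorem bar_le_resolvOp {A β A' β' c C : ℝ} {w : ℝ × ℝ → ℝ} (hM : 0 < M) (hA : 0 < A) (hβ : 0 ≤ β)
    (hA' : 0 < A') (hβ' : 0 ≤ β') (hw : Measurable w) (hb : ∀ y ∈ quad, |w y| ≤ C)
    (h : ∀ y ∈ quad, c * (bar A β y.1 * bar A' β' y.2)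
      * (M + (barCoef p A β y.1 + barCoef q A' β' y.2)) ≤ w y) {y : ℝ × ℝ} (hy : y ∈ quad) :
    c * (bar A β y.1 * bar A' β' y.2) ≤ resolvOp p q M w y := by
  obtain ⟨hV, ⟨C', hC'⟩, he⟩ := resolvOp_bar (p := p) (q := q) hM hA hβ hA' hβ' c
  rw [← he y hy]
  exact resolvOp_mono hM hV hC' hw hb h y

/-- Comparison with a singular barrier, obtained as a limit of regular ones. -/
theorem resolvOp_le_of_tendsto_bar {β β' C U : ℝ} {w : ℝ × ℝ → ℝ} {ε : ℕ → ℝ} (hM : 0 < M)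
    (hε : ∀ n, 0 < ε n) (hβ : 0 ≤ β) (hβ' : 0 ≤ β') (hw : Measurable w)
    (h0 : ∀ y ∈ quad, 0 ≤ w y) (hb : ∀ y ∈ quad, |w y| ≤ C)
    (hn : ∀ n, ∀ y ∈ quad, 0 ≤ barCoef p (ε n) β y.1 + barCoef q (ε n) β' y.2)
    (h : ∀ y ∈ quad, ∀ δ > 0, ∀ᶠ n in atTop, w y - δ ≤ bar (ε n) β y.1 * bar (ε n) β' y.2
      * (M + (barCoef p (ε n) β y.1 + barCoef q (ε n) β' y.2))) {y : ℝ × ℝ} (hy : y ∈ quad)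
    (hU : ∀ n, bar (ε n) β y.1 * bar (ε n) β' y.2 ≤ U) :
    resolvOp p q M w y ≤ U := by
  set V : ℕ → ℝ × ℝ → ℝ := fun n y => bar (ε n) β y.1 * bar (ε n) β' y.2
      * (M + (barCoef p (ε n) β y.1 + barCoef q (ε n) β' y.2)) with hV
  have mV : ∀ n, Measurable (V n) := fun n => by
    have := measurable_bar (ε n) β
    have := measurable_bar (ε n) β'
    have := measurable_barCoef p (ε n) β
    have := measurable_barCoef q (ε n) β'
    fun_prop
  have V0 : ∀ n, ∀ y ∈ quad, 0 ≤ V n y := fun n y hy => by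
    have h1 := bar_pos β (hε n) hy.1
    have h2 := bar_pos β' (hε n) hy.2
    have := hn n y hy
    positivity
  have hmin : ∀ n, ∀ y ∈ quad, |min (w y) (V n y)| ≤ C := fun n y hy => by
    rw [abs_of_nonneg (le_min (h0 y hy) (V0 n y hy))]
    exact (min_le_left _ _).trans ((le_abs_self _).trans (hb y hy))
  have ht := tendsto_resolvOp (p := p) (q := q) hM (W := fun n y => min (w y) (V n y)) (w := w)
    (fun n => hw.min (mV n)) hmin (fun y hy => by
      refine tendsto_order.2 ⟨fun a ha => ?_, fun a ha => Eventually.of_forall fun n =>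
        (min_le_left _ _).trans_lt ha⟩
      filter_upwards [h y hy ((w y - a) / 2) (by linarith)] with n hn
      exact lt_min ha (by linarith)) y
  refine le_of_tendsto' ht fun n => ?_
  refine le_trans ?_ (hU n)
  have := resolvOp_le_bar (p := p) (q := q) (c := 1) (w := fun y => min (w y) (V n y)) hM (hε n) hβ
    (hε n) hβ' (hw.min (mV n)) (hmin n) (fun y _ => by
      rw [one_mul]; exact min_le_right _ _) hy
  rwa [one_mul] at this

end resolvent_order

section barriers

variable {lam : ℝ}

theorem bar_half_sq {A s : ℝ} (h : 0 < A + s) : bar A (1 / 2) s ^ 2 = 1 / (A + s) := by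
  rw [bar, ← Real.rpow_natCast, ← Real.rpow_mul h.le]
  norm_num
  rw [Real.rpow_neg_one]

theorem bar_one (A s : ℝ) : bar A 1 s = 1 / (A + s) := by
  rw [bar, Real.rpow_neg_one, one_div]

theorem bar_zero (A s : ℝ) : bar A 0 s = 1 := by simp [bar]

theorem barCoef_half (A s : ℝ) : barCoef 4 A (1 / 2) s = (s + 4 * A) / (A + s) ^ 2 := by
  unfold barCoef; congr 1; norm_num; ring

theorem barCoef_one (A s : ℝ) : barCoef 4 A 1 s = 8 * A / (A + s) ^ 2 := by
  unfold barCoef; congr 1; norm_num; ring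

theorem barCoef_zero (p : ℕ) (A s : ℝ) : barCoef p A 0 s = 0 := by simp [barCoef]

/-- The shift making the nonlinearities monotone. -/
def shift (lam : ℝ) : ℝ := 1 + 6 * lam

/-- The width parameter of the barrier for the connection coefficients. -/
def widthG (lam : ℝ) : ℝ := 1 / (16 + lam)

/-- The width parameter of the upper barrier for the section. -/
def widthHi (lam : ℝ) : ℝ := 4 * widthG lam ^ 2

/-- The width parameter of the lower barrier for the section. -/
def widthLo (lam : ℝ) : ℝ := widthHi lam + 32 / lam

/-- Upper barrier for the section. -/
def hiF (lam : ℝ) (y : ℝ × ℝ) : ℝ :=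
  2 * (bar (widthHi lam) (1 / 2) y.1 * bar (widthHi lam) (1 / 2) y.2)

/-- Lower barrier for the section. -/
def loF (lam : ℝ) (y : ℝ × ℝ) : ℝ :=
  1 / 2 * (bar (widthLo lam) (1 / 2) y.1 * bar (widthLo lam) (1 / 2) y.2)

/-- The right-hand side of the shifted equation for the section, as a function of the section, the
two connection coefficients and the squared radii. -/
def srcF (lam f g h S T : ℝ) : ℝ :=
  f * (shift lam + ((2 * g - S * g ^ 2) + (2 * h - T * h ^ 2)) + lam / 2 * (1 - S * T * f ^ 2))

/-- The right-hand side of the shifted equation for the first connection coefficient. -/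
def srcG (lam f g S T : ℝ) : ℝ := shift lam * g + T * f ^ 2 * (1 - S * g)

section scalar
variable {f f' g g' h h' S T : ℝ}

theorem srcF_mono_left (hlam : 0 < lam) (hf : 0 ≤ f) (hff : f ≤ f') (hS : 0 ≤ S) (hT : 0 ≤ T)
    (hb : S * T * f' ^ 2 ≤ 4) (ha : 0 ≤ (2 * g - S * g ^ 2) + (2 * h - T * h ^ 2)) :
    srcF lam f g h S T ≤ srcF lam f' g h S T := by
  unfold srcF shift
  set a := (2 * g - S * g ^ 2) + (2 * h - T * h ^ 2)
  set P := S * T with hP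
  have hP0 : 0 ≤ P := mul_nonneg hS hT
  have h1 : P * (f' ^ 2 + f' * f + f ^ 2) ≤ 12 := by
    have : f' ^ 2 + f' * f + f ^ 2 ≤ 3 * f' ^ 2 := by nlinarith
    nlinarith
  have h2 : 0 ≤ (f' - f) * (1 + 6 * lam + a + lam / 2 - lam / 2 * (P * (f' ^ 2 + f' * f + f ^ 2))) := by
    refine mul_nonneg (by linarith) ?_
    nlinarith
  nlinarith [h2]

theorem two_mul_sub_mono (hg : g ≤ g') (hS : 0 ≤ S) (h' : S * g' ≤ 1) :
    2 * g - S * g ^ 2 ≤ 2 * g' - S * g' ^ 2 := by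
  have : S * g ≤ 1 := (mul_le_mul_of_nonneg_left hg hS).trans h'
  nlinarith [mul_nonneg (sub_nonneg.2 hg) (by linarith : 0 ≤ 2 - S * g - S * g')]

theorem two_mul_sub_nonneg (hg : 0 ≤ g) (hSg : S * g ≤ 1) : 0 ≤ 2 * g - S * g ^ 2 := by
  nlinarith

theorem two_mul_sub_le (hS : 0 < S) : 2 * g - S * g ^ 2 ≤ 1 / S := by
  rw [le_div_iff₀ hS]
  nlinarith [sq_nonneg (S * g - 1)]

theorem srcF_mono (hlam : 0 < lam) (hf : 0 ≤ f) (hff : f ≤ f') (hg : 0 ≤ g) (hgg : g ≤ g')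
    (hh : 0 ≤ h) (hhh : h ≤ h') (hS : 0 ≤ S) (hT : 0 ≤ T) (hb : S * T * f' ^ 2 ≤ 4)
    (hSg : S * g' ≤ 1) (hTh : T * h' ≤ 1) : srcF lam f g h S T ≤ srcF lam f' g' h' S T := by
  have m1 := two_mul_sub_mono hgg hS hSg
  have m2 := two_mul_sub_mono hhh hT hTh
  have n1 := two_mul_sub_nonneg hg ((mul_le_mul_of_nonneg_left hgg hS).trans hSg)
  have n2 := two_mul_sub_nonneg hh ((mul_le_mul_of_nonneg_left hhh hT).trans hTh)
  refine (srcF_mono_left hlam hf hff hS hT hb (by linarith)).trans ?_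
  unfold srcF
  have : 0 ≤ f' := hf.trans hff
  gcongr

theorem srcG_mono (hlam : 0 < lam) (hf : 0 ≤ f) (hff : f ≤ f') (hgg : g ≤ g')
    (hS : 0 ≤ S) (hT : 0 ≤ T) (hb : S * T * f' ^ 2 ≤ 1) (hSg : S * g' ≤ 1) :
    srcG lam f g S T ≤ srcG lam f' g' S T := by
  unfold srcG shift
  have h1 : f ^ 2 ≤ f' ^ 2 := pow_le_pow_left₀ hf hff 2
  have h2 : S * g ≤ 1 := (mul_le_mul_of_nonneg_left hgg hS).trans hSg
  have h3 : T * f ^ 2 * (1 - S * g) ≤ T * f' ^ 2 * (1 - S * g) := by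
    have : 0 ≤ 1 - S * g := by linarith
    gcongr
  have h4 : 0 ≤ (g' - g) * (1 + 6 * lam - S * T * f' ^ 2) :=
    mul_nonneg (by linarith) (by linarith)
  nlinarith

end scalar

theorem widthG_pos (hlam : 0 < lam) : 0 < widthG lam := by unfold widthG; positivity

theorem widthHi_pos (hlam : 0 < lam) : 0 < widthHi lam := by
  have := widthG_pos hlam
  unfold widthHi; positivity

theorem widthLo_pos (hlam : 0 < lam) : 0 < widthLo lam := by
  have := widthHi_pos hlam
  unfold widthLo; positivity

theorem hiF_sq (hlam : 0 < lam) {y : ℝ × ℝ} (hy : y ∈ quad) :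
    hiF lam y ^ 2 = 4 / ((widthHi lam + y.1) * (widthHi lam + y.2)) := by
  have h1 := add_pos_of_pos_of_nonneg (widthHi_pos hlam) hy.1
  have h2 := add_pos_of_pos_of_nonneg (widthHi_pos hlam) hy.2
  rw [hiF, mul_pow, mul_pow, bar_half_sq h1, bar_half_sq h2]
  field_simp
  norm_num

theorem loF_sq (hlam : 0 < lam) {y : ℝ × ℝ} (hy : y ∈ quad) :
    loF lam y ^ 2 = 1 / 4 / ((widthLo lam + y.1) * (widthLo lam + y.2)) := by
  have h1 := add_pos_of_pos_of_nonneg (widthLo_pos hlam) hy.1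
  have h2 := add_pos_of_pos_of_nonneg (widthLo_pos hlam) hy.2
  rw [loF, mul_pow, mul_pow, bar_half_sq h1, bar_half_sq h2]
  field_simp
  norm_num

theorem hiF_pos (hlam : 0 < lam) {y : ℝ × ℝ} (hy : y ∈ quad) : 0 < hiF lam y := by
  have h1 := bar_pos (1 / 2) (widthHi_pos hlam) hy.1
  have h2 := bar_pos (1 / 2) (widthHi_pos hlam) hy.2
  unfold hiF; positivity

theorem loF_pos (hlam : 0 < lam) {y : ℝ × ℝ} (hy : y ∈ quad) : 0 < loF lam y := by
  have h1 := bar_pos (1 / 2) (widthLo_pos hlam) hy.1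
  have h2 := bar_pos (1 / 2) (widthLo_pos hlam) hy.2
  unfold loF; positivity

theorem mul_div_add_le {S T a : ℝ} (hS : 0 ≤ S) (hT : 0 ≤ T) (ha : 0 < a) :
    S * T / ((a + S) * (a + T)) ≤ 1 := by
  rw [div_le_one (by positivity)]
  nlinarith [mul_nonneg ha.le hS, mul_nonneg ha.le hT, sq_nonneg a]

theorem mul_hiF_sq_le (hlam : 0 < lam) {y : ℝ × ℝ} (hy : y ∈ quad) :
    y.1 * y.2 * hiF lam y ^ 2 ≤ 4 := by
  rw [hiF_sq hlam hy]
  have := mul_div_add_le hy.1 hy.2 (widthHi_pos hlam)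
  rw [mul_div_assoc'] at *
  linarith [this, mul_div_assoc (y.1 * y.2) 4 ((widthHi lam + y.1) * (widthHi lam + y.2)),
    show y.1 * y.2 * 4 / ((widthHi lam + y.1) * (widthHi lam + y.2))
      = 4 * (y.1 * y.2 / ((widthHi lam + y.1) * (widthHi lam + y.2))) by ring]

theorem mul_loF_sq_le (hlam : 0 < lam) {y : ℝ × ℝ} (hy : y ∈ quad) :
    y.1 * y.2 * loF lam y ^ 2 ≤ 1 / 4 := by
  rw [loF_sq hlam hy]
  have := mul_div_add_le hy.1 hy.2 (widthLo_pos hlam)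
  linarith [show y.1 * y.2 * (1 / 4 / ((widthLo lam + y.1) * (widthLo lam + y.2)))
      = 1 / 4 * (y.1 * y.2 / ((widthLo lam + y.1) * (widthLo lam + y.2))) by ring]

theorem loF_le_hiF (hlam : 0 < lam) {y : ℝ × ℝ} (hy : y ∈ quad) : loF lam y ≤ hiF lam y := by
  refine (sq_le_sq₀ (loF_pos hlam hy).le (hiF_pos hlam hy).le).1 ?_
  rw [loF_sq hlam hy, hiF_sq hlam hy]
  have hy1 : 0 ≤ y.1 := hy.1
  have hy2 : 0 ≤ y.2 := hy.2
  have hA := widthHi_pos hlam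
  have hA' : widthHi lam ≤ widthLo lam := by
    have : 0 < 32 / lam := by positivity
    unfold widthLo; linarith
  have hL := widthLo_pos hlam
  gcongr
  norm_num

/-- The bound satisfied by the first connection coefficient divided by the squared radius. -/
def hiG (lam : ℝ) (y : ℝ × ℝ) : ℝ := 2 / (widthG lam + y.1)

theorem hiG_le (hlam : 0 < lam) {y : ℝ × ℝ} (hy : y ∈ quad) : hiG lam y ≤ 2 / widthG lam := by
  have := widthG_pos hlam
  have hy1 : 0 ≤ y.1 := hy.1
  unfold hiG
  gcongr
  linarith

theorem two_hiG_add_le (hlam : 0 < lam) :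
    4 / widthG lam + lam / 2 ≤ 5 / (4 * widthHi lam) := by
  unfold widthHi widthG
  have : 5 / (4 * (4 * (1 / (16 + lam)) ^ 2)) = 5 * (16 + lam) ^ 2 / 16 := by field_simp; ring
  rw [this]
  have : 4 / (1 / (16 + lam)) = 4 * (16 + lam) := by field_simp
  rw [this]
  nlinarith

theorem coef_large {A S : ℝ} (hA : 0 < A) (h : A ≤ S) : 1 / S ≤ (S + 4 * A) / (A + S) ^ 2 := by
  have : 0 < S := hA.trans_le h
  rw [div_le_div_iff₀ this (by positivity)]
  nlinarith

theorem coef_small {A S : ℝ} (hA : 0 < A) (hS : 0 ≤ S) (h : S ≤ A) :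
    5 / (4 * A) ≤ (S + 4 * A) / (A + S) ^ 2 := by
  rw [div_le_div_iff₀ (by positivity) (by positivity)]
  nlinarith [mul_nonneg (sub_nonneg.2 h) (by positivity : 0 ≤ 11 * A + 5 * S)]

theorem srcF_hiF_le (hlam : 0 < lam) {y : ℝ × ℝ} (hy : y ∈ quad) {g h : ℝ} (hg : g ≤ 2 / widthG lam)
    (hh : h ≤ 2 / widthG lam) : srcF lam (hiF lam y) g h y.1 y.2 ≤ hiF lam y
      * (shift lam + (barCoef 4 (widthHi lam) (1 / 2) y.1 + barCoef 4 (widthHi lam) (1 / 2) y.2)) := by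
  unfold srcF
  refine mul_le_mul_of_nonneg_left ?_ (hiF_pos hlam hy).le
  rw [barCoef_half, barCoef_half]
  have hA := widthHi_pos hlam
  have key := two_hiG_add_le hlam
  have hS : 0 ≤ y.1 := hy.1
  have hT : 0 ≤ y.2 := hy.2
  have e4 : 4 / widthG lam = 2 * (2 / widthG lam) := by ring
  have hP : 0 ≤ y.1 * y.2 * hiF lam y ^ 2 := by positivity
  have a1 : 2 * g - y.1 * g ^ 2 ≤ 4 / widthG lam := by nlinarith [mul_nonneg hS (sq_nonneg g)]
  have a2 : 2 * h - y.2 * h ^ 2 ≤ 4 / widthG lam := by nlinarith [mul_nonneg hT (sq_nonneg h)]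
  have hlP : lam / 2 * (1 - y.1 * y.2 * hiF lam y ^ 2) ≤ lam / 2 := by nlinarith
  set A := widthHi lam with hAdef
  rcases le_total A y.1 with c1 | c1 <;> rcases le_total A y.2 with c2 | c2
  · have k1 := (two_mul_sub_le (g := g) (hA.trans_le c1)).trans (coef_large hA c1)
    have k2 := (two_mul_sub_le (g := h) (hA.trans_le c2)).trans (coef_large hA c2)
    have : 1 ≤ y.1 * y.2 * hiF lam y ^ 2 := by
      rw [hiF_sq hlam hy, mul_div_assoc', le_div_iff₀ (by positivity), ← hAdef]
      nlinarith [mul_nonneg (sub_nonneg.2 c1) (sub_nonneg.2 c2)]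
    have : lam / 2 * (1 - y.1 * y.2 * hiF lam y ^ 2) ≤ 0 := by nlinarith
    linarith
  · have k1 := (two_mul_sub_le (g := g) (hA.trans_le c1)).trans (coef_large hA c1)
    have k2 := coef_small hA hT c2
    linarith
  · have k1 := coef_small hA hS c1
    have k2 := (two_mul_sub_le (g := h) (hA.trans_le c2)).trans (coef_large hA c2)
    linarith
  · have k1 := coef_small hA hS c1
    have k2 := coef_small hA hT c2
    linarith

theorem le_srcF_loF (hlam : 0 < lam) {y : ℝ × ℝ} (hy : y ∈ quad) {g h : ℝ}
    (ha : 0 ≤ (2 * g - y.1 * g ^ 2) + (2 * h - y.2 * h ^ 2)) :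
    loF lam y * (shift lam + (barCoef 4 (widthLo lam) (1 / 2) y.1
      + barCoef 4 (widthLo lam) (1 / 2) y.2)) ≤ srcF lam (loF lam y) g h y.1 y.2 := by
  unfold srcF
  refine mul_le_mul_of_nonneg_left ?_ (loF_pos hlam hy).le
  rw [barCoef_half, barCoef_half]
  have hA := widthLo_pos hlam
  have hP := mul_loF_sq_le hlam hy
  have c : ∀ s : ℝ, 0 ≤ s → (s + 4 * widthLo lam) / (widthLo lam + s) ^ 2 ≤ 4 / widthLo lam := by
    intro s hs
    rw [div_le_div_iff₀ (by positivity) hA]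
    nlinarith [mul_nonneg hs hA.le, sq_nonneg s]
  have c1 := c y.1 hy.1
  have c2 := c y.2 hy.2
  have : 4 / widthLo lam ≤ lam / 8 := by
    rw [div_le_div_iff₀ hA (by norm_num)]
    have : lam * widthLo lam = lam * widthHi lam + 32 := by unfold widthLo; field_simp
    nlinarith [mul_pos hlam (widthHi_pos hlam)]
  nlinarith

theorem srcG_hiG_le (hlam : 0 < lam) {y : ℝ × ℝ} (hy : y ∈ quad) {f : ℝ} (hf0 : 0 ≤ f)
    (hf : f ≤ hiF lam y) : srcG lam f (hiG lam y) y.1 y.2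
      ≤ hiG lam y * (shift lam + barCoef 4 (widthG lam) 1 y.1) := by
  have hm := widthG_pos hlam
  have hS : 0 ≤ y.1 := hy.1
  have hT : 0 ≤ y.2 := hy.2
  rw [barCoef_one]
  unfold srcG hiG
  set μ := widthG lam with hμ
  have hp : 0 < μ + y.1 := by positivity
  have e1 : 1 - y.1 * (2 / (μ + y.1)) = (μ - y.1) / (μ + y.1) := by field_simp; ring
  rw [e1]
  have hTf : y.2 * f ^ 2 ≤ 1 / μ ^ 2 := by
    have h1 : f ^ 2 ≤ hiF lam y ^ 2 := pow_le_pow_left₀ hf0 hf 2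
    rw [hiF_sq hlam hy] at h1
    have hA := widthHi_pos hlam
    have h2 : y.2 * (4 / ((widthHi lam + y.1) * (widthHi lam + y.2))) ≤ 4 / widthHi lam := by
      rw [mul_div_assoc', div_le_div_iff₀ (by positivity) hA]
      nlinarith [mul_nonneg hS hT, mul_nonneg hS hA.le, mul_nonneg (mul_nonneg hS hT) hA.le]
    have h3 : 4 / widthHi lam = 1 / μ ^ 2 := by unfold widthHi; rw [← hμ]; field_simp
    rw [← h3]
    exact (mul_le_mul_of_nonneg_left h1 hT).trans h2
  have h0 : 0 ≤ y.2 * f ^ 2 := by positivity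
  have main : y.2 * f ^ 2 * ((μ - y.1) / (μ + y.1)) ≤ 2 / (μ + y.1) * (8 * μ / (μ + y.1) ^ 2) := by
    have e2 : 2 / (μ + y.1) * (8 * μ / (μ + y.1) ^ 2) = 16 * μ / (μ + y.1) ^ 3 := by
      field_simp; ring
    rw [e2]
    rcases le_total y.1 μ with c | c
    · have : 0 ≤ (μ - y.1) / (μ + y.1) := div_nonneg (by linarith) hp.le
      refine (mul_le_mul_of_nonneg_right hTf this).trans ?_
      rw [div_mul_div_comm, div_le_div_iff₀ (by positivity) (by positivity)]
      have : (μ - y.1) * (μ + y.1) ^ 2 ≤ 16 * μ * μ ^ 2 := by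
        have i1 : (μ + y.1) ^ 2 ≤ (2 * μ) ^ 2 := pow_le_pow_left₀ hp.le (by linarith) 2
        have i2 : (μ - y.1) * (μ + y.1) ^ 2 ≤ μ * (2 * μ) ^ 2 :=
          mul_le_mul (by linarith) i1 (by positivity) hm.le
        nlinarith [pow_pos hm 3]
      calc 1 * (μ - y.1) * (μ + y.1) ^ 3 = (μ - y.1) * (μ + y.1) ^ 2 * (μ + y.1) := by ring
        _ ≤ 16 * μ * μ ^ 2 * (μ + y.1) := by gcongr
        _ = _ := by ring
    · refine le_trans (mul_nonpos_of_nonneg_of_nonpos h0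
        (div_nonpos_of_nonpos_of_nonneg (by linarith) hp.le)) (by positivity)
  rw [mul_add]
  linarith

end barriers

section iteration

variable {lam : ℝ}

theorem one_le_shift (hlam : 0 < lam) : 1 ≤ shift lam := by unfold shift; linarith

theorem shift_pos (hlam : 0 < lam) : 0 < shift lam := one_pos.trans_le (one_le_shift hlam)

/-- The source of the equation for the section, evaluated along a pair of functions. -/
def fieldF (lam : ℝ) (φ γ : ℝ × ℝ → ℝ) (y : ℝ × ℝ) : ℝ :=
  srcF lam (φ y) (γ y) (γ y.swap) y.1 y.2

/-- The source of the equation for the connection, evaluated along a pair of functions. -/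
def fieldG (lam : ℝ) (φ γ : ℝ × ℝ → ℝ) (y : ℝ × ℝ) : ℝ := srcG lam (φ y) (γ y) y.1 y.2

/-- The invariant set of the monotone iteration. -/
structure Adm (lam : ℝ) (φ γ : ℝ × ℝ → ℝ) : Prop where
  measF : Measurable φ
  measG : Measurable γ
  symm : ∀ y ∈ quad, φ y.swap = φ y
  loF_le : ∀ y ∈ quad, loF lam y ≤ φ y
  le_hiF : ∀ y ∈ quad, φ y ≤ hiF lam y
  mul_sq_le : ∀ y ∈ quad, y.1 * y.2 * φ y ^ 2 ≤ 1
  nonneg : ∀ y ∈ quad, 0 ≤ γ y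
  le_hiG : ∀ y ∈ quad, γ y ≤ hiG lam y
  mul_le : ∀ y ∈ quad, y.1 * γ y ≤ 1

theorem swap_mem_quad {y : ℝ × ℝ} (hy : y ∈ quad) : y.swap ∈ quad := ⟨hy.2, hy.1⟩

theorem hiF_le (hlam : 0 < lam) {y : ℝ × ℝ} (hy : y ∈ quad) :
    hiF lam y ≤ 2 * (widthHi lam ^ (-(1 / 2) : ℝ) * widthHi lam ^ (-(1 / 2) : ℝ)) := by
  have hA := widthHi_pos hlam
  have h1 := bar_le (β := 1 / 2) hA (by norm_num) hy.1
  have h2 := bar_le (β := 1 / 2) hA (by norm_num) hy.2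
  have h3 := (bar_pos (1 / 2) hA hy.2).le
  unfold hiF
  gcongr

section
variable {φ γ φ' γ' : ℝ × ℝ → ℝ}

theorem measurable_fieldF (hφ : Measurable φ) (hγ : Measurable γ) : Measurable (fieldF lam φ γ) := by
  have := hγ.comp measurable_swap
  unfold fieldF srcF
  simp only [Function.comp_def] at this
  fun_prop

theorem measurable_fieldG (hφ : Measurable φ) (hγ : Measurable γ) : Measurable (fieldG lam φ γ) := by
  unfold fieldG srcG
  fun_prop

theorem Adm.pos (h : Adm lam φ γ) (hlam : 0 < lam) {y : ℝ × ℝ} (hy : y ∈ quad) : 0 < φ y :=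
  (loF_pos hlam hy).trans_le (h.loF_le y hy)

theorem Adm.le_const (h : Adm lam φ γ) (hlam : 0 < lam) {y : ℝ × ℝ} (hy : y ∈ quad) :
    γ y ≤ 2 / widthG lam := (h.le_hiG y hy).trans (hiG_le hlam hy)

theorem Adm.coef_nonneg (h : Adm lam φ γ) {y : ℝ × ℝ} (hy : y ∈ quad) :
    0 ≤ (2 * γ y - y.1 * γ y ^ 2) + (2 * γ y.swap - y.2 * γ y.swap ^ 2) :=
  add_nonneg (two_mul_sub_nonneg (h.nonneg y hy) (h.mul_le y hy))
    (two_mul_sub_nonneg (h.nonneg _ (swap_mem_quad hy)) (h.mul_le _ (swap_mem_quad hy)))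

/-- The sources are nonnegative and bounded, uniformly over the invariant set. -/
theorem exists_field_bound (hlam : 0 < lam) : ∃ C, ∀ φ γ, Adm lam φ γ → ∀ y ∈ quad,
    (0 ≤ fieldF lam φ γ y ∧ fieldF lam φ γ y ≤ C) ∧ 0 ≤ fieldG lam φ γ y ∧ fieldG lam φ γ y ≤ C := by
  set K := 2 * (widthHi lam ^ (-(1 / 2) : ℝ) * widthHi lam ^ (-(1 / 2) : ℝ)) with hK
  have hA := widthHi_pos hlam
  have hμ := widthG_pos hlam
  have hK0 : 0 < K := by positivity
  have hM := shift_pos hlam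
  set L := 2 / widthG lam with hL
  have hL0 : 0 < L := by positivity
  refine ⟨max (K * (shift lam + 4 * L + lam / 2)) (shift lam * L + 4 / widthHi lam),
    fun φ γ h y hy => ?_⟩
  have hS : 0 ≤ y.1 := hy.1
  have hT : 0 ≤ y.2 := hy.2
  have p := h.pos hlam hy
  have c := h.coef_nonneg hy
  have b := h.mul_sq_le y hy
  have g0 := h.nonneg y hy
  have g1 := h.le_const hlam hy
  have g2 := h.le_const hlam (swap_mem_quad hy)
  have g3 := h.mul_le y hy
  have b0 : 0 ≤ y.1 * y.2 * φ y ^ 2 := by positivity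
  have k := (h.le_hiF y hy).trans (hiF_le hlam hy)
  refine ⟨⟨?_, le_max_of_le_left ?_⟩, ?_, le_max_of_le_right ?_⟩
  · unfold fieldF srcF
    have : 0 ≤ lam / 2 * (1 - y.1 * y.2 * φ y ^ 2) := mul_nonneg (by linarith) (by linarith)
    exact mul_nonneg p.le (by linarith)
  · unfold fieldF srcF
    have e1 : lam / 2 * (1 - y.1 * y.2 * φ y ^ 2) ≤ lam / 2 := by nlinarith
    have e2 : 0 ≤ lam / 2 * (1 - y.1 * y.2 * φ y ^ 2) := mul_nonneg (by linarith) (by linarith)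
    have e3 : 0 ≤ y.1 * γ y ^ 2 := by positivity
    have e4 : 0 ≤ y.2 * γ y.swap ^ 2 := by positivity
    exact mul_le_mul k (by linarith) (by linarith) hK0.le
  · unfold fieldG srcG
    have : 0 ≤ 1 - y.1 * γ y := by linarith
    positivity
  · unfold fieldG srcG
    have e1 : φ y ^ 2 ≤ hiF lam y ^ 2 := pow_le_pow_left₀ p.le (h.le_hiF y hy) 2
    rw [hiF_sq hlam hy] at e1
    have e2 : y.2 * (4 / ((widthHi lam + y.1) * (widthHi lam + y.2))) ≤ 4 / widthHi lam := by
      rw [mul_div_assoc', div_le_div_iff₀ (by positivity) hA]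
      nlinarith [mul_nonneg hS hT, mul_nonneg hS hA.le, mul_nonneg (mul_nonneg hS hT) hA.le]
    have e3 : y.2 * φ y ^ 2 ≤ 4 / widthHi lam := (mul_le_mul_of_nonneg_left e1 hT).trans e2
    have e4 : 0 ≤ y.1 * γ y := mul_nonneg hS g0
    have e5 : y.2 * φ y ^ 2 * (1 - y.1 * γ y) ≤ y.2 * φ y ^ 2 :=
      mul_le_of_le_one_right (by positivity) (by linarith)
    have e6 : shift lam * γ y ≤ shift lam * L := mul_le_mul_of_nonneg_left g1 hM.le
    linarith

theorem Adm.fieldF_swap (h : Adm lam φ γ) {y : ℝ × ℝ} (hy : y ∈ quad) :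
    fieldF lam φ γ y.swap = fieldF lam φ γ y := by
  simp only [fieldF, srcF, Prod.swap_swap, Prod.fst_swap, Prod.snd_swap, h.symm y hy]
  ring

theorem Adm.fieldF_mono (h : Adm lam φ γ) (h' : Adm lam φ' γ') (hlam : 0 < lam)
    (hφ : ∀ y ∈ quad, φ y ≤ φ' y) (hγ : ∀ y ∈ quad, γ y ≤ γ' y) {y : ℝ × ℝ} (hy : y ∈ quad) :
    fieldF lam φ γ y ≤ fieldF lam φ' γ' y :=
  srcF_mono hlam (h.pos hlam hy).le (hφ y hy) (h.nonneg y hy) (hγ y hy)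
    (h.nonneg _ (swap_mem_quad hy)) (hγ _ (swap_mem_quad hy)) hy.1 hy.2
    ((h'.mul_sq_le y hy).trans (by norm_num)) (h'.mul_le y hy) (h'.mul_le _ (swap_mem_quad hy))

theorem Adm.fieldG_mono (h : Adm lam φ γ) (h' : Adm lam φ' γ') (hlam : 0 < lam)
    (hφ : ∀ y ∈ quad, φ y ≤ φ' y) (hγ : ∀ y ∈ quad, γ y ≤ γ' y) {y : ℝ × ℝ} (hy : y ∈ quad) :
    fieldG lam φ γ y ≤ fieldG lam φ' γ' y :=
  srcG_mono hlam (h.pos hlam hy).le (hφ y hy) (hγ y hy) hy.1 hy.2 (h'.mul_sq_le y hy)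
    (h'.mul_le y hy)

end

/-- A sequence of widths decreasing to zero. -/
def eps (n : ℕ) : ℝ := 1 / ((n : ℝ) + 1)

theorem eps_pos (n : ℕ) : 0 < eps n := by unfold eps; positivity

theorem eps_le (n : ℕ) : eps n ≤ 1 := by
  unfold eps
  rw [div_le_one (by positivity)]
  linarith [Nat.cast_nonneg (α := ℝ) n]

theorem tendsto_eps : Tendsto eps atTop (𝓝 0) := tendsto_one_div_add_atTop_nhds_zero_nat

theorem eventually_le_bar_mul {β β' T : ℝ} (hβ : 0 < β) (hβ' : 0 ≤ β') (hT : 0 ≤ T) (C : ℝ) :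
    ∀ᶠ n in atTop, C ≤ bar (eps n) β 0 * bar (eps n) β' T := by
  have t : Tendsto (fun n => bar (eps n) β 0) atTop atTop := by
    have h := (tendsto_rpow_neg_nhdsGT_zero (y := -β) (by linarith)).comp
      (tendsto_nhdsWithin_iff.2 ⟨tendsto_eps, Eventually.of_forall fun n => eps_pos n⟩)
    refine h.congr fun n => ?_
    simp [bar]
  have hc : 0 < bar 1 β' T := bar_pos β' one_pos hT
  filter_upwards [(t.atTop_mul_const hc).eventually_ge_atTop C] with n hn
  refine hn.trans ?_
  refine mul_le_mul_of_nonneg_left ?_ (bar_pos β (eps_pos n) le_rfl).le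
  exact Real.rpow_le_rpow_of_nonpos (add_pos_of_pos_of_nonneg (eps_pos n) hT)
    (by linarith [eps_le n]) (by linarith)

theorem bar_eps_le {β s : ℝ} (hβ : 0 ≤ β) (hs : 0 < s) (n : ℕ) : bar (eps n) β s ≤ bar 0 β s :=
  Real.rpow_le_rpow_of_nonpos (by simpa using hs) (by linarith [eps_pos n]) (by linarith)

theorem tendsto_bar_eps (β : ℝ) {s : ℝ} (hs : 0 < s) :
    Tendsto (fun n => bar (eps n) β s) atTop (𝓝 (bar 0 β s)) := by
  unfold bar
  exact (tendsto_eps.add_const s).rpow_const (Or.inl (by simpa using hs.ne'))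

theorem tendsto_barCoef_eps (p : ℕ) (β : ℝ) {s : ℝ} (hs : 0 < s) :
    Tendsto (fun n => barCoef p (eps n) β s) atTop (𝓝 (barCoef p 0 β s)) := by
  unfold barCoef
  have h := tendsto_eps.add_const s
  exact ((h.const_mul _).sub_const _).div (h.pow 2) (by simpa using hs.ne')

section
variable {φ γ : ℝ × ℝ → ℝ}

theorem Adm.resolvOp_mul_sq_le (h : Adm lam φ γ) (hlam : 0 < lam) {y : ℝ × ℝ} (hy : y ∈ quad) :
    y.1 * y.2 * resolvOp 4 4 (shift lam) (fieldF lam φ γ) y ^ 2 ≤ 1 := by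
  obtain ⟨C, hC⟩ := exists_field_bound hlam
  have hM := shift_pos hlam
  rcases (show (0:ℝ) ≤ y.1 from hy.1).eq_or_lt with h1 | h1
  · rw [← h1]; simp
  rcases (show (0:ℝ) ≤ y.2 from hy.2).eq_or_lt with h2 | h2
  · rw [← h2]; simp
  have n0 : ∀ y ∈ quad, 0 ≤ fieldF lam φ γ y := fun v hv => (hC φ γ h v hv).1.1
  have cn : ∀ n, ∀ s : ℝ, 0 ≤ s → 0 ≤ barCoef 4 (eps n) (1 / 2) s := fun n s hs => by
    have := eps_pos n
    rw [barCoef_half]; positivity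
  have cs : ∀ n, ∀ y ∈ quad, 0 ≤ barCoef 4 (eps n) (1 / 2) y.1 + barCoef 4 (eps n) (1 / 2) y.2 :=
    fun n v hv => add_nonneg (cn n _ hv.1) (cn n _ hv.2)
  have key : resolvOp 4 4 (shift lam) (fieldF lam φ γ) y ≤ bar 0 (1 / 2) y.1 * bar 0 (1 / 2) y.2 := by
    refine resolvOp_le_of_tendsto_bar (β := 1 / 2) (β' := 1 / 2) (C := C) hM eps_pos (by norm_num)
      (by norm_num)
      (measurable_fieldF h.measF h.measG) n0
      (fun v hv => abs_le.2 ⟨by linarith [n0 v hv, (hC φ γ h v hv).1.2], (hC φ γ h v hv).1.2⟩)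
      cs (fun v hv δ hδ => ?_) hy fun n => ?_
    · have axis : (∀ᶠ n in atTop, fieldF lam φ γ v
          ≤ bar (eps n) (1 / 2) v.1 * bar (eps n) (1 / 2) v.2) → ∀ᶠ n in atTop,
          fieldF lam φ γ v - δ ≤ bar (eps n) (1 / 2) v.1 * bar (eps n) (1 / 2) v.2
            * (shift lam + (barCoef 4 (eps n) (1 / 2) v.1 + barCoef 4 (eps n) (1 / 2) v.2)) := by
        intro hev
        filter_upwards [hev] with n hn
        have hp : 0 ≤ bar (eps n) (1 / 2) v.1 * bar (eps n) (1 / 2) v.2 :=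
          mul_nonneg (bar_pos _ (eps_pos n) hv.1).le (bar_pos _ (eps_pos n) hv.2).le
        have := le_mul_of_one_le_right hp (show 1 ≤ shift lam + (barCoef 4 (eps n) (1 / 2) v.1
          + barCoef 4 (eps n) (1 / 2) v.2) by linarith [one_le_shift hlam, cs n v hv])
        linarith
      rcases (show (0:ℝ) ≤ v.1 from hv.1).eq_or_lt with v1 | v1
      · refine axis ?_
        rw [← v1]
        exact eventually_le_bar_mul (by norm_num) (by norm_num) hv.2 _
      rcases (show (0:ℝ) ≤ v.2 from hv.2).eq_or_lt with v2 | v2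
      · refine axis ?_
        rw [← v2]
        simp_rw [mul_comm (bar _ _ v.1)]
        exact eventually_le_bar_mul (by norm_num) (by norm_num) hv.1 _
      have lim := ((tendsto_bar_eps (1 / 2) v1).mul (tendsto_bar_eps (1 / 2) v2)).mul
        (((tendsto_barCoef_eps 4 (1 / 2) v1).add (tendsto_barCoef_eps 4 (1 / 2) v2)).const_add
          (shift lam))
      refine (lim.eventually_const_le (u := fieldF lam φ γ v - δ) ?_)
      refine lt_of_lt_of_le (sub_lt_self _ hδ) ?_
      set U := bar 0 (1 / 2) v.1 * bar 0 (1 / 2) v.2 with hU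
      have hU2 : U ^ 2 = 1 / v.1 * (1 / v.2) := by
        rw [hU, mul_pow, bar_half_sq (by simpa using v1), bar_half_sq (by simpa using v2)]
        simp
      have hU0 : 0 ≤ U := mul_nonneg (Real.rpow_nonneg (by linarith) _)
        (Real.rpow_nonneg (by linarith) _)
      have hPU : v.1 * v.2 * U ^ 2 = 1 := by rw [hU2]; field_simp
      have hφU : φ v ≤ U := by
        refine (sq_le_sq₀ (h.pos hlam hv).le hU0).1 ?_
        have := h.mul_sq_le v hv
        refine le_of_mul_le_mul_left ?_ (mul_pos v1 v2)
        rw [hPU]; exact this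
      refine (srcF_mono_left hlam (h.pos hlam hv).le hφU hv.1 hv.2 (by rw [hPU]; norm_num)
        (h.coef_nonneg hv)).trans ?_
      unfold srcF
      rw [hPU]
      refine mul_le_mul_of_nonneg_left ?_ hU0
      rw [barCoef_half, barCoef_half]
      have e1 := two_mul_sub_le (g := γ v) v1
      have e2 := two_mul_sub_le (g := γ v.swap) v2
      have e3 : ∀ s : ℝ, 0 < s → (s + 4 * 0) / (0 + s) ^ 2 = 1 / s := fun s hs => by field_simp; ring
      rw [e3 _ v1, e3 _ v2]
      linarith
    · exact mul_le_mul (bar_eps_le (by norm_num) h1 n) (bar_eps_le (by norm_num) h2 n)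
        (bar_pos _ (eps_pos n) hy.2).le (Real.rpow_nonneg (by linarith) _)
  have r0 := resolvOp_nonneg (p := 4) (q := 4) (M := shift lam) n0 y
  have := pow_le_pow_left₀ r0 key 2
  rw [mul_pow, bar_half_sq (by simpa using h1), bar_half_sq (by simpa using h2)] at this
  calc _ ≤ y.1 * y.2 * (1 / (0 + y.1) * (1 / (0 + y.2))) := by gcongr
    _ = 1 := by field_simp; simp

theorem Adm.resolvOp_mul_le (h : Adm lam φ γ) (hlam : 0 < lam) {y : ℝ × ℝ} (hy : y ∈ quad) :
    y.1 * resolvOp 4 2 (shift lam) (fieldG lam φ γ) y ≤ 1 := by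
  obtain ⟨C, hC⟩ := exists_field_bound hlam
  have hM := shift_pos hlam
  rcases (show (0:ℝ) ≤ y.1 from hy.1).eq_or_lt with h1 | h1
  · rw [← h1]; simp
  have n0 : ∀ y ∈ quad, 0 ≤ fieldG lam φ γ y := fun v hv => (hC φ γ h v hv).2.1
  have cs : ∀ n, ∀ y ∈ quad, 0 ≤ barCoef 4 (eps n) 1 y.1 + barCoef 2 (eps n) 0 y.2 :=
    fun n v hv => by
      have := eps_pos n
      have : 0 ≤ v.1 := hv.1
      rw [barCoef_one, barCoef_zero]; positivity
  have key : resolvOp 4 2 (shift lam) (fieldG lam φ γ) y ≤ 1 / y.1 := by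
    refine resolvOp_le_of_tendsto_bar (β := 1) (β' := 0) (C := C) hM eps_pos (by norm_num) le_rfl
      (measurable_fieldG h.measF h.measG) n0
      (fun v hv => abs_le.2 ⟨by linarith [n0 v hv, (hC φ γ h v hv).2.2], (hC φ γ h v hv).2.2⟩)
      cs (fun v hv δ hδ => ?_) hy fun n => ?_
    · rcases (show (0:ℝ) ≤ v.1 from hv.1).eq_or_lt with v1 | v1
      · filter_upwards [eventually_le_bar_mul (β := 1) one_pos le_rfl hv.2 (fieldG lam φ γ v)]
          with n hn
        have c := cs n v hv
        rw [← v1] at c ⊢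
        have hp : 0 ≤ bar (eps n) 1 0 * bar (eps n) 0 v.2 :=
          mul_nonneg (bar_pos _ (eps_pos n) le_rfl).le (bar_pos _ (eps_pos n) hv.2).le
        have := le_mul_of_one_le_right hp (show 1 ≤ shift lam + (barCoef 4 (eps n) 1 0
          + barCoef 2 (eps n) 0 v.2) by linarith [one_le_shift hlam])
        linarith
      simp_rw [bar_zero, barCoef_zero]
      have lim := ((tendsto_bar_eps 1 v1).mul_const 1).mul
        (((tendsto_barCoef_eps 4 1 v1).add_const 0).const_add (shift lam))
      refine (lim.eventually_const_le (u := fieldG lam φ γ v - δ) ?_)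
      refine lt_of_lt_of_le (sub_lt_self _ hδ) ?_
      rw [bar_one, barCoef_one]
      have e : 1 / (0 + v.1) * 1 * (shift lam + (8 * 0 / (0 + v.1) ^ 2 + 0)) = shift lam / v.1 := by
        simp [div_eq_inv_mul]
      rw [e, le_div_iff₀ v1]
      unfold fieldG srcG
      have a := h.mul_sq_le v hv
      have b := h.mul_le v hv
      have := mul_nonneg (sub_nonneg.2 b) (by linarith [one_le_shift hlam] :
        0 ≤ shift lam - v.1 * v.2 * φ v ^ 2)
      nlinarith
    · rw [bar_zero, mul_one, bar_one]
      have := eps_pos n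
      gcongr
      linarith
  calc _ ≤ y.1 * (1 / y.1) := by gcongr
    _ = 1 := by field_simp

/-- The iteration step preserves the invariant set. -/
theorem Adm.step (h : Adm lam φ γ) (hlam : 0 < lam) :
    Adm lam (resolvOp 4 4 (shift lam) (fieldF lam φ γ))
      (resolvOp 4 2 (shift lam) (fieldG lam φ γ)) := by
  obtain ⟨C, hC⟩ := exists_field_bound hlam
  have hM := shift_pos hlam
  have mF := measurable_fieldF (lam := lam) h.measF h.measG
  have mG := measurable_fieldG (lam := lam) h.measF h.measG
  have bF : ∀ y ∈ quad, |fieldF lam φ γ y| ≤ C := fun v hv =>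
    abs_le.2 ⟨by linarith [(hC φ γ h v hv).1.1, (hC φ γ h v hv).1.2], (hC φ γ h v hv).1.2⟩
  have bG : ∀ y ∈ quad, |fieldG lam φ γ y| ≤ C := fun v hv =>
    abs_le.2 ⟨by linarith [(hC φ γ h v hv).2.1, (hC φ γ h v hv).2.2], (hC φ γ h v hv).2.2⟩
  refine ⟨(continuous_resolvOp hM mF bF).measurable, (continuous_resolvOp hM mG bG).measurable,
    fun y _ => resolvOp_swap mF (fun v hv => h.fieldF_swap hv) y, fun y hy => ?_, fun y hy => ?_,
    fun y hy => h.resolvOp_mul_sq_le hlam hy, fun y _ => resolvOp_nonneg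
      (fun v hv => (hC φ γ h v hv).2.1) y, fun y hy => ?_, fun y hy => h.resolvOp_mul_le hlam hy⟩
  · refine bar_le_resolvOp hM (widthLo_pos hlam) (by norm_num) (widthLo_pos hlam) (by norm_num) mF bF
      (fun v hv => ?_) hy
    refine (le_srcF_loF hlam hv (h.coef_nonneg hv)).trans ?_
    exact srcF_mono_left hlam (loF_pos hlam hv).le (h.loF_le v hv) hv.1 hv.2
      ((h.mul_sq_le v hv).trans (by norm_num)) (h.coef_nonneg hv)
  · refine resolvOp_le_bar hM (widthHi_pos hlam) (by norm_num) (widthHi_pos hlam) (by norm_num) mF bF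
      (fun v hv => ?_) hy
    refine le_trans ?_ (srcF_hiF_le hlam hv (h.le_const hlam hv) (h.le_const hlam (swap_mem_quad hv)))
    exact srcF_mono_left hlam (h.pos hlam hv).le (h.le_hiF v hv) hv.1 hv.2 (mul_hiF_sq_le hlam hv)
      (h.coef_nonneg hv)
  · have e : hiG lam y = 2 * (bar (widthG lam) 1 y.1 * bar 1 0 y.2) := by
      rw [bar_one, bar_zero, hiG]; ring
    rw [e]
    refine resolvOp_le_bar hM (widthG_pos hlam) (by norm_num) one_pos le_rfl mG bG
      (fun v hv => ?_) hy
    have e' : 2 * (bar (widthG lam) 1 v.1 * bar 1 0 v.2) = hiG lam v := by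
      rw [bar_one, bar_zero, hiG]; ring
    rw [e', barCoef_zero, add_zero]
    refine le_trans ?_ (srcG_hiG_le hlam hv (h.pos hlam hv).le (h.le_hiF v hv))
    unfold fieldG srcG
    have a : 0 ≤ shift lam - v.1 * v.2 * φ v ^ 2 := by
      linarith [one_le_shift hlam, h.mul_sq_le v hv]
    have := mul_nonneg (sub_nonneg.2 (h.le_hiG v hv)) a
    nlinarith

end

theorem adm_loF (hlam : 0 < lam) : Adm lam (loF lam) (fun _ => 0) := by
  have := measurable_bar (widthLo lam) (1 / 2)
  refine ⟨by unfold loF; fun_prop, measurable_const, fun y _ => ?_, fun _ _ => le_rfl,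
    fun y hy => loF_le_hiF hlam hy, fun y hy => (mul_loF_sq_le hlam hy).trans (by norm_num),
    fun _ _ => le_rfl, fun y hy => ?_, fun y _ => by simp⟩
  · simp only [loF, Prod.fst_swap, Prod.snd_swap]; ring
  · have := widthG_pos hlam
    have : 0 ≤ y.1 := hy.1
    unfold hiG; positivity

/-- The monotone iteration. -/
def iter (lam : ℝ) : ℕ → (ℝ × ℝ → ℝ) × (ℝ × ℝ → ℝ)
  | 0 => (loF lam, fun _ => 0)
  | n + 1 => (resolvOp 4 4 (shift lam) (fieldF lam (iter lam n).1 (iter lam n).2),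
      resolvOp 4 2 (shift lam) (fieldG lam (iter lam n).1 (iter lam n).2))

theorem adm_iter (hlam : 0 < lam) (n : ℕ) : Adm lam (iter lam n).1 (iter lam n).2 := by
  induction n with
  | zero => exact adm_loF hlam
  | succ n ih => exact ih.step hlam

theorem iter_le_succ (hlam : 0 < lam) (n : ℕ) : (∀ y ∈ quad, (iter lam n).1 y ≤ (iter lam (n + 1)).1 y)
    ∧ ∀ y ∈ quad, (iter lam n).2 y ≤ (iter lam (n + 1)).2 y := by
  induction n with
  | zero => exact ⟨(adm_iter hlam 1).loF_le, (adm_iter hlam 1).nonneg⟩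
  | succ n ih =>
    obtain ⟨C, hC⟩ := exists_field_bound hlam
    have hM := shift_pos hlam
    have bF : ∀ n, ∀ y ∈ quad, |fieldF lam (iter lam n).1 (iter lam n).2 y| ≤ C := fun n v hv => by
      have := (hC _ _ (adm_iter hlam n) v hv).1
      exact abs_le.2 ⟨by linarith, this.2⟩
    have bG : ∀ n, ∀ y ∈ quad, |fieldG lam (iter lam n).1 (iter lam n).2 y| ≤ C := fun n v hv => by
      have := (hC _ _ (adm_iter hlam n) v hv).2
      exact abs_le.2 ⟨by linarith, this.2⟩
    have mF n := measurable_fieldF (lam := lam) (adm_iter hlam n).measF (adm_iter hlam n).measG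
    have mG n := measurable_fieldG (lam := lam) (adm_iter hlam n).measF (adm_iter hlam n).measG
    exact ⟨fun y _ => resolvOp_mono hM (mF n) (bF n) (mF (n + 1)) (bF (n + 1))
        (fun v hv => (adm_iter hlam n).fieldF_mono (adm_iter hlam (n + 1)) hlam ih.1 ih.2 hv) y,
      fun y _ => resolvOp_mono hM (mG n) (bG n) (mG (n + 1)) (bG (n + 1))
        (fun v hv => (adm_iter hlam n).fieldG_mono (adm_iter hlam (n + 1)) hlam ih.1 ih.2 hv) y⟩

/-- The fixed point of the monotone iteration. -/
theorem exists_fixed_point (hlam : 0 < lam) : ∃ (φ γ : ℝ × ℝ → ℝ) (C : ℝ), Continuous φ ∧ Continuous γ ∧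
    (∀ y ∈ quad, φ y.swap = φ y) ∧ (∀ y ∈ quad, 0 < φ y) ∧ (∀ y ∈ quad, y.1 * y.2 * φ y ^ 2 ≤ 1) ∧
    (∀ y ∈ quad, 0 ≤ γ y) ∧ (∀ y ∈ quad, y.1 * γ y ≤ 1) ∧
    (∀ y ∈ quad, |fieldF lam φ γ y| ≤ C) ∧ (∀ y ∈ quad, |fieldG lam φ γ y| ≤ C) ∧
    φ = resolvOp 4 4 (shift lam) (fieldF lam φ γ) ∧ γ = resolvOp 4 2 (shift lam) (fieldG lam φ γ) := by
  obtain ⟨C, hC⟩ := exists_field_bound hlam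
  have hM := shift_pos hlam
  set φ : ℝ × ℝ → ℝ := fun y => ⨆ n, (iter lam n).1 y with hφ
  set γ : ℝ × ℝ → ℝ := fun y => ⨆ n, (iter lam n).2 y with hγ
  have tφ : ∀ y ∈ quad, Tendsto (fun n => (iter lam n).1 y) atTop (𝓝 (φ y)) := fun y hy =>
    tendsto_atTop_ciSup (monotone_nat_of_le_succ fun n => (iter_le_succ hlam n).1 y hy)
      ⟨hiF lam y, by rintro _ ⟨n, rfl⟩; exact (adm_iter hlam n).le_hiF y hy⟩
  have tγ : ∀ y ∈ quad, Tendsto (fun n => (iter lam n).2 y) atTop (𝓝 (γ y)) := fun y hy =>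
    tendsto_atTop_ciSup (monotone_nat_of_le_succ fun n => (iter_le_succ hlam n).2 y hy)
      ⟨hiG lam y, by rintro _ ⟨n, rfl⟩; exact (adm_iter hlam n).le_hiG y hy⟩
  have adm : Adm lam φ γ := by
    refine ⟨Measurable.iSup fun n => (adm_iter hlam n).measF,
      Measurable.iSup fun n => (adm_iter hlam n).measG, fun y hy => ?_, fun y hy => ?_,
      fun y hy => ?_, fun y hy => ?_, fun y hy => ?_, fun y hy => ?_, fun y hy => ?_⟩
    · simp only [hφ]
      exact iSup_congr fun n => (adm_iter hlam n).symm y hy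
    · exact ge_of_tendsto' (tφ y hy) fun n => (adm_iter hlam n).loF_le y hy
    · exact le_of_tendsto' (tφ y hy) fun n => (adm_iter hlam n).le_hiF y hy
    · exact le_of_tendsto' (((tφ y hy).pow 2).const_mul _) fun n => (adm_iter hlam n).mul_sq_le y hy
    · exact ge_of_tendsto' (tγ y hy) fun n => (adm_iter hlam n).nonneg y hy
    · exact le_of_tendsto' (tγ y hy) fun n => (adm_iter hlam n).le_hiG y hy
    · exact le_of_tendsto' ((tγ y hy).const_mul _) fun n => (adm_iter hlam n).mul_le y hy
  have bF : ∀ φ γ, Adm lam φ γ → ∀ y ∈ quad, |fieldF lam φ γ y| ≤ C := fun φ γ h v hv => by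
    have := (hC _ _ h v hv).1
    exact abs_le.2 ⟨by linarith, this.2⟩
  have bG : ∀ φ γ, Adm lam φ γ → ∀ y ∈ quad, |fieldG lam φ γ y| ≤ C := fun φ γ h v hv => by
    have := (hC _ _ h v hv).2
    exact abs_le.2 ⟨by linarith, this.2⟩
  have eφ : ∀ y ∈ quad, φ y = resolvOp 4 4 (shift lam) (fieldF lam φ γ) y := fun y hy => by
    refine tendsto_nhds_unique ((tφ y hy).comp (tendsto_add_atTop_nat 1)) ?_
    refine tendsto_resolvOp hM (fun n => measurable_fieldF (adm_iter hlam n).measF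
      (adm_iter hlam n).measG) (fun n => bF _ _ (adm_iter hlam n)) (fun v hv => ?_) y
    have a := tφ v hv
    have b := tγ v hv
    have c := tγ _ (swap_mem_quad hv)
    unfold fieldF srcF
    exact a.mul (((((b.const_mul 2).sub ((b.pow 2).const_mul _)).add
      ((c.const_mul 2).sub ((c.pow 2).const_mul _))).const_add _).add
      ((((a.pow 2).const_mul _).const_sub 1).const_mul _))
  have eγ : ∀ y ∈ quad, γ y = resolvOp 4 2 (shift lam) (fieldG lam φ γ) y := fun y hy => by
    refine tendsto_nhds_unique ((tγ y hy).comp (tendsto_add_atTop_nat 1)) ?_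
    refine tendsto_resolvOp hM (fun n => measurable_fieldG (adm_iter hlam n).measF
      (adm_iter hlam n).measG) (fun n => bG _ _ (adm_iter hlam n)) (fun v hv => ?_) y
    have a := tφ v hv
    have b := tγ v hv
    unfold fieldG srcG
    exact (b.const_mul _).add (((a.pow 2).const_mul _).mul ((b.const_mul _).const_sub 1))
  have sF : ∀ y ∈ quad, fieldF lam φ γ y = fieldF lam (resolvOp 4 4 (shift lam) (fieldF lam φ γ))
      (resolvOp 4 2 (shift lam) (fieldG lam φ γ)) y := fun y hy => by
    simp only [fieldF] at eφ eγ ⊢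
    rw [← eφ y hy, ← eγ y hy, ← eγ _ (swap_mem_quad hy)]
  have sG : ∀ y ∈ quad, fieldG lam φ γ y = fieldG lam (resolvOp 4 4 (shift lam) (fieldF lam φ γ))
      (resolvOp 4 2 (shift lam) (fieldG lam φ γ)) y := fun y hy => by
    simp only [fieldG] at eφ eγ ⊢
    rw [← eφ y hy, ← eγ y hy]
  have adm' := adm.step hlam
  refine ⟨_, _, C, continuous_resolvOp hM (measurable_fieldF adm.measF adm.measG) (bF _ _ adm),
    continuous_resolvOp hM (measurable_fieldG adm.measF adm.measG) (bG _ _ adm), adm'.symm,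
    fun y hy => adm'.pos hlam hy, adm'.mul_sq_le, adm'.nonneg, adm'.mul_le, bF _ _ adm', bG _ _ adm',
    resolvOp_congr sF, resolvOp_congr sG⟩

end iteration

section polar

variable {p q : ℕ}

/-- The open quadrant. -/
def openQuad : Set (ℝ × ℝ) := Ioi 0 ×ˢ Ioi 0

theorem isOpen_openQuad : IsOpen openQuad := isOpen_Ioi.prod isOpen_Ioi

/-- Coordinatewise squaring. -/
def sqMap (r : ℝ × ℝ) : ℝ × ℝ := (r.1 ^ 2, r.2 ^ 2)

/-- Coordinatewise square root. -/
def sqrtMap (y : ℝ × ℝ) : ℝ × ℝ := (√y.1, √y.2)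

theorem sqMap_mem_openQuad {r : ℝ × ℝ} (hr : r ∈ openQuad) : sqMap r ∈ openQuad :=
  ⟨mem_Ioi.2 (pow_pos hr.1 2), mem_Ioi.2 (pow_pos hr.2 2)⟩

theorem sqMap_mem_quad (r : ℝ × ℝ) : sqMap r ∈ quad :=
  ⟨mem_Ici.2 (sq_nonneg _), mem_Ici.2 (sq_nonneg _)⟩

theorem sqrtMap_mem_openQuad {y : ℝ × ℝ} (hy : y ∈ openQuad) : sqrtMap y ∈ openQuad :=
  ⟨mem_Ioi.2 (Real.sqrt_pos.2 hy.1), mem_Ioi.2 (Real.sqrt_pos.2 hy.2)⟩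

theorem sqrtMap_sqMap {r : ℝ × ℝ} (hr : r ∈ openQuad) : sqrtMap (sqMap r) = r :=
  Prod.ext (Real.sqrt_sq (le_of_lt hr.1)) (Real.sqrt_sq (le_of_lt hr.2))

theorem sqMap_sqrtMap {y : ℝ × ℝ} (hy : y ∈ openQuad) : sqMap (sqrtMap y) = y :=
  Prod.ext (Real.sq_sqrt (le_of_lt hy.1)) (Real.sq_sqrt (le_of_lt hy.2))

theorem contDiff_sqMap {n : WithTop ℕ∞} : ContDiff ℝ n sqMap := by unfold sqMap; fun_prop

theorem contDiffOn_sqrtMap {n : WithTop ℕ∞} : ContDiffOn ℝ n sqrtMap openQuad :=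
  (contDiffOn_fst.sqrt fun _ hy => ne_of_gt hy.1).prodMk
    (contDiffOn_snd.sqrt fun _ hy => ne_of_gt hy.2)

/-- The monomial weight with real exponents. -/
def wt (a b : ℝ) (r : ℝ × ℝ) : ℝ := r.1 ^ a * r.2 ^ b

theorem wt_pos (a b : ℝ) {r : ℝ × ℝ} (hr : r ∈ openQuad) : 0 < wt a b r :=
  mul_pos (Real.rpow_pos_of_pos hr.1 _) (Real.rpow_pos_of_pos hr.2 _)

theorem contDiffOn_wt {n : WithTop ℕ∞} (a b : ℝ) : ContDiffOn ℝ n (wt a b) openQuad :=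
  (contDiffOn_fst.rpow_const_of_ne fun _ hy => ne_of_gt hy.1).mul
    (contDiffOn_snd.rpow_const_of_ne fun _ hy => ne_of_gt hy.2)

theorem hasDerivAt_fst_line {k : ℝ × ℝ → ℝ} {y : ℝ × ℝ} (hk : DifferentiableAt ℝ k y) :
    HasDerivAt (fun t => k (t, y.2)) (pd (1, 0) k y) y.1 :=
  hk.hasFDerivAt.comp_hasDerivAt y.1 ((hasDerivAt_id y.1).prodMk (hasDerivAt_const y.1 y.2))

theorem hasDerivAt_snd_line {k : ℝ × ℝ → ℝ} {y : ℝ × ℝ} (hk : DifferentiableAt ℝ k y) :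
    HasDerivAt (fun t => k (y.1, t)) (pd (0, 1) k y) y.2 :=
  hk.hasFDerivAt.comp_hasDerivAt y.2 ((hasDerivAt_const y.2 y.1).prodMk (hasDerivAt_id y.2))

/-- Smooth compactly supported functions are regular up to the boundary. -/
theorem radRegular_of_hasCompactSupport {θ : ℝ × ℝ → ℝ} (hθ : ContDiff ℝ ∞ θ)
    (sθ : HasCompactSupport θ) : ∃ C, RadRegular θ (pd (1, 0) θ) (pd (0, 1) θ)
      (pd (1, 0) (pd (1, 0) θ)) (pd (0, 1) (pd (0, 1) θ)) C := by
  have c₁ := pd_contDiff hθ (1, 0)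
  have c₂ := pd_contDiff hθ (0, 1)
  have c₁₁ := pd_contDiff c₁ (1, 0)
  have c₂₂ := pd_contDiff c₂ (0, 1)
  have s₁ := HasCompactSupport.pd sθ (1, 0)
  have s₂ := HasCompactSupport.pd sθ (0, 1)
  have s₁₁ := HasCompactSupport.pd s₁ (1, 0)
  have s₂₂ := HasCompactSupport.pd s₂ (0, 1)
  have key : ∀ (k l : ℝ × ℝ → ℝ), ContDiff ℝ ∞ k → HasCompactSupport k → Continuous l →
      ∃ C, ∀ y, |k y * l y| ≤ C := fun k l hk sk hl =>
    (hk.continuous.mul hl).bounded_above_of_compact_support sk.mul_right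
  obtain ⟨C₀, h₀⟩ := key _ (fun _ => 1) hθ sθ continuous_const
  obtain ⟨C₁, h₁⟩ := key _ (fun y => 1 + y.1) c₁ s₁ (by fun_prop)
  obtain ⟨C₂, h₂⟩ := key _ (fun y => 1 + y.2) c₂ s₂ (by fun_prop)
  obtain ⟨C₃, h₃⟩ := key _ (fun y => 1 + y.1) c₁₁ s₁₁ (by fun_prop)
  obtain ⟨C₄, h₄⟩ := key _ (fun y => 1 + y.2) c₂₂ s₂₂ (by fun_prop)
  refine ⟨max C₀ (max (max C₁ C₂) (max C₃ C₄)), ⟨fun y _ => ?_, fun y _ =>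
    hasDerivAt_fst_line (c₁.differentiable (by simp) y),
    fun y _ => hasDerivAt_snd_line (c₂.differentiable (by simp) y), c₁.continuous.continuousOn, c₂.continuous.continuousOn,
    c₁₁.continuous.continuousOn, c₂₂.continuous.continuousOn, fun y _ => ?_, fun y hy => ?_,
    fun y hy => ?_, fun y hy => ?_, fun y hy => ?_⟩⟩
  · have := (hθ.differentiable (by simp) y).hasFDerivAt
    refine this.congr_fderiv ?_
    ext <;> simp [pd]
  · exact le_max_of_le_left (by simpa using h₀ y)
  · have : 0 ≤ 1 + y.1 := by have : (0:ℝ) ≤ y.1 := hy.1; positivity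
    rw [← abs_of_nonneg this, ← abs_mul]
    exact (h₁ y).trans (by simp)
  · have : 0 ≤ 1 + y.2 := by have : (0:ℝ) ≤ y.2 := hy.2; positivity
    rw [← abs_of_nonneg this, ← abs_mul]
    exact (h₂ y).trans (by simp)
  · have : 0 ≤ 1 + y.1 := by have : (0:ℝ) ≤ y.1 := hy.1; positivity
    rw [← abs_of_nonneg this, ← abs_mul]
    exact (h₃ y).trans (by simp)
  · have : 0 ≤ 1 + y.2 := by have : (0:ℝ) ≤ y.2 := hy.2; positivity
    rw [← abs_of_nonneg this, ← abs_mul]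
    exact (h₄ y).trans (by simp)

theorem hasCompactSupport_comp_of_sq_le {E : Type*} [NormedAddCommGroup E] [ProperSpace E]
    {k : ℝ × ℝ → ℝ} (hk : HasCompactSupport k) {s : E → ℝ × ℝ} (hs : ∀ x, ‖x‖ ^ 2 ≤ ‖s x‖) :
    HasCompactSupport fun x => k (s x) := by
  obtain ⟨R, hR⟩ := hk.isCompact.isBounded.exists_norm_le
  refine HasCompactSupport.intro (isCompact_closedBall (0 : E) √R) fun x hx => ?_
  by_contra hne
  have h1 := (hs x).trans (hR _ (subset_tsupport _ hne))
  rw [mem_closedBall_zero_iff, not_le] at hx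
  exact absurd (Real.le_sqrt_of_sq_le h1) (not_le.2 hx)

theorem norm_sq_le_norm_sqMap (r : ℝ × ℝ) : ‖r‖ ^ 2 ≤ ‖sqMap r‖ := by
  rw [Prod.norm_def r]
  rcases max_cases ‖r.1‖ ‖r.2‖ with ⟨h, _⟩ | ⟨h, _⟩ <;> rw [h]
  · rw [← norm_pow]; exact norm_fst_le (sqMap r)
  · rw [← norm_pow]; exact norm_snd_le (sqMap r)

theorem norm_sq_le_norm_sqRad (x : Eu p × Eu q) : ‖x‖ ^ 2 ≤ ‖sqRad x‖ := by
  rw [Prod.norm_def x]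
  rcases max_cases ‖x.1‖ ‖x.2‖ with ⟨h, _⟩ | ⟨h, _⟩ <;> rw [h]
  · simp [sqRad]
  · simp [sqRad]

/-- Integration in polar coordinates in both factors. -/
theorem exists_integral_sqRad (p q : ℕ) [NeZero p] [NeZero q] : ∃ c : ℝ, 0 < c ∧
    ∀ k : ℝ × ℝ → ℝ, Continuous k → HasCompactSupport k →
      ∫ x : Eu p × Eu q, k (sqRad x)
        = c * ∫ r in openQuad, r.1 ^ (p - 1) * r.2 ^ (q - 1) * k (sqMap r) := by
  have hb : ∀ d : ℕ, 0 < (volume : Measure (Eu d)).real (Metric.ball 0 1) := fun d =>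
    ENNReal.toReal_pos (Metric.measure_ball_pos _ _ one_pos).ne' measure_ball_lt_top.ne
  have hp : 0 < (p : ℝ) := Nat.cast_pos.2 (NeZero.pos p)
  have hq : 0 < (q : ℝ) := Nat.cast_pos.2 (NeZero.pos q)
  refine ⟨(p * (volume : Measure (Eu p)).real (Metric.ball 0 1))
    * (q * (volume : Measure (Eu q)).real (Metric.ball 0 1)),
    mul_pos (mul_pos hp (hb p)) (mul_pos hq (hb q)), fun k hk sk => ?_⟩
  have i1 : Integrable fun x : Eu p × Eu q => k (sqRad x) :=
    (hk.comp continuous_sqRad).integrable_of_hasCompactSupport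
      (hasCompactSupport_comp_of_sq_le sk norm_sq_le_norm_sqRad)
  have i2 : Integrable fun r : ℝ × ℝ => r.1 ^ (p - 1) * r.2 ^ (q - 1) * k (sqMap r) := by
    have : Continuous fun r : ℝ × ℝ => r.1 ^ (p - 1) * r.2 ^ (q - 1) * k (sqMap r) := by
      have := (contDiff_sqMap (n := 0)).continuous
      fun_prop
    exact this.integrable_of_hasCompactSupport
      (hasCompactSupport_comp_of_sq_le sk norm_sq_le_norm_sqMap).mul_left
  have polar : ∀ (d : ℕ) [NeZero d] (l : ℝ → ℝ), ∫ x : Eu d, l ‖x‖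
      = (d * (volume : Measure (Eu d)).real (Metric.ball 0 1)) * ∫ y in Ioi (0:ℝ), y ^ (d - 1) * l y := by
    intro d _ l
    have := integral_fun_norm_addHaar (volume : Measure (Eu d)) l
    rw [this]
    simp [mul_assoc]
  rw [Measure.volume_eq_prod, integral_prod _ (by rwa [← Measure.volume_eq_prod])]
  have inner : ∀ x : Eu p, ∫ z : Eu q, k (sqRad (x, z)) = (fun s : ℝ =>
      (q * (volume : Measure (Eu q)).real (Metric.ball 0 1))
        * ∫ t in Ioi (0:ℝ), t ^ (q - 1) * k (s ^ 2, t ^ 2)) ‖x‖ := fun x =>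
    polar q fun t => k (‖x‖ ^ 2, t ^ 2)
  rw [integral_congr_ae (ae_of_all _ inner), polar p fun s =>
      (q * (volume : Measure (Eu q)).real (Metric.ball 0 1))
        * ∫ t in Ioi (0:ℝ), t ^ (q - 1) * k (s ^ 2, t ^ 2)]
  refine Eq.trans (congrArg _ ?_) (mul_assoc _ _ _).symm
  rw [openQuad, Measure.volume_eq_prod, setIntegral_prod _ (by
    rw [← Measure.volume_eq_prod]; exact i2.integrableOn), ← integral_const_mul]
  refine integral_congr_ae (ae_of_all _ fun s => ?_)
  simp only
  rw [mul_left_comm, ← integral_const_mul]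
  congr 1
  refine integral_congr_ae (ae_of_all _ fun t => ?_)
  simp only [sqMap]
  ring

end polar

section calculus
variable {K : ℝ × ℝ → ℝ} {r : ℝ × ℝ}

theorem hasDerivAt_rpow_mul_comp_sq {k : ℝ → ℝ} {s k' : ℝ} (a : ℝ) (hs : 0 < s)
    (hk : HasDerivAt k k' (s ^ 2)) :
    HasDerivAt (fun t => t ^ a * k (t ^ 2)) (a * (s ^ (a - 1) * k (s ^ 2))
      + 2 * (s ^ (a + 1) * k')) s := by
  have h1 := Real.hasDerivAt_rpow_const (p := a) (Or.inl hs.ne')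
  have h2 : HasDerivAt (fun t => k (t ^ 2)) (k' * (2 * s)) s := by
    have := HasDerivAt.comp (h := fun t : ℝ => t ^ 2) s hk (hasDerivAt_pow 2 s)
    simpa [Function.comp_def] using this
  refine (h1.mul h2).congr_deriv ?_
  rw [Real.rpow_add_one hs.ne']
  ring

theorem differentiableAt_wt_mul (a b : ℝ) (hr : r ∈ openQuad)
    (hK : DifferentiableAt ℝ K (sqMap r)) :
    DifferentiableAt ℝ (fun r => wt a b r * K (sqMap r)) r := by
  have h1 := ((contDiffOn_wt (n := 1) a b).contDiffAt (isOpen_openQuad.mem_nhds hr)).differentiableAt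
    (by simp)
  exact h1.mul (hK.comp r (contDiff_sqMap.differentiable (n := 1) (by simp) r))

theorem pd_fst_wt_mul (a b : ℝ) (hr : r ∈ openQuad) (hK : DifferentiableAt ℝ K (sqMap r)) :
    pd (1, 0) (fun r => wt a b r * K (sqMap r)) r = a * (wt (a - 1) b r * K (sqMap r))
      + 2 * (wt (a + 1) b r * pd (1, 0) K (sqMap r)) := by
  have h1 := hasDerivAt_fst_line (differentiableAt_wt_mul a b hr hK)
  have h2 := (hasDerivAt_rpow_mul_comp_sq a hr.1 (hasDerivAt_fst_line hK)).mul_const (r.2 ^ b)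
  refine (h1.congr_of_eventuallyEq (Eventually.of_forall fun t => ?_)).unique
    (h2.congr_deriv ?_)
  · simp only [wt, sqMap]; ring
  · simp only [wt, sqMap]; ring

theorem pd_snd_wt_mul (a b : ℝ) (hr : r ∈ openQuad) (hK : DifferentiableAt ℝ K (sqMap r)) :
    pd (0, 1) (fun r => wt a b r * K (sqMap r)) r = b * (wt a (b - 1) r * K (sqMap r))
      + 2 * (wt a (b + 1) r * pd (0, 1) K (sqMap r)) := by
  have h1 := hasDerivAt_snd_line (differentiableAt_wt_mul a b hr hK)
  have h2 := (hasDerivAt_rpow_mul_comp_sq b hr.2 (hasDerivAt_snd_line hK)).mul_const (r.1 ^ a)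
  refine (h1.congr_of_eventuallyEq (Eventually.of_forall fun t => ?_)).unique
    (h2.congr_deriv ?_)
  · simp only [wt, sqMap]; ring
  · simp only [wt, sqMap]; ring

theorem pd_congr {f g : ℝ × ℝ → ℝ} {x : ℝ × ℝ} (h : f =ᶠ[𝓝 x] g) (v : ℝ × ℝ) :
    pd v f =ᶠ[𝓝 x] pd v g := by
  filter_upwards [h.fderiv (𝕜 := ℝ)] with y hy
  simp [pd, hy]

theorem lap_congr {f g : ℝ × ℝ → ℝ} {x : ℝ × ℝ} (h : f =ᶠ[𝓝 x] g) : lap f x = lap g x := by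
  unfold lap
  rw [(pd_congr (pd_congr h (1, 0)) (1, 0)).eq_of_nhds, (pd_congr (pd_congr h (0, 1)) (0, 1)).eq_of_nhds]

theorem pd_const_mul {f : ℝ × ℝ → ℝ} {x : ℝ × ℝ} (hf : DifferentiableAt ℝ f x) (c : ℝ) (v : ℝ × ℝ) :
    pd v (fun y => c * f y) x = c * pd v f x := by
  unfold pd
  rw [fderiv_const_mul hf]
  simp

/-- The Laplacian of a weighted function of the squared coordinates. -/
theorem lap_wt_mul (a b : ℝ) (hK : ContDiffOn ℝ ∞ K openQuad) (hr : r ∈ openQuad) :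
    lap (fun r => wt a b r * K (sqMap r)) r = wt a b r *
      ((4 * r.1 ^ 2 * pd (1, 0) (pd (1, 0) K) (sqMap r) + (4 * a + 2) * pd (1, 0) K (sqMap r)
          + a * (a - 1) / r.1 ^ 2 * K (sqMap r))
        + (4 * r.2 ^ 2 * pd (0, 1) (pd (0, 1) K) (sqMap r) + (4 * b + 2) * pd (0, 1) K (sqMap r)
          + b * (b - 1) / r.2 ^ 2 * K (sqMap r))) := by
  have hO := isOpen_openQuad
  have dK : ∀ r ∈ openQuad, DifferentiableAt ℝ K (sqMap r) := fun r hr =>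
    (hK.contDiffAt (hO.mem_nhds (sqMap_mem_openQuad hr))).differentiableAt (by simp)
  have dpK : ∀ v, ∀ r ∈ openQuad, DifferentiableAt ℝ (pd v K) (sqMap r) := fun v r hr =>
    ((contDiffOn_pd hO hK v).contDiffAt (hO.mem_nhds (sqMap_mem_openQuad hr))).differentiableAt
      (by simp)
  have e1 : pd (1, 0) (fun r => wt a b r * K (sqMap r)) =ᶠ[𝓝 r] fun r =>
      a * (wt (a - 1) b r * K (sqMap r)) + 2 * (wt (a + 1) b r * pd (1, 0) K (sqMap r)) := by
    filter_upwards [hO.mem_nhds hr] with s hs using pd_fst_wt_mul a b hs (dK s hs)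
  have e2 : pd (0, 1) (fun r => wt a b r * K (sqMap r)) =ᶠ[𝓝 r] fun r =>
      b * (wt a (b - 1) r * K (sqMap r)) + 2 * (wt a (b + 1) r * pd (0, 1) K (sqMap r)) := by
    filter_upwards [hO.mem_nhds hr] with s hs using pd_snd_wt_mul a b hs (dK s hs)
  have r1 : 0 < r.1 := hr.1
  have r2 : 0 < r.2 := hr.2
  unfold lap
  rw [(pd_congr e1 _).eq_of_nhds, (pd_congr e2 _).eq_of_nhds,
    pd_add ((differentiableAt_wt_mul _ _ hr (dK r hr)).const_mul _)
      ((differentiableAt_wt_mul _ _ hr (dpK _ r hr)).const_mul _),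
    pd_add ((differentiableAt_wt_mul _ _ hr (dK r hr)).const_mul _)
      ((differentiableAt_wt_mul _ _ hr (dpK _ r hr)).const_mul _),
    pd_const_mul (differentiableAt_wt_mul _ _ hr (dK r hr)),
    pd_const_mul (differentiableAt_wt_mul _ _ hr (dpK _ r hr)),
    pd_const_mul (differentiableAt_wt_mul _ _ hr (dK r hr)),
    pd_const_mul (differentiableAt_wt_mul _ _ hr (dpK _ r hr)),
    pd_fst_wt_mul _ _ hr (dK r hr), pd_fst_wt_mul _ _ hr (dpK _ r hr),
    pd_snd_wt_mul _ _ hr (dK r hr), pd_snd_wt_mul _ _ hr (dpK _ r hr)]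
  simp only [wt, sub_add_cancel, add_sub_cancel_right, Real.rpow_add_one r1.ne',
    Real.rpow_add_one r2.ne', Real.rpow_sub_one r1.ne', Real.rpow_sub_one r2.ne']
  field_simp
  ring

end calculus

/-- The test function on the squared radii associated with a test function on the quadrant. -/
theorem exists_radial_test {ξ : ℝ × ℝ → ℝ} (hξ : ContDiff ℝ ∞ ξ) (sξ : HasCompactSupport ξ)
    (tξ : tsupport ξ ⊆ openQuad) (a b : ℝ) : ∃ θ : ℝ × ℝ → ℝ, ContDiff ℝ ∞ θ ∧ HasCompactSupport θ ∧
      ∀ r ∈ openQuad, ξ r = wt a b r * θ (sqMap r) := by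
  set θ : ℝ × ℝ → ℝ := fun y => (wt a b (sqrtMap y))⁻¹ * ξ (sqrtMap y) with hθ
  have hO := isOpen_openQuad
  have sub : Function.support θ ⊆ sqMap '' tsupport ξ := fun y hy => by
    have h1 : ξ (sqrtMap y) ≠ 0 := right_ne_zero_of_mul hy
    have h2 : sqrtMap y ∈ tsupport ξ := subset_tsupport _ h1
    have h3 := tξ h2
    have h4 : y ∈ openQuad := ⟨mem_Ioi.2 (Real.sqrt_pos.1 h3.1), mem_Ioi.2 (Real.sqrt_pos.1 h3.2)⟩
    exact ⟨_, h2, sqMap_sqrtMap h4⟩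
  have cpt : IsCompact (sqMap '' tsupport ξ) :=
    sξ.isCompact.image (contDiff_sqMap (n := 0)).continuous
  refine ⟨θ, contDiff_of_tsupport_subset (O := openQuad) ?_ hO ?_,
    HasCompactSupport.of_support_subset_isCompact cpt sub, fun r hr => ?_⟩
  · have m : MapsTo sqrtMap openQuad openQuad := fun y hy => sqrtMap_mem_openQuad hy
    exact (((contDiffOn_wt a b).comp contDiffOn_sqrtMap m).inv fun y hy =>
      (wt_pos a b (sqrtMap_mem_openQuad hy)).ne').mul (hξ.comp_contDiffOn contDiffOn_sqrtMap)
  · refine (closure_minimal sub cpt.isClosed).trans ?_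
    rintro _ ⟨r, hr, rfl⟩
    exact sqMap_mem_openQuad (tξ hr)
  · simp only [hθ, sqrtMap_sqMap hr]
    have := (wt_pos a b hr).ne'
    field_simp

/-- The resolvent equation in polar coordinates, in weak form with respect to the flat Laplacian of
the quadrant. -/
theorem integral_mul_lap_resolvOp {p q : ℕ} [NeZero p] [NeZero q] {M C a b : ℝ} {w : ℝ × ℝ → ℝ}
    (hM : 0 < M) (hw : Continuous w) (hb : ∀ y ∈ quad, |w y| ≤ C) (ha : 2 * a = p - 1)
    (hb' : 2 * b = q - 1) {ξ : ℝ × ℝ → ℝ} (hξ : ContDiff ℝ ∞ ξ) (sξ : HasCompactSupport ξ)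
    (tξ : tsupport ξ ⊆ openQuad) :
    ∫ r, wt a b r * resolvOp p q M w (sqMap r) * lap ξ r
      = ∫ r, wt a b r * ((M + (a * (a - 1) / r.1 ^ 2 + b * (b - 1) / r.2 ^ 2))
        * resolvOp p q M w (sqMap r) - w (sqMap r)) * ξ r := by
  obtain ⟨θ, hθ, sθ, eθ⟩ := exists_radial_test hξ sξ tξ a b
  obtain ⟨Cθ, reg⟩ := radRegular_of_hasCompactSupport hθ sθ
  obtain ⟨c, hc, polar⟩ := exists_integral_sqRad p q
  set φ := resolvOp p q M w with hφ
  have cφ : Continuous φ := continuous_resolvOp hM hw.measurable hb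
  set v : ℝ × ℝ → ℝ := fun y => M * θ y - radLap p q (pd (1, 0) θ) (pd (0, 1) θ)
    (pd (1, 0) (pd (1, 0) θ)) (pd (0, 1) (pd (0, 1) θ)) y with hv
  have cv : Continuous v := by
    have := hθ.continuous
    have := (pd_contDiff hθ (1, 0)).continuous
    have := (pd_contDiff hθ (0, 1)).continuous
    have := (pd_contDiff (pd_contDiff hθ (1, 0)) (1, 0)).continuous
    have := (pd_contDiff (pd_contDiff hθ (0, 1)) (0, 1)).continuous
    simp only [hv, radLap]
    fun_prop
  have sv : HasCompactSupport v := HasCompactSupport.intro sθ fun y hy => by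
    have z : ∀ e, y ∉ tsupport (pd e θ) := fun e h => hy (tsupport_pd_subset _ _ h)
    have z2 : ∀ e, pd e (pd e θ) y = 0 := fun e =>
      image_eq_zero_of_notMem_tsupport fun h => z e (tsupport_pd_subset _ _ h)
    simp [hv, radLap, image_eq_zero_of_notMem_tsupport hy, image_eq_zero_of_notMem_tsupport (z _), z2]
  have int : ∀ k : ℝ × ℝ → ℝ, Continuous k → HasCompactSupport k →
      Integrable fun x : Eu p × Eu q => k (sqRad x) := fun k hk sk =>
    (hk.comp continuous_sqRad).integrable_of_hasCompactSupport
      (hasCompactSupport_comp_of_sq_le sk norm_sq_le_norm_sqRad)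
  have main := reg.integral_integral_resolv_mul (p := p) (q := q) hM hw.measurable hb cv.measurable
    (fun _ _ => rfl) (int v cv sv)
  simp_rw [← resolvOp_sqRad hw.measurable] at main
  set k : ℝ × ℝ → ℝ := fun y => φ y * v y - w y * θ y with hk
  have k0 : ∫ x : Eu p × Eu q, k (sqRad x) = 0 := by
    simp only [hk]
    rw [integral_sub (int (fun y => φ y * v y) (cφ.mul cv) sv.mul_left)
      (int (fun y => w y * θ y) (hw.mul hθ.continuous) sθ.mul_left)]
    exact sub_eq_zero.2 main
  rw [polar k ((cφ.mul cv).sub (hw.mul hθ.continuous)) (sv.mul_left.sub sθ.mul_left)] at k0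
  have k1 := (mul_eq_zero.1 k0).resolve_left hc.ne'
  have hO := isOpen_openQuad
  have csq : Continuous sqMap := (contDiff_sqMap (n := 0)).continuous
  have cwt : ContinuousOn (wt a b) openQuad := (contDiffOn_wt (n := 0) a b).continuousOn
  have n1 : ∀ r ∈ openQuad, r.1 ^ 2 ≠ 0 := fun r hr => (pow_pos (mem_Ioi.1 hr.1) 2).ne'
  have n2 : ∀ r ∈ openQuad, r.2 ^ 2 ≠ 0 := fun r hr => (pow_pos (mem_Ioi.1 hr.2) 2).ne'
  have cU : ContinuousOn (fun r => wt a b r * φ (sqMap r)) openQuad :=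
    cwt.mul (cφ.comp csq).continuousOn
  have cF : ContinuousOn (fun r => wt a b r * ((M + (a * (a - 1) / r.1 ^ 2 + b * (b - 1) / r.2 ^ 2))
        * φ (sqMap r) - w (sqMap r))) openQuad := by
    have h1 := (cφ.comp csq).continuousOn (s := openQuad)
    have h2 := (hw.comp csq).continuousOn (s := openQuad)
    simp only [Function.comp_def] at h1 h2
    fun_prop (disch := assumption)
  have tl : tsupport (lap ξ) ⊆ tsupport ξ := by
    refine closure_minimal (fun y hy => ?_) (isClosed_tsupport _)
    by_contra h
    have z : ∀ e, y ∉ tsupport (pd e ξ) := fun e h' => h (tsupport_pd_subset _ _ h')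
    have z2 : ∀ e, pd e (pd e ξ) y = 0 := fun e =>
      image_eq_zero_of_notMem_tsupport fun h' => z e (tsupport_pd_subset _ _ h')
    exact hy (by simp [lap, z2])
  have iU := integrable_mul_of_tsupport_subset hO cU (lap_contDiff hξ).continuous
    (HasCompactSupport.lap sξ) (tl.trans tξ)
  have iF := integrable_mul_of_tsupport_subset hO cF hξ.continuous sξ tξ
  rw [← sub_eq_zero, ← integral_sub iU iF,
    ← setIntegral_eq_integral_of_forall_compl_eq_zero (s := openQuad), ← neg_eq_zero, ← integral_neg,
    ← k1]
  · refine setIntegral_congr_fun hO.measurableSet fun r hr => ?_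
    have r1 : 0 < r.1 := hr.1
    have r2 : 0 < r.2 := hr.2
    have el : lap ξ r = lap (fun r => wt a b r * θ (sqMap r)) r := lap_congr (by
      filter_upwards [hO.mem_nhds hr] with s hs using eθ s hs)
    have pw : ∀ {s : ℝ} {d : ℕ} [NeZero d] {e : ℝ}, 0 < s → 2 * e = d - 1 →
        s ^ (d - 1) = s ^ e * s ^ e := by
      intro s d _ e hs he
      rw [← Real.rpow_add hs, ← two_mul, he, ← Real.rpow_natCast,
        Nat.cast_pred (NeZero.pos d)]
    have hw2 : r.1 ^ (p - 1) * r.2 ^ (q - 1) = wt a b r * wt a b r := by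
      rw [pw r1 ha, pw r2 hb', wt]; ring
    simp only [hk, hv, radLap]
    rw [hw2, el, lap_wt_mul a b hθ.contDiffOn hr, eθ r hr]
    have hp : (2 * p : ℝ) = 4 * a + 2 := by linarith
    have hq : (2 * q : ℝ) = 4 * b + 2 := by linarith
    rw [hp, hq]
    simp only [sqMap]
    ring
  · intro r hr
    rw [image_eq_zero_of_notMem_tsupport fun h => hr (tξ h),
      image_eq_zero_of_notMem_tsupport fun h => hr (tξ (tl h))]
    simp

section regularity
variable {p q : ℕ} [NeZero p] [NeZero q] {M C a b : ℝ} {w φ : ℝ × ℝ → ℝ}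

/-- The right-hand side of the flat Poisson equation for the weighted resolvent. -/
def polarSrc (M a b : ℝ) (φ w : ℝ × ℝ → ℝ) (r : ℝ × ℝ) : ℝ :=
  wt a b r * ((M + (a * (a - 1) / r.1 ^ 2 + b * (b - 1) / r.2 ^ 2)) * φ (sqMap r) - w (sqMap r))

theorem contDiffOn_polarSrc {n : WithTop ℕ∞} (M a b : ℝ) (hφ : ContDiffOn ℝ n φ openQuad)
    (hw : ContDiffOn ℝ n w openQuad) : ContDiffOn ℝ n (polarSrc M a b φ w) openQuad := by
  have m : MapsTo sqMap openQuad openQuad := fun r hr => sqMap_mem_openQuad hr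
  have h1 := hφ.comp contDiff_sqMap.contDiffOn m
  have h2 := hw.comp contDiff_sqMap.contDiffOn m
  have n1 : ∀ r ∈ openQuad, r.1 ^ 2 ≠ 0 := fun r hr => (pow_pos (mem_Ioi.1 hr.1) 2).ne'
  have n2 : ∀ r ∈ openQuad, r.2 ^ 2 ≠ 0 := fun r hr => (pow_pos (mem_Ioi.1 hr.2) 2).ne'
  have q1 : ContDiffOn ℝ n (fun r : ℝ × ℝ => a * (a - 1) / r.1 ^ 2) openQuad :=
    contDiffOn_const.div (contDiffOn_fst.pow 2) n1
  have q2 : ContDiffOn ℝ n (fun r : ℝ × ℝ => b * (b - 1) / r.2 ^ 2) openQuad :=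
    contDiffOn_const.div (contDiffOn_snd.pow 2) n2
  exact (contDiffOn_wt a b).mul (((contDiffOn_const.add (q1.add q2)).mul h1).sub h2)

theorem weak_polar (hM : 0 < M) (hw : Continuous w) (hb : ∀ y ∈ quad, |w y| ≤ C)
    (ha : 2 * a = p - 1) (hb' : 2 * b = q - 1) (hφ : φ = resolvOp p q M w) (ξ : ℝ × ℝ → ℝ)
    (hξ : ContDiff ℝ ∞ ξ) (sξ : HasCompactSupport ξ) (tξ : tsupport ξ ⊆ openQuad) :
    ∫ r, wt a b r * φ (sqMap r) * lap ξ r = ∫ r, polarSrc M a b φ w r * ξ r := by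
  rw [hφ]
  exact integral_mul_lap_resolvOp hM hw hb ha hb' hξ sξ tξ

/-- The resolvent gains one derivative in the open quadrant. -/
theorem contDiffOn_succ_of_eq_resolvOp (hM : 0 < M) (hw : Continuous w) (hb : ∀ y ∈ quad, |w y| ≤ C)
    (ha : 2 * a = p - 1) (hb' : 2 * b = q - 1) (hφ : φ = resolvOp p q M w) {n : ℕ}
    (hn : ContDiffOn ℝ n φ openQuad) (hwn : ContDiffOn ℝ n w openQuad) :
    ContDiffOn ℝ (n + 1 : ℕ) φ openQuad := by
  have cφ : Continuous φ := hφ ▸ continuous_resolvOp hM hw.measurable hb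
  have cu : ContinuousOn (fun r => wt a b r * φ (sqMap r)) openQuad :=
    (contDiffOn_wt (n := 0) a b).continuousOn.mul
      (cφ.comp (contDiff_sqMap (n := 0)).continuous).continuousOn
  have hu := contDiffOn_succ_of_weak_poisson isOpen_openQuad cu (contDiffOn_polarSrc M a b hn hwn)
    (weak_polar hM hw hb ha hb' hφ)
  have m : MapsTo sqrtMap openQuad openQuad := fun y hy => sqrtMap_mem_openQuad hy
  refine ((hu.comp contDiffOn_sqrtMap m).div ((contDiffOn_wt a b).comp contDiffOn_sqrtMap m)
    fun y hy => (wt_pos a b (m hy)).ne').congr fun y hy => ?_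
  change φ y = wt a b (sqrtMap y) * φ (sqMap (sqrtMap y)) / wt a b (sqrtMap y)
  rw [sqMap_sqrtMap hy, mul_div_cancel_left₀ _ (wt_pos a b (m hy)).ne']

/-- The resolvent equation holds pointwise in the open quadrant. -/
theorem radLap_of_eq_resolvOp (hM : 0 < M) (hw : Continuous w) (hb : ∀ y ∈ quad, |w y| ≤ C)
    (ha : 2 * a = p - 1) (hb' : 2 * b = q - 1) (hφ : φ = resolvOp p q M w)
    (hn : ContDiffOn ℝ ∞ φ openQuad) {r : ℝ × ℝ} (hr : r ∈ openQuad) :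
    4 * r.1 ^ 2 * pd (1, 0) (pd (1, 0) φ) (sqMap r) + 2 * p * pd (1, 0) φ (sqMap r)
      + (4 * r.2 ^ 2 * pd (0, 1) (pd (0, 1) φ) (sqMap r) + 2 * q * pd (0, 1) φ (sqMap r))
      = M * φ (sqMap r) - w (sqMap r) := by
  have m : MapsTo sqMap openQuad openQuad := fun r hr => sqMap_mem_openQuad hr
  have cF : ContinuousOn (polarSrc M a b φ w) openQuad :=
    (contDiffOn_polarSrc (n := 0) M a b (hn.of_le (by simp))
      (contDiffOn_zero.2 hw.continuousOn)).continuousOn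
  have e := lap_eq_of_weak_poisson isOpen_openQuad
    ((contDiffOn_wt a b).mul (hn.comp contDiff_sqMap.contDiffOn m)) cF
    (weak_polar hM hw hb ha hb' hφ) hr
  have e' := lap_wt_mul a b hn hr
  simp only [Function.comp_def] at e
  rw [e', polarSrc] at e
  have := mul_left_cancel₀ (wt_pos a b hr).ne' e
  have hp : (2 * p : ℝ) = 4 * a + 2 := by linarith
  have hq : (2 * q : ℝ) = 4 * b + 2 := by linarith
  rw [hp, hq]
  linarith

end regularity

theorem continuous_fieldF {lam : ℝ} {φ γ : ℝ × ℝ → ℝ} (hφ : Continuous φ) (hγ : Continuous γ) :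
    Continuous (fieldF lam φ γ) := by
  have := hγ.comp continuous_swap
  unfold fieldF srcF
  simp only [Function.comp_def] at this
  fun_prop

theorem continuous_fieldG {lam : ℝ} {φ γ : ℝ × ℝ → ℝ} (hφ : Continuous φ) (hγ : Continuous γ) :
    Continuous (fieldG lam φ γ) := by
  unfold fieldG srcG
  fun_prop

theorem contDiffOn_fieldF {lam : ℝ} {φ γ : ℝ × ℝ → ℝ} {n : WithTop ℕ∞}
    (hφ : ContDiffOn ℝ n φ openQuad) (hγ : ContDiffOn ℝ n γ openQuad) :
    ContDiffOn ℝ n (fieldF lam φ γ) openQuad := by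
  have h : ContDiffOn ℝ n (fun y => γ y.swap) openQuad :=
    hγ.comp (contDiffOn_snd.prodMk contDiffOn_fst) fun y hy => ⟨hy.2, hy.1⟩
  have swapped : ∀ η : ℝ × ℝ → ℝ, ContDiffOn ℝ n η openQuad →
      ContDiffOn ℝ n (fun y => srcF lam (φ y) (γ y) (η y) y.1 y.2) openQuad := by
    intro η hη
    unfold srcF
    fun_prop
  exact swapped _ h

theorem contDiffOn_fieldG {lam : ℝ} {φ γ : ℝ × ℝ → ℝ} {n : WithTop ℕ∞}
    (hφ : ContDiffOn ℝ n φ openQuad) (hγ : ContDiffOn ℝ n γ openQuad) :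
    ContDiffOn ℝ n (fieldG lam φ γ) openQuad := by
  unfold fieldG srcG
  fun_prop

/-- The reduced profile in squared radii: a smooth solution of the desingularised system. -/
theorem exists_reduced_profile {lam : ℝ} (hlam : 0 < lam) : ∃ φ γ : ℝ × ℝ → ℝ,
    Continuous φ ∧ Continuous γ ∧ (∀ y ∈ quad, φ y.swap = φ y) ∧ (∀ y ∈ quad, 0 < φ y) ∧
    (∀ y ∈ quad, y.1 * y.2 * φ y ^ 2 ≤ 1) ∧ (∀ y ∈ quad, 0 ≤ γ y) ∧ (∀ y ∈ quad, y.1 * γ y ≤ 1) ∧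
    ContDiffOn ℝ ∞ φ openQuad ∧ ContDiffOn ℝ ∞ γ openQuad ∧
    (∀ r ∈ openQuad, 4 * r.1 ^ 2 * pd (1, 0) (pd (1, 0) φ) (sqMap r) + 8 * pd (1, 0) φ (sqMap r)
      + (4 * r.2 ^ 2 * pd (0, 1) (pd (0, 1) φ) (sqMap r) + 8 * pd (0, 1) φ (sqMap r))
      = shift lam * φ (sqMap r) - fieldF lam φ γ (sqMap r)) ∧
    (∀ r ∈ openQuad, 4 * r.1 ^ 2 * pd (1, 0) (pd (1, 0) γ) (sqMap r) + 8 * pd (1, 0) γ (sqMap r)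
      + (4 * r.2 ^ 2 * pd (0, 1) (pd (0, 1) γ) (sqMap r) + 4 * pd (0, 1) γ (sqMap r))
      = shift lam * γ (sqMap r) - fieldG lam φ γ (sqMap r)) := by
  obtain ⟨φ, γ, C, cφ, cγ, sφ, pφ, bφ, pγ, bγ, bF, bG, eφ, eγ⟩ := exists_fixed_point hlam
  have hM := shift_pos hlam
  have cF := continuous_fieldF (lam := lam) cφ cγ
  have cG := continuous_fieldG (lam := lam) cφ cγ
  have e4 : 2 * (3 / 2 : ℝ) = (4 : ℕ) - 1 := by norm_num
  have e2 : 2 * (1 / 2 : ℝ) = (2 : ℕ) - 1 := by norm_num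
  have smooth : ∀ n : ℕ, ContDiffOn ℝ n φ openQuad ∧ ContDiffOn ℝ n γ openQuad := by
    intro n
    induction n with
    | zero => exact ⟨contDiffOn_zero.2 cφ.continuousOn, contDiffOn_zero.2 cγ.continuousOn⟩
    | succ n ih =>
      exact ⟨contDiffOn_succ_of_eq_resolvOp hM cF bF e4 e4 eφ ih.1 (contDiffOn_fieldF ih.1 ih.2),
        contDiffOn_succ_of_eq_resolvOp hM cG bG e4 e2 eγ ih.2 (contDiffOn_fieldG ih.1 ih.2)⟩
  have s1 : ContDiffOn ℝ ∞ φ openQuad := contDiffOn_infty.2 fun n => (smooth n).1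
  have s2 : ContDiffOn ℝ ∞ γ openQuad := contDiffOn_infty.2 fun n => (smooth n).2
  refine ⟨φ, γ, cφ, cγ, sφ, pφ, bφ, pγ, bγ, s1, s2, fun r hr => ?_, fun r hr => ?_⟩
  · have := radLap_of_eq_resolvOp hM cF bF e4 e4 eφ s1 hr
    norm_num at this
    exact this
  · have := radLap_of_eq_resolvOp hM cG bG e4 e2 eγ s2 hr
    norm_num at this
    exact this

section partials
variable {f : ℝ → ℝ → ℝ} {a b : ℝ}

theorem d1_eq_pd (h : DifferentiableAt ℝ (Function.uncurry f) (a, b)) :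
    d1 f a b = pd (1, 0) (Function.uncurry f) (a, b) :=
  (hasDerivAt_fst_line h).deriv

theorem d2_eq_pd (h : DifferentiableAt ℝ (Function.uncurry f) (a, b)) :
    d2 f a b = pd (0, 1) (Function.uncurry f) (a, b) :=
  (hasDerivAt_snd_line h).deriv

theorem d1_d1_add_d2_d2 (h : ContDiffOn ℝ ∞ (Function.uncurry f) openQuad) (hr : (a, b) ∈ openQuad) :
    d1 (d1 f) a b + d2 (d2 f) a b = lap (Function.uncurry f) (a, b) := by
  have hO := isOpen_openQuad
  have df : ∀ r ∈ openQuad, DifferentiableAt ℝ (Function.uncurry f) r := fun r hr =>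
    (h.contDiffAt (hO.mem_nhds hr)).differentiableAt (by simp)
  have dp : ∀ v, DifferentiableAt ℝ (pd v (Function.uncurry f)) (a, b) := fun v =>
    ((contDiffOn_pd hO h v).contDiffAt (hO.mem_nhds hr)).differentiableAt (by simp)
  have e1 : (fun t => d1 f t b) =ᶠ[𝓝 a] fun t => pd (1, 0) (Function.uncurry f) (t, b) := by
    filter_upwards [isOpen_Ioi.mem_nhds hr.1] with t ht using d1_eq_pd (df _ ⟨ht, hr.2⟩)
  have e2 : (fun t => d2 f a t) =ᶠ[𝓝 b] fun t => pd (0, 1) (Function.uncurry f) (a, t) := by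
    filter_upwards [isOpen_Ioi.mem_nhds hr.2] with t ht using d2_eq_pd (df _ ⟨hr.1, ht⟩)
  rw [d1, d2, e1.deriv_eq, e2.deriv_eq, (hasDerivAt_fst_line (dp _)).deriv,
    (hasDerivAt_snd_line (dp _)).deriv, lap]

end partials

end SaddleProfile

open SaddleProfile

theorem saddle_profile_exists (lam : ℝ) (hlam : 0 < lam) :
    ∃ f g h : ℝ → ℝ → ℝ,
      -- smoothness on the open quadrant
      ContDiffOn ℝ (⊤ : ℕ∞) (Function.uncurry f) (Set.Ioi 0 ×ˢ Set.Ioi 0) ∧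
      ContDiffOn ℝ (⊤ : ℕ∞) (Function.uncurry g) (Set.Ioi 0 ×ˢ Set.Ioi 0) ∧
      ContDiffOn ℝ (⊤ : ℕ∞) (Function.uncurry h) (Set.Ioi 0 ×ˢ Set.Ioi 0) ∧
      -- 0 ≤ f, g, h ≤ 1 on the quadrant
      (∀ a b : ℝ, 0 < a → 0 < b →
        0 ≤ f a b ∧ f a b ≤ 1 ∧ 0 ≤ g a b ∧ g a b ≤ 1 ∧ 0 ≤ h a b ∧ h a b ≤ 1) ∧
      -- the reduced saddle system
      (∀ a b : ℝ, 0 < a → 0 < b →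
        (d1 (d1 f) a b + d2 (d2 f) a b + d1 f a b / a + d2 f a b / b
          - f a b * (1 - g a b) ^ 2 / a ^ 2 - f a b * (1 - h a b) ^ 2 / b ^ 2
          - lam / 2 * ((f a b) ^ 2 - 1) * f a b = 0) ∧
        (d1 (d1 g) a b + d2 (d2 g) a b - d1 g a b / a + d2 g a b / b
          + (f a b) ^ 2 - (f a b) ^ 2 * g a b = 0) ∧
        (d1 (d1 h) a b + d2 (d2 h) a b + d1 h a b / a - d2 h a b / b
          + (f a b) ^ 2 - (f a b) ^ 2 * h a b = 0)) ∧
      -- f extends continuously to the closed quadrant with zero boundary values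
      ContinuousOn (Function.uncurry f) (Set.Ici 0 ×ˢ Set.Ici 0) ∧
      (∀ r : ℝ, 0 ≤ r → f r 0 = 0 ∧ f 0 r = 0) ∧
      -- f is positive in the open quadrant
      (∀ a b : ℝ, 0 < a → 0 < b → 0 < f a b) ∧
      -- symmetry between g and h
      (∀ a b : ℝ, 0 < a → 0 < b → g a b = h b a) ∧
      -- g extends continuously up to the r₂-axis and vanishes there
      ContinuousOn (Function.uncurry g) (Set.Ici 0 ×ˢ Set.Ioi 0) ∧
      (∀ b : ℝ, 0 < b → g 0 b = 0) := by
  obtain ⟨φ, γ, cφ, cγ, sφ, pφ, bφ, pγ, bγ, s1, s2, eφ, eγ⟩ := exists_reduced_profile hlam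
  set f : ℝ → ℝ → ℝ := fun a b => wt 1 1 (a, b) * φ (sqMap (a, b)) with hf
  set g : ℝ → ℝ → ℝ := fun a b => wt 2 0 (a, b) * γ (sqMap (a, b)) with hg
  have f_eq : ∀ a b, f a b = a * b * φ (a ^ 2, b ^ 2) := fun a b => by simp [hf, wt, sqMap]
  have g_eq : ∀ a b, g a b = a ^ 2 * γ (a ^ 2, b ^ 2) := fun a b => by simp [hg, wt, sqMap]
  have uf : Function.uncurry f = fun r => wt 1 1 r * φ (sqMap r) := rfl
  have ug : Function.uncurry g = fun r => wt 2 0 r * γ (sqMap r) := rfl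
  have m : Set.MapsTo sqMap openQuad openQuad := fun r hr => sqMap_mem_openQuad hr
  have hO := isOpen_openQuad
  have smf : ContDiffOn ℝ (⊤ : ℕ∞) (Function.uncurry f) openQuad :=
    (contDiffOn_wt 1 1).mul (s1.comp contDiff_sqMap.contDiffOn m)
  have smg : ContDiffOn ℝ (⊤ : ℕ∞) (Function.uncurry g) openQuad :=
    (contDiffOn_wt 2 0).mul (s2.comp contDiff_sqMap.contDiffOn m)
  have f_symm : ∀ a b, f a b = f b a := fun a b => by
    have : φ (b ^ 2, a ^ 2) = φ (a ^ 2, b ^ 2) := sφ _ (sqMap_mem_quad (a, b))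
    rw [f_eq, f_eq, this, mul_comm a b]
  have f_pos : ∀ a b : ℝ, 0 < a → 0 < b → 0 < f a b := fun a b ha hb => by
    rw [f_eq]
    exact mul_pos (mul_pos ha hb) (pφ _ (sqMap_mem_quad (a, b)))
  have g_bd : ∀ a b : ℝ, 0 ≤ g a b ∧ g a b ≤ 1 := fun a b => by
    rw [g_eq]
    exact ⟨mul_nonneg (sq_nonneg a) (pγ _ (sqMap_mem_quad (a, b))), bγ _ (sqMap_mem_quad (a, b))⟩
  have dφ : ∀ {r}, r ∈ openQuad → DifferentiableAt ℝ φ (sqMap r) := fun hr =>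
    (s1.contDiffAt (hO.mem_nhds (m hr))).differentiableAt (by simp)
  have dγ : ∀ {r}, r ∈ openQuad → DifferentiableAt ℝ γ (sqMap r) := fun hr =>
    (s2.contDiffAt (hO.mem_nhds (m hr))).differentiableAt (by simp)
  have eqF : ∀ a b : ℝ, 0 < a → 0 < b → d1 (d1 f) a b + d2 (d2 f) a b + d1 f a b / a + d2 f a b / b
      - f a b * (1 - g a b) ^ 2 / a ^ 2 - f a b * (1 - g b a) ^ 2 / b ^ 2
      - lam / 2 * ((f a b) ^ 2 - 1) * f a b = 0 := fun a b ha hb => by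
    have hr : ((a, b) : ℝ × ℝ) ∈ openQuad := ⟨ha, hb⟩
    rw [d1_d1_add_d2_d2 smf hr, d1_eq_pd (f := f) (differentiableAt_wt_mul 1 1 hr (dφ hr)),
      d2_eq_pd (f := f) (differentiableAt_wt_mul 1 1 hr (dφ hr)), uf, lap_wt_mul 1 1 s1 hr,
      pd_fst_wt_mul 1 1 hr (dφ hr), pd_snd_wt_mul 1 1 hr (dφ hr), f_eq, g_eq, g_eq]
    have e := eφ _ hr
    simp only [fieldF, srcF, sqMap, Prod.swap_prod_mk, wt] at e ⊢
    norm_num at e ⊢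
    field_simp
    linear_combination (2 * a ^ 2 * b ^ 2) * e
  have eqG : ∀ a b : ℝ, 0 < a → 0 < b → d1 (d1 g) a b + d2 (d2 g) a b - d1 g a b / a + d2 g a b / b
      + (f a b) ^ 2 - (f a b) ^ 2 * g a b = 0 := fun a b ha hb => by
    have hr : ((a, b) : ℝ × ℝ) ∈ openQuad := ⟨ha, hb⟩
    rw [d1_d1_add_d2_d2 smg hr, d1_eq_pd (f := g) (differentiableAt_wt_mul 2 0 hr (dγ hr)),
      d2_eq_pd (f := g) (differentiableAt_wt_mul 2 0 hr (dγ hr)), ug, lap_wt_mul 2 0 s2 hr,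
      pd_fst_wt_mul 2 0 hr (dγ hr), pd_snd_wt_mul 2 0 hr (dγ hr), f_eq, g_eq]
    have e := eγ _ hr
    simp only [fieldG, srcG, sqMap, wt] at e ⊢
    norm_num at e ⊢
    field_simp
    linear_combination (a ^ 2) * e
  refine ⟨f, g, fun a b => g b a, smf, smg, ?_, fun a b ha hb => ⟨(f_pos a b ha hb).le, ?_,
    (g_bd a b).1, (g_bd a b).2, (g_bd b a).1, (g_bd b a).2⟩, fun a b ha hb => ⟨eqF a b ha hb,
    eqG a b ha hb, ?_⟩, ?_, fun r _ => ⟨by simp [f_eq], by simp [f_eq]⟩, f_pos, fun _ _ _ _ => rfl,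
    ?_, fun b _ => by simp [g_eq]⟩
  · exact smg.comp (contDiffOn_snd.prodMk contDiffOn_fst) fun y hy => ⟨hy.2, hy.1⟩
  · have := bφ _ (sqMap_mem_quad (a, b))
    refine (sq_le_one_iff₀ (f_pos a b ha hb).le).1 ?_
    rw [f_eq]
    refine le_trans (le_of_eq ?_) this
    simp only [sqMap]
    ring
  · have e := eqG b a hb ha
    rw [f_symm a b]
    simp only [d1, d2] at e ⊢
    linarith
  · have : Continuous (Function.uncurry f) := by
      have : Function.uncurry f = fun r => r.1 * r.2 * φ (r.1 ^ 2, r.2 ^ 2) :=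
        funext fun r => f_eq r.1 r.2
      rw [this]
      fun_prop
    exact this.continuousOn
  · have : Continuous (Function.uncurry g) := by
      have : Function.uncurry g = fun r => r.1 ^ 2 * γ (r.1 ^ 2, r.2 ^ 2) :=
        funext fun r => g_eq r.1 r.2
      rw [this]
      fun_prop
    exact this.continuousOn

end
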